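/- arXiv:2202.00854 — 3 statements merged into one kernel-verified Lean document; each statement's English description precedes it below -/
import Mathlib

section
/- If a reduced graph contains an induced cycle of even length at least 8, then it is bipartite. -/
/-! Common definitions: arc/interval representations, graph classes,
induced subgraph containment, small named graphs, reduced graphs. -/

/-- The point of the unit circle corresponding to parameter `t`. -/
noncomputable def circlePt (t : ℝ) : ℝ × ℝ :=
  (Real.cos (2 * Real.pi * t), Real.sin (2 * Real.pi * t))

/-- A (nonempty closed) arc of the unit circle: the image under
`t ↦ (cos 2πt, sin 2πt)` of a closed interval `[a, b] ⊆ ℝ` with `0 ≤ b - a < 1`. -/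
def IsUnitCircleArc (A : Set (ℝ × ℝ)) : Prop :=
  ∃ a b : ℝ, 0 ≤ b - a ∧ b - a < 1 ∧ A = circlePt '' Set.Icc a b

/-- An arc representation of a graph: each vertex gets an arc of the unit circle,
and two distinct vertices are adjacent iff their arcs intersect. -/
def IsArcRep {V : Type*} (G : SimpleGraph V) (f : V → Set (ℝ × ℝ)) : Prop :=
  (∀ v, IsUnitCircleArc (f v)) ∧
    ∀ u v : V, u ≠ v → (G.Adj u v ↔ (f u ∩ f v).Nonempty)

/-- A family of sets is proper if no member is properly contained in another. -/
def ProperFamily {V α : Type*} (f : V → Set α) : Prop :=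
  ∀ u v : V, ¬ f u ⊂ f v

/-- A family of sets is Helly if every subfamily of pairwise intersecting sets
has a common point. -/
def HellyFamily {V α : Type*} (f : V → Set α) : Prop :=
  ∀ S : Set V, (∀ u ∈ S, ∀ v ∈ S, (f u ∩ f v).Nonempty) → (⋂ v ∈ S, f v).Nonempty

/-- A proper circular-arc graph: admits an arc representation with no arc
properly contained in another. -/
def IsProperCircularArcGraph {V : Type*} (G : SimpleGraph V) : Prop :=
  ∃ f : V → Set (ℝ × ℝ), IsArcRep G f ∧ ProperFamily f

/-- A proper Helly circular-arc graph: admits an arc representation that is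
simultaneously proper and Helly. -/
def IsProperHellyCircularArcGraph {V : Type*} (G : SimpleGraph V) : Prop :=
  ∃ f : V → Set (ℝ × ℝ), IsArcRep G f ∧ ProperFamily f ∧ HellyFamily f

/-- An interval representation: each vertex gets a nonempty closed bounded
interval of ℝ; distinct vertices adjacent iff intervals intersect. -/
def IsIntervalRep {V : Type*} (G : SimpleGraph V) (f : V → Set ℝ) : Prop :=
  (∀ v, ∃ a b : ℝ, a ≤ b ∧ f v = Set.Icc a b) ∧
    ∀ u v : V, u ≠ v → (G.Adj u v ↔ (f u ∩ f v).Nonempty)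

def IsIntervalGraph {V : Type*} (G : SimpleGraph V) : Prop :=
  ∃ f : V → Set ℝ, IsIntervalRep G f

def IsProperIntervalGraph {V : Type*} (G : SimpleGraph V) : Prop :=
  ∃ f : V → Set ℝ, IsIntervalRep G f ∧ ProperFamily f

/-- A graph is bipartite: its vertices can be partitioned into two independent sets. -/
def IsBipartite {V : Type*} (G : SimpleGraph V) : Prop :=
  ∃ c : V → Bool, ∀ u v : V, G.Adj u v → c u ≠ c v

/-- A permutation graph. -/
def IsPermutationGraph {V : Type*} (G : SimpleGraph V) : Prop :=
  ∃ a b : V → ℝ, Function.Injective a ∧ Function.Injective b ∧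
    ∀ u v : V, u ≠ v → (G.Adj u v ↔ (a u - a v) * (b u - b v) < 0)

def IsBipartitePermutationGraph {V : Type*} (G : SimpleGraph V) : Prop :=
  IsPermutationGraph G ∧ IsBipartite G

/-- `f : ZMod ℓ → V` is an induced (chordless) cycle of length `ℓ ≥ 3` in `G`:
`f` is injective and two images are adjacent iff their indices are consecutive mod `ℓ`. -/
def IsInducedCycle {V : Type*} (G : SimpleGraph V) (ℓ : ℕ) (f : ZMod ℓ → V) : Prop :=
  3 ≤ ℓ ∧ Function.Injective f ∧
    ∀ i j : ZMod ℓ, G.Adj (f i) (f j) ↔ (i = j + 1 ∨ j = i + 1)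

/-- `G` contains `H` as an induced subgraph. -/
def ContainsInduced {V W : Type*} (G : SimpleGraph V) (H : SimpleGraph W) : Prop :=
  ∃ f : W → V, Function.Injective f ∧ ∀ u v : W, H.Adj u v ↔ G.Adj (f u) (f v)

/-- `G` contains `C_ℓ*`: an induced cycle of length `ℓ` together with a vertex
adjacent to no vertex of the cycle. -/
def HasCycleStar {V : Type*} (G : SimpleGraph V) (ℓ : ℕ) : Prop :=
  ∃ (f : ZMod ℓ → V) (v : V), IsInducedCycle G ℓ f ∧ ∀ i : ZMod ℓ, ¬ G.Adj v (f i)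

/-- A maximal clique. -/
def IsMaxClique {V : Type*} (G : SimpleGraph V) (s : Set V) : Prop :=
  G.IsClique s ∧ ∀ t : Set V, G.IsClique t → s ⊆ t → t = s

/-- A clique path: a linear arrangement of all maximal cliques of `G` such that
the cliques containing any fixed vertex are consecutive. -/
def IsCliquePath {W : Type*} (G : SimpleGraph W) (q : ℕ) (K : Fin q → Set W) : Prop :=
  Function.Injective K ∧ (∀ i, IsMaxClique G (K i)) ∧
    (∀ s : Set W, IsMaxClique G s → ∃ i, K i = s) ∧
    ∀ (v : W) (i j k : Fin q), i ≤ j → j ≤ k → v ∈ K i → v ∈ K k → v ∈ K j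

/-- A circular interval of residues mod `n`: `{p, p+1, …, p+m}`. -/
def IsCircInterval {n : ℕ} (s : Set (ZMod n)) : Prop :=
  ∃ (p : ZMod n) (m : ℕ), s = {x : ZMod n | ∃ k : ℕ, k ≤ m ∧ x = p + (k : ZMod n)}

/-! ### Small named graphs -/

/-- The claw `K_{1,3}`. -/
def clawG : SimpleGraph (Fin 4) := SimpleGraph.fromRel (fun u _ => u = 0)

/-- The net: a triangle `{0,1,2}` with pendant vertices `3,4,5` attached to
`0,1,2` respectively. -/
def netG : SimpleGraph (Fin 6) :=
  SimpleGraph.fromRel (fun u v => (u.val < 3 ∧ v.val < 3) ∨ v.val = u.val + 3)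

/-- The tent `S_3`: triangle `{0,1,2}`, independent set `{3,4,5}`, with
`3 ~ 0,1`, `4 ~ 1,2`, `5 ~ 2,0`. -/
def tentS3 : SimpleGraph (Fin 6) :=
  SimpleGraph.fromRel (fun u v =>
    (u.val < 3 ∧ v.val < 3) ∨ (u = 3 ∧ (v = 0 ∨ v = 1)) ∨
      (u = 4 ∧ (v = 1 ∨ v = 2)) ∨ (u = 5 ∧ (v = 2 ∨ v = 0)))

/-- `S_3*`: the tent together with an isolated vertex `6`. -/
def S3star : SimpleGraph (Fin 7) :=
  SimpleGraph.fromRel (fun u v =>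
    (u.val < 3 ∧ v.val < 3) ∨ (u = 3 ∧ (v = 0 ∨ v = 1)) ∨
      (u = 4 ∧ (v = 1 ∨ v = 2)) ∨ (u = 5 ∧ (v = 2 ∨ v = 0)))

/-- The complement of `S_3*`. -/
def compS3star : SimpleGraph (Fin 7) := S3starᶜ

/-- The complement of `C_4*`: two edges `0-2`, `1-3` plus a universal vertex `4`. -/
def compC4star : SimpleGraph (Fin 5) :=
  SimpleGraph.fromRel (fun u v => (u = 0 ∧ v = 2) ∨ (u = 1 ∧ v = 3) ∨ u = 4)

/-- The chordless cycle `C_6`. -/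
def cycle6G : SimpleGraph (Fin 6) :=
  SimpleGraph.fromRel (fun u v => v.val = (u.val + 1) % 6)

/-- The complement of `C_6`. -/
def compC6 : SimpleGraph (Fin 6) := cycle6Gᶜ

/-- The wheel `W_4`: a `C_4` on `{0,1,2,3}` plus a hub `4`. -/
def W4G : SimpleGraph (Fin 5) :=
  SimpleGraph.fromRel (fun u v => (u.val < 4 ∧ v.val = (u.val + 1) % 4) ∨ v = 4)

/-- The wheel `W_5`: a `C_5` on `{0,…,4}` plus a hub `5`. -/
def W5G : SimpleGraph (Fin 6) :=
  SimpleGraph.fromRel (fun u v => (u.val < 5 ∧ v.val = (u.val + 1) % 5) ∨ v = 5)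

/-- `F_1` (the long claw): the claw with each edge subdivided once. -/
def F1G : SimpleGraph (Fin 7) :=
  SimpleGraph.fromRel (fun u v =>
    (u = 0 ∧ v = 1) ∨ (u = 1 ∧ v = 2) ∨ (u = 0 ∧ v = 3) ∨ (u = 3 ∧ v = 4) ∨
      (u = 0 ∧ v = 5) ∨ (u = 5 ∧ v = 6))

/-- `F_2`: a `C_4` `0-1-2-3-0` with pendant vertices `4,5,6` attached to `0,2,3`. -/
def F2G : SimpleGraph (Fin 7) :=
  SimpleGraph.fromRel (fun u v =>
    (u = 0 ∧ v = 1) ∨ (u = 1 ∧ v = 2) ∨ (u = 2 ∧ v = 3) ∨ (u = 3 ∧ v = 0) ∨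
      (u = 0 ∧ v = 4) ∨ (u = 2 ∧ v = 5) ∨ (u = 3 ∧ v = 6))

/-- `F_3`: a `C_6` `0-1-2-3-4-5-0` with chord `0-3` and pendant `6` at `0`. -/
def F3G : SimpleGraph (Fin 7) :=
  SimpleGraph.fromRel (fun u v =>
    (u.val < 6 ∧ v.val = (u.val + 1) % 6) ∨ (u = 0 ∧ v = 3) ∨ (u = 0 ∧ v = 6))

/-- `F_4`: a `C_6` `0-1-2-3-4-5-0` with chord `0-3` and a vertex `6` adjacent
exactly to `0` and `3`. -/
def F4G : SimpleGraph (Fin 7) :=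
  SimpleGraph.fromRel (fun u v =>
    (u.val < 6 ∧ v.val = (u.val + 1) % 6) ∨ (u = 0 ∧ v = 3) ∨ (u = 6 ∧ (v = 0 ∨ v = 3)))

/-- A reduced graph: connected, co-connected, and containing none of
`C_3*`, `C_5*`, the complement of `C_4*`, `C_6`, `S_3`, the complement of `S_3*`,
`F_1`, `F_2`, `F_3`, `F_4` as induced subgraphs. -/
def IsReducedGraph {V : Type*} (R : SimpleGraph V) : Prop :=
  R.Connected ∧ Rᶜ.Connected ∧
    ¬ HasCycleStar R 3 ∧ ¬ HasCycleStar R 5 ∧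
    ¬ ContainsInduced R compC4star ∧
    ¬ (∃ f : ZMod 6 → V, IsInducedCycle R 6 f) ∧
    ¬ ContainsInduced R tentS3 ∧
    ¬ ContainsInduced R compS3star ∧
    ¬ ContainsInduced R F1G ∧ ¬ ContainsInduced R F2G ∧
    ¬ ContainsInduced R F3G ∧ ¬ ContainsInduced R F4G

/-- A map realizing the prescribed adjacencies of a relation without false twins is injective. -/
theorem injective_of_adj_iff {V W : Type*} {G : SimpleGraph V} {r : W → W → Prop} {f : W → V}
    (htwin : ∀ i j, (∀ k, r i k ↔ r j k) → i = j)
    (hadj : ∀ i j, G.Adj (f i) (f j) ↔ r i j) : Function.Injective f := fun i j h =>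
  htwin i j fun k => by rw [← hadj, ← hadj, h]

/-- In a `C_3*`-free graph, every triangle is dominating. -/
theorem adj_triangle {V : Type*} {R : SimpleGraph V} (hR : ¬ HasCycleStar R 3) {a b c : V} (x : V)
    (hab : R.Adj a b) (hbc : R.Adj b c) (hac : R.Adj a c) :
    R.Adj x a ∨ R.Adj x b ∨ R.Adj x c := by
  by_contra! hx
  have hinj : Function.Injective (![a, b, c] : Fin 3 → V) :=
    injective_of_adj_iff (G := R) (r := fun i j => i ≠ j) (by decide) fun i j => by
      fin_cases i <;> fin_cases j <;> simp [hab, hbc, hac, hab.symm, hbc.symm, hac.symm]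
  have key : ∀ i j : Fin 3, R.Adj (![a, b, c] i) (![a, b, c] j) ↔ (i = j + 1 ∨ j = i + 1) := by
    intro i j
    fin_cases i <;> fin_cases j <;> simp [hab, hbc, hac, hab.symm, hbc.symm, hac.symm]
  refine hR ⟨(![a, b, c] : Fin 3 → V), x, ⟨le_rfl, hinj, key⟩, fun i => ?_⟩
  fin_cases i
  exacts [hx.1, hx.2.1, hx.2.2]

/-- In a `C_5*`-free graph, every induced five-cycle is dominating. -/
theorem adj_pentagon {V : Type*} {R : SimpleGraph V} (hR : ¬ HasCycleStar R 5)
    {a b c d e : V} (x : V)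
    (hab : R.Adj a b) (hbc : R.Adj b c) (hcd : R.Adj c d) (hde : R.Adj d e) (hea : R.Adj e a)
    (hac : ¬ R.Adj a c) (had : ¬ R.Adj a d) (hbd : ¬ R.Adj b d) (hbe : ¬ R.Adj b e)
    (hce : ¬ R.Adj c e) :
    R.Adj x a ∨ R.Adj x b ∨ R.Adj x c ∨ R.Adj x d ∨ R.Adj x e := by
  by_contra! hx
  have key : ∀ i j : Fin 5, R.Adj (![a, b, c, d, e] i) (![a, b, c, d, e] j) ↔
      (i = j + 1 ∨ j = i + 1) := by
    intro i j
    fin_cases i <;> fin_cases j <;>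
      simp [hab, hbc, hcd, hde, hea, hab.symm, hbc.symm, hcd.symm, hde.symm, hea.symm, hac, had,
        hbd, hbe, hce, mt R.adj_symm hac, mt R.adj_symm had, mt R.adj_symm hbd,
        mt R.adj_symm hbe, mt R.adj_symm hce]
  have hinj := injective_of_adj_iff (by decide) key
  refine hR ⟨(![a, b, c, d, e] : Fin 5 → V), x,
    ⟨by norm_num, hinj, key⟩, fun i => ?_⟩
  fin_cases i
  exacts [hx.1, hx.2.1, hx.2.2.1, hx.2.2.2.1, hx.2.2.2.2]

theorem not_hexagon {V : Type*} {R : SimpleGraph V} (hR : ¬ ∃ f : ZMod 6 → V, IsInducedCycle R 6 f)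
    {a b c d e x : V}
    (hab : R.Adj a b) (hbc : R.Adj b c) (hcd : R.Adj c d) (hde : R.Adj d e) (hex : R.Adj e x)
    (hxa : R.Adj x a) (hac : ¬ R.Adj a c) (had : ¬ R.Adj a d) (hae : ¬ R.Adj a e)
    (hbd : ¬ R.Adj b d) (hbe : ¬ R.Adj b e) (hbx : ¬ R.Adj b x) (hce : ¬ R.Adj c e)
    (hcx : ¬ R.Adj c x) (hdx : ¬ R.Adj d x) : False := by
  have key : ∀ i j : Fin 6, R.Adj (![a, b, c, d, e, x] i) (![a, b, c, d, e, x] j) ↔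
      (i = j + 1 ∨ j = i + 1) := by
    intro i j
    fin_cases i <;> fin_cases j <;>
      simp [hab, hbc, hcd, hde, hex, hxa, hab.symm, hbc.symm, hcd.symm, hde.symm, hex.symm,
        hxa.symm, hac, had, hae, hbd, hbe, hbx, hce, hcx, hdx, mt R.adj_symm hac,
        mt R.adj_symm had, mt R.adj_symm hae, mt R.adj_symm hbd, mt R.adj_symm hbe,
        mt R.adj_symm hbx, mt R.adj_symm hce, mt R.adj_symm hcx, mt R.adj_symm hdx]
  have hinj := injective_of_adj_iff (by decide) key
  exact hR ⟨(![a, b, c, d, e, x] : Fin 6 → V),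
    by norm_num, hinj, key⟩

/-- The complement of `C_4*` is the butterfly: two triangles sharing one vertex. -/
theorem not_butterfly {V : Type*} {R : SimpleGraph V} (hR : ¬ ContainsInduced R compC4star)
    {a b c d x : V} (hac : R.Adj a c) (hbd : R.Adj b d)
    (hxa : R.Adj x a) (hxb : R.Adj x b) (hxc : R.Adj x c) (hxd : R.Adj x d)
    (hab : ¬ R.Adj a b) (had : ¬ R.Adj a d) (hbc : ¬ R.Adj b c) (hcd : ¬ R.Adj c d) : False := by
  have key : ∀ i j, R.Adj (![a, b, c, d, x] i) (![a, b, c, d, x] j) ↔ compC4star.Adj i j := by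
    intro i j
    fin_cases i <;> fin_cases j <;>
      simp [compC4star, hac, hbd, hxa, hxb, hxc, hxd, hac.symm, hbd.symm, hxa.symm, hxb.symm,
        hxc.symm, hxd.symm, hab, had, hbc, hcd, mt R.adj_symm hab, mt R.adj_symm had,
        mt R.adj_symm hbc, mt R.adj_symm hcd]
  let _ : DecidableRel compC4star.Adj := inferInstanceAs (DecidableRel (SimpleGraph.fromRel _).Adj)
  exact hR ⟨_, injective_of_adj_iff (by decide) key, fun u v => (key u v).symm⟩

/-- The long claw with centre `c` and legs `c - a₁ - a₂`, `c - b₁ - b₂`, `c - d₁ - d₂`. -/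
theorem not_longClaw {V : Type*} {R : SimpleGraph V} (hR : ¬ ContainsInduced R F1G)
    {c a₁ a₂ b₁ b₂ d₁ d₂ : V} (hca : R.Adj c a₁) (ha : R.Adj a₁ a₂) (hcb : R.Adj c b₁)
    (hb : R.Adj b₁ b₂) (hcd : R.Adj c d₁) (hd : R.Adj d₁ d₂)
    (n₁ : ¬ R.Adj c a₂) (n₂ : ¬ R.Adj c b₂) (n₃ : ¬ R.Adj c d₂)
    (n₄ : ¬ R.Adj a₁ b₁) (n₅ : ¬ R.Adj a₁ b₂) (n₆ : ¬ R.Adj a₂ b₁) (n₇ : ¬ R.Adj a₂ b₂)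
    (n₈ : ¬ R.Adj d₁ a₁) (n₉ : ¬ R.Adj d₁ a₂) (m₁ : ¬ R.Adj d₂ a₁) (m₂ : ¬ R.Adj d₂ a₂)
    (m₃ : ¬ R.Adj d₁ b₁) (m₄ : ¬ R.Adj d₁ b₂) (m₅ : ¬ R.Adj d₂ b₁) (m₆ : ¬ R.Adj d₂ b₂) :
    False := by
  have key : ∀ i j, R.Adj (![c, a₁, a₂, b₁, b₂, d₁, d₂] i) (![c, a₁, a₂, b₁, b₂, d₁, d₂] j) ↔
      F1G.Adj i j := by
    intro i j
    fin_cases i <;> fin_cases j <;>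
      simp [F1G, hca, ha, hcb, hb, hcd, hd, hca.symm, ha.symm, hcb.symm, hb.symm, hcd.symm,
        hd.symm, n₁, n₂, n₃, n₄, n₅, n₆, n₇, n₈, n₉, m₁, m₂, m₃, m₄, m₅, m₆,
        mt R.adj_symm n₁, mt R.adj_symm n₂, mt R.adj_symm n₃, mt R.adj_symm n₄,
        mt R.adj_symm n₅, mt R.adj_symm n₆, mt R.adj_symm n₇, mt R.adj_symm n₈,
        mt R.adj_symm n₉, mt R.adj_symm m₁, mt R.adj_symm m₂, mt R.adj_symm m₃,
        mt R.adj_symm m₄, mt R.adj_symm m₅, mt R.adj_symm m₆]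
  let _ : DecidableRel F1G.Adj := inferInstanceAs (DecidableRel (SimpleGraph.fromRel _).Adj)
  exact hR ⟨_, injective_of_adj_iff (by decide) key, fun u v => (key u v).symm⟩

/-- `F_2` with four-cycle `a b c d` and vertices `a'`, `c'`, `d'` pendant at `a`, `c`, `d`. -/
theorem not_F2 {V : Type*} {R : SimpleGraph V} (hR : ¬ ContainsInduced R F2G)
    {a b c d a' c' d' : V} (hab : R.Adj a b) (hbc : R.Adj b c) (hcd : R.Adj c d)
    (hda : R.Adj d a) (haa : R.Adj a a') (hcc : R.Adj c c') (hdd : R.Adj d d')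
    (n₁ : ¬ R.Adj a c) (n₂ : ¬ R.Adj b d) (n₃ : ¬ R.Adj b a') (n₄ : ¬ R.Adj c a')
    (n₅ : ¬ R.Adj d a') (n₆ : ¬ R.Adj a c') (n₇ : ¬ R.Adj b c') (n₈ : ¬ R.Adj d c')
    (n₉ : ¬ R.Adj d' a) (m₁ : ¬ R.Adj d' b) (m₂ : ¬ R.Adj d' c) (m₃ : ¬ R.Adj a' c')
    (m₄ : ¬ R.Adj d' a') (m₅ : ¬ R.Adj d' c') : False := by
  have key : ∀ i j, R.Adj (![a, b, c, d, a', c', d'] i) (![a, b, c, d, a', c', d'] j) ↔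
      F2G.Adj i j := by
    intro i j
    fin_cases i <;> fin_cases j <;>
      simp [F2G, hab, hbc, hcd, hda, haa, hcc, hdd, hab.symm, hbc.symm, hcd.symm, hda.symm,
        haa.symm, hcc.symm, hdd.symm, n₁, n₂, n₃, n₄, n₅, n₆, n₇, n₈, n₉, m₁, m₂, m₃, m₄, m₅,
        mt R.adj_symm n₁, mt R.adj_symm n₂, mt R.adj_symm n₃, mt R.adj_symm n₄,
        mt R.adj_symm n₅, mt R.adj_symm n₆, mt R.adj_symm n₇, mt R.adj_symm n₈,
        mt R.adj_symm n₉, mt R.adj_symm m₁, mt R.adj_symm m₂, mt R.adj_symm m₃,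
        mt R.adj_symm m₄, mt R.adj_symm m₅]
  let _ : DecidableRel F2G.Adj := inferInstanceAs (DecidableRel (SimpleGraph.fromRel _).Adj)
  exact hR ⟨_, injective_of_adj_iff (by decide) key, fun u v => (key u v).symm⟩

/-- `g : ℤ → V` winds around an induced cycle of length `ℓ`. -/
structure IsWinding {V : Type*} (R : SimpleGraph V) (ℓ : ℤ) (g : ℤ → V) : Prop where
  periodic : ∀ a b, ℓ ∣ a - b → g a = g b
  adj_iff : ∀ a b, R.Adj (g a) (g b) ↔ ℓ ∣ a - b - 1 ∨ ℓ ∣ b - a - 1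

namespace IsWinding

variable {V : Type*} {R : SimpleGraph V} {ℓ : ℤ} {g : ℤ → V} {u v : V} {i j k : ℤ}

theorem adj (hg : IsWinding R ℓ g) (h : i - j = 1 ∨ j - i = 1) : R.Adj (g i) (g j) := by
  rw [hg.adj_iff]
  rcases h with h | h <;> simp [h]

theorem not_adj (hg : IsWinding R ℓ g) (h₁ : 1 - ℓ < i - j) (h₂ : i - j < ℓ - 1)
    (h₃ : i - j ≠ 1) (h₄ : j - i ≠ 1) : ¬ R.Adj (g i) (g j) := by
  rw [hg.adj_iff]
  rintro (h | h)
  · exact h₃ (by linarith [Int.eq_zero_of_abs_lt_dvd h (abs_lt.2 ⟨by omega, by omega⟩)])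
  · exact h₄ (by linarith [Int.eq_zero_of_abs_lt_dvd h (abs_lt.2 ⟨by omega, by omega⟩)])

theorem exists_mem_period (hg : IsWinding R ℓ g) (hℓ : 0 < ℓ) (i j : ℤ) :
    ∃ k, i ≤ k ∧ k < i + ℓ ∧ ℓ ∣ j - k ∧ g k = g j := by
  have h₁ := Int.emod_nonneg (j - i) hℓ.ne'
  have h₂ := Int.emod_lt_of_pos (j - i) hℓ
  have h₃ : ℓ ∣ j - (i + (j - i) % ℓ) := by
    rw [← sub_sub]; exact Int.dvd_self_sub_emod
  exact ⟨i + (j - i) % ℓ, by omega, by omega, h₃, (hg.periodic _ _ h₃).symm⟩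

theorem not_adj_succ (hg : IsWinding R ℓ g) (hℓ : 8 ≤ ℓ) (h3 : ¬ HasCycleStar R 3)
    (hb : ¬ ContainsInduced R compC4star) (hi : R.Adj v (g i)) : ¬ R.Adj v (g (i + 1)) := by
  intro hi'
  have key : ∀ k, i + 3 ≤ k → k ≤ i + 4 → R.Adj v (g k) := fun k h₁ h₂ => by
    rcases adj_triangle h3 (g k) hi (hg.adj (by omega)) hi' with h | h | h
    · exact h.symm
    · exact (hg.not_adj (by omega) (by omega) (by omega) (by omega) h).elim
    · exact (hg.not_adj (by omega) (by omega) (by omega) (by omega) h).elim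
  refine not_butterfly hb (a := g i) (c := g (i + 1)) (b := g (i + 3)) (d := g (i + 4)) (x := v)
    (hg.adj ?_) (hg.adj ?_) hi (key _ ?_ ?_) hi' (key _ ?_ ?_) (hg.not_adj ?_ ?_ ?_ ?_)
    (hg.not_adj ?_ ?_ ?_ ?_) (hg.not_adj ?_ ?_ ?_ ?_) (hg.not_adj ?_ ?_ ?_ ?_) <;> omega

theorem not_adj_pred (hg : IsWinding R ℓ g) (hℓ : 8 ≤ ℓ) (h3 : ¬ HasCycleStar R 3)
    (hb : ¬ ContainsInduced R compC4star) (hi : R.Adj v (g i)) : ¬ R.Adj v (g (i - 1)) := by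
  intro h
  have := hg.not_adj_succ hℓ h3 hb h
  rw [sub_add_cancel] at this
  exact this hi

theorem not_adj_add_three (hg : IsWinding R ℓ g) (hℓ : 8 ≤ ℓ) (h3 : ¬ HasCycleStar R 3)
    (h5 : ¬ HasCycleStar R 5) (hb : ¬ ContainsInduced R compC4star) (hi : R.Adj v (g i)) :
    ¬ R.Adj v (g (i + 3)) := by
  intro hi'
  have h₁ := hg.not_adj_succ hℓ h3 hb hi
  have h₂ : ¬ R.Adj v (g (i + 2)) := by
    have := hg.not_adj_pred hℓ h3 hb hi'
    rwa [show i + 3 - 1 = i + 2 by ring] at this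
  have key : ∀ k, i + 5 ≤ k → k ≤ i + 6 → R.Adj v (g k) := fun k hk₁ hk₂ => by
    have hn : ∀ m, i ≤ m → m ≤ i + 3 → ¬ R.Adj (g k) (g m) := fun m _ _ =>
      hg.not_adj (by omega) (by omega) (by omega) (by omega)
    rcases adj_pentagon h5 (a := v) (b := g i) (c := g (i + 1)) (d := g (i + 2)) (e := g (i + 3))
      (g k) hi (hg.adj (by omega)) (hg.adj (by omega)) (hg.adj (by omega)) hi'.symm h₁ h₂
      (hg.not_adj (by omega) (by omega) (by omega) (by omega))
      (hg.not_adj (by omega) (by omega) (by omega) (by omega))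
      (hg.not_adj (by omega) (by omega) (by omega) (by omega)) with h | h | h | h | h
    · exact h.symm
    all_goals exact (hn _ (by omega) (by omega) h).elim
  have h₆ := hg.not_adj_succ hℓ h3 hb (key (i + 5) (by omega) (by omega))
  exact h₆ (key _ (by omega) (by omega))

theorem adj_add_two_of_adj_add_four (hg : IsWinding R ℓ g) (hℓ : 8 ≤ ℓ)
    (h3 : ¬ HasCycleStar R 3) (h5 : ¬ HasCycleStar R 5) (hb : ¬ ContainsInduced R compC4star)
    (h6 : ¬ ∃ f : ZMod 6 → V, IsInducedCycle R 6 f)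
    (hi : R.Adj v (g i)) (hj : R.Adj v (g (i + 4))) : R.Adj v (g (i + 2)) := by
  by_contra h₂
  have h₁ := hg.not_adj_succ hℓ h3 hb hi
  have h₃ := hg.not_adj_add_three hℓ h3 h5 hb hi
  refine not_hexagon h6 (a := v) (b := g i) (c := g (i + 1)) (d := g (i + 2)) (e := g (i + 3))
    (x := g (i + 4)) hi (hg.adj ?_) (hg.adj ?_) (hg.adj ?_) (hg.adj ?_) hj.symm h₁ h₂ h₃
    (hg.not_adj ?_ ?_ ?_ ?_) (hg.not_adj ?_ ?_ ?_ ?_) (hg.not_adj ?_ ?_ ?_ ?_)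
    (hg.not_adj ?_ ?_ ?_ ?_) (hg.not_adj ?_ ?_ ?_ ?_) (hg.not_adj ?_ ?_ ?_ ?_) <;> omega

/-- Two neighbours of `v` on the cycle force neighbours at distance two. -/
theorem adj_add_two_or_sub_two (hg : IsWinding R ℓ g) (hℓ : 8 ≤ ℓ)
    (h3 : ¬ HasCycleStar R 3) (h5 : ¬ HasCycleStar R 5) (hb : ¬ ContainsInduced R compC4star)
    (h6 : ¬ ∃ f : ZMod 6 → V, IsInducedCycle R 6 f) (hF1 : ¬ ContainsInduced R F1G)
    (hi : R.Adj v (g i)) (hj : R.Adj v (g j)) (hij : i < j) (hji : j < i + ℓ) :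
    R.Adj v (g (i + 2)) ∨ R.Adj v (g (i - 2)) := by
  by_contra! h
  obtain ⟨hp2, hm2⟩ := h
  have hp1 := hg.not_adj_succ hℓ h3 hb hi
  have hm1 := hg.not_adj_pred hℓ h3 hb hi
  have hp3 := hg.not_adj_add_three hℓ h3 h5 hb hi
  have hp4 := mt (hg.adj_add_two_of_adj_add_four hℓ h3 h5 hb h6 hi) hp2
  have hm3 : ¬ R.Adj v (g (i - 3)) := fun h => by
    have := hg.not_adj_add_three hℓ h3 h5 hb h
    rw [sub_add_cancel] at this
    exact this hi
  have hm4 : ¬ R.Adj v (g (i - 4)) := fun h => by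
    have := hg.adj_add_two_of_adj_add_four hℓ h3 h5 hb h6 h (by rwa [sub_add_cancel])
    rw [show i - 4 + 2 = i - 2 by ring] at this
    exact hm2 this
  have hj' : R.Adj v (g (j - ℓ)) := by
    rwa [hg.periodic (j - ℓ) j ⟨-1, by ring⟩]
  have hne : ∀ m, ¬ R.Adj v (g m) → j ≠ m ∧ j - ℓ ≠ m := fun m hm =>
    ⟨fun e => hm (e ▸ hj), fun e => hm (e ▸ hj')⟩
  have := hne _ hp1
  have := hne _ hm1
  have := hne _ hp2
  have := hne _ hm2
  have := hne _ hp3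
  have := hne _ hm3
  have := hne _ hp4
  have := hne _ hm4
  refine not_longClaw hF1 (c := g i) (a₁ := g (i + 1)) (a₂ := g (i + 2)) (b₁ := g (i - 1))
    (b₂ := g (i - 2)) (d₁ := v) (d₂ := g j) (hg.adj ?_) (hg.adj ?_) (hg.adj ?_) (hg.adj ?_)
    hi.symm hj (hg.not_adj ?_ ?_ ?_ ?_) (hg.not_adj ?_ ?_ ?_ ?_) (hg.not_adj ?_ ?_ ?_ ?_)
    (hg.not_adj ?_ ?_ ?_ ?_) (hg.not_adj ?_ ?_ ?_ ?_) (hg.not_adj ?_ ?_ ?_ ?_)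
    (hg.not_adj ?_ ?_ ?_ ?_) hp1 hp2 (hg.not_adj ?_ ?_ ?_ ?_) (hg.not_adj ?_ ?_ ?_ ?_) hm1 hm2
    (hg.not_adj ?_ ?_ ?_ ?_) (hg.not_adj ?_ ?_ ?_ ?_) <;> omega

theorem even_sub_of_adj_add_two (hg : IsWinding R ℓ g) (hℓ : 8 ≤ ℓ) (hev : Even ℓ)
    (h3 : ¬ HasCycleStar R 3) (hb : ¬ ContainsInduced R compC4star)
    (hF2 : ¬ ContainsInduced R F2G)
    (hi : R.Adj v (g i)) (hi' : R.Adj v (g (i + 2))) (hj : R.Adj v (g j)) : Even (j - i) := by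
  obtain ⟨k, hk₁, hk₂, hk, hgk⟩ := hg.exists_mem_period (by omega) (i - 2) j
  rw [← hgk] at hj
  suffices Even (k - i) by
    have := (even_iff_two_dvd.2 (hev.two_dvd.trans hk)).add this
    rwa [sub_add_sub_cancel] at this
  by_contra hodd
  have hp1 := hg.not_adj_succ hℓ h3 hb hi
  have hm1 := hg.not_adj_pred hℓ h3 hb hi
  have hp3 := hg.not_adj_succ hℓ h3 hb hi'
  rw [add_assoc, show (2 + 1 : ℤ) = 3 by rfl] at hp3
  have : k ≠ i + 1 := fun e => hp1 (e ▸ hj)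
  have : k ≠ i - 1 := fun e => hm1 (e ▸ hj)
  have : k ≠ i + 3 := fun e => hp3 (e ▸ hj)
  rw [Int.even_iff] at hodd
  refine not_F2 hF2 (a := g i) (b := g (i + 1)) (c := g (i + 2)) (d := v) (a' := g (i - 1))
    (c' := g (i + 3)) (d' := g k) (hg.adj ?_) (hg.adj ?_) hi'.symm hi (hg.adj ?_) (hg.adj ?_) hj
    (hg.not_adj ?_ ?_ ?_ ?_) (mt R.adj_symm hp1) (hg.not_adj ?_ ?_ ?_ ?_) (hg.not_adj ?_ ?_ ?_ ?_)
    hm1 (hg.not_adj ?_ ?_ ?_ ?_) (hg.not_adj ?_ ?_ ?_ ?_) hp3 (hg.not_adj ?_ ?_ ?_ ?_)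
    (hg.not_adj ?_ ?_ ?_ ?_) (hg.not_adj ?_ ?_ ?_ ?_) (hg.not_adj ?_ ?_ ?_ ?_)
    (hg.not_adj ?_ ?_ ?_ ?_) (hg.not_adj ?_ ?_ ?_ ?_) <;> omega

/-- All neighbours of a vertex on the cycle have the same parity. -/
theorem even_sub (hg : IsWinding R ℓ g) (hℓ : 8 ≤ ℓ) (hev : Even ℓ)
    (h3 : ¬ HasCycleStar R 3) (h5 : ¬ HasCycleStar R 5) (hb : ¬ ContainsInduced R compC4star)
    (h6 : ¬ ∃ f : ZMod 6 → V, IsInducedCycle R 6 f) (hF1 : ¬ ContainsInduced R F1G)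
    (hF2 : ¬ ContainsInduced R F2G) (hi : R.Adj v (g i)) (hj : R.Adj v (g j)) :
    Even (j - i) := by
  obtain ⟨k, hk₁, hk₂, hk, hgk⟩ := hg.exists_mem_period (by omega) i j
  rcases hk₁.eq_or_lt with rfl | hlt
  · exact even_iff_two_dvd.2 (hev.two_dvd.trans hk)
  rcases hg.adj_add_two_or_sub_two hℓ h3 h5 hb h6 hF1 hi (hgk ▸ hj) hlt hk₂ with h | h
  · exact hg.even_sub_of_adj_add_two hℓ hev h3 hb hF2 hi h hj
  · have := hg.even_sub_of_adj_add_two hℓ hev h3 hb hF2 h (by rwa [sub_add_cancel]) hj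
    rw [Int.even_iff] at this ⊢
    omega

/-- Adjacent vertices have neighbours on the cycle close to each other. -/
theorem exists_adj_near (hg : IsWinding R ℓ g) (hℓ : 8 ≤ ℓ)
    (h3 : ¬ HasCycleStar R 3) (hb : ¬ ContainsInduced R compC4star)
    (hF1 : ¬ ContainsInduced R F1G) (hF2 : ¬ ContainsInduced R F2G)
    (hi : R.Adj u (g i)) (huv : R.Adj u v) :
    ∃ j k, R.Adj u (g j) ∧ R.Adj v (g k) ∧ j - 2 ≤ k ∧ k ≤ j + 2 := by
  by_contra! h
  have hn : ∀ j k, R.Adj u (g j) → j - 2 ≤ k → k ≤ j + 2 → ¬ R.Adj v (g k) :=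
    fun j k h₁ h₂ h₃ h₄ => absurd h₃ (h j k h₁ h₄ h₂).not_ge
  have hpair : ∀ i, R.Adj u (g i) → ¬ R.Adj u (g (i + 2)) := by
    intro i hi hi'
    have hp1 := hg.not_adj_succ hℓ h3 hb hi
    have hm1 := hg.not_adj_pred hℓ h3 hb hi
    have hp3 := hg.not_adj_succ hℓ h3 hb hi'
    rw [add_assoc, show (2 + 1 : ℤ) = 3 by rfl] at hp3
    refine not_F2 hF2 (a := g i) (b := g (i + 1)) (c := g (i + 2)) (d := u) (a' := g (i - 1))
      (c' := g (i + 3)) (d' := v) (hg.adj ?_) (hg.adj ?_) hi'.symm hi (hg.adj ?_) (hg.adj ?_) huv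
      (hg.not_adj ?_ ?_ ?_ ?_) (mt R.adj_symm hp1) (hg.not_adj ?_ ?_ ?_ ?_)
      (hg.not_adj ?_ ?_ ?_ ?_) hm1 (hg.not_adj ?_ ?_ ?_ ?_) (hg.not_adj ?_ ?_ ?_ ?_) hp3
      (hn i _ hi ?_ ?_) (hn i _ hi ?_ ?_) (hn i _ hi ?_ ?_) (hg.not_adj ?_ ?_ ?_ ?_)
      (hn i _ hi ?_ ?_) (hn (i + 2) _ hi' ?_ ?_) <;> omega
  have hm2 : ¬ R.Adj u (g (i - 2)) := fun h => hpair _ h (by rwa [sub_add_cancel])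
  refine not_longClaw hF1 (c := g i) (a₁ := g (i + 1)) (a₂ := g (i + 2)) (b₁ := g (i - 1))
    (b₂ := g (i - 2)) (d₁ := u) (d₂ := v) (hg.adj ?_) (hg.adj ?_) (hg.adj ?_) (hg.adj ?_)
    hi.symm huv (hg.not_adj ?_ ?_ ?_ ?_) (hg.not_adj ?_ ?_ ?_ ?_)
    (mt R.adj_symm (hn i i hi ?_ ?_))
    (hg.not_adj ?_ ?_ ?_ ?_) (hg.not_adj ?_ ?_ ?_ ?_) (hg.not_adj ?_ ?_ ?_ ?_)
    (hg.not_adj ?_ ?_ ?_ ?_) (hg.not_adj_succ hℓ h3 hb hi) (hpair i hi) (hn i _ hi ?_ ?_)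
    (hn i _ hi ?_ ?_) (hg.not_adj_pred hℓ h3 hb hi) hm2 (hn i _ hi ?_ ?_) (hn i _ hi ?_ ?_) <;>
    omega

/-- The cycle is dominating. -/
theorem exists_adj (hg : IsWinding R ℓ g) (hℓ : 8 ≤ ℓ) (hconn : R.Connected)
    (h3 : ¬ HasCycleStar R 3) (hb : ¬ ContainsInduced R compC4star)
    (hF1 : ¬ ContainsInduced R F1G) (hF2 : ¬ ContainsInduced R F2G) (v : V) :
    ∃ k, R.Adj v (g k) := by
  obtain ⟨w⟩ := hconn.preconnected v (g 0)
  suffices ∀ x y, R.Walk x y → (∃ k, R.Adj y (g k)) → ∃ k, R.Adj x (g k) from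
    this _ _ w ⟨1, hg.adj (by omega)⟩
  intro x y w
  induction w with
  | nil => exact id
  | cons h _ ih =>
    intro hy
    obtain ⟨i, hi⟩ := ih hy
    obtain ⟨_, k, _, hk, _⟩ := hg.exists_adj_near hℓ h3 hb hF1 hF2 hi h.symm
    exact ⟨k, hk⟩

/-- Adjacent vertices have neighbours of opposite parities on the cycle. -/
theorem not_even_sub_of_adj (hg : IsWinding R ℓ g) (hℓ : 8 ≤ ℓ) (hev : Even ℓ)
    (h3 : ¬ HasCycleStar R 3) (h5 : ¬ HasCycleStar R 5) (hb : ¬ ContainsInduced R compC4star)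
    (h6 : ¬ ∃ f : ZMod 6 → V, IsInducedCycle R 6 f) (hF1 : ¬ ContainsInduced R F1G)
    (hF2 : ¬ ContainsInduced R F2G) (huv : R.Adj u v) (hi : R.Adj u (g i))
    (hj : R.Adj v (g j)) : ¬ Even (j - i) := by
  intro hij
  have hodd : ∀ m, ¬ Even (m - i) → ¬ R.Adj (g m) u ∧ ¬ R.Adj (g m) v := fun m hm =>
    ⟨fun h => hm (hg.even_sub hℓ hev h3 h5 hb h6 hF1 hF2 hi h.symm), fun h => hm (by
      have := (hg.even_sub hℓ hev h3 h5 hb h6 hF1 hF2 hj h.symm).add hij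
      rwa [sub_add_sub_cancel] at this)⟩
  have hdisj : ∀ m, R.Adj u (g m) → ¬ R.Adj v (g m) := by
    intro m hum hvm
    have hm := hg.even_sub hℓ hev h3 h5 hb h6 hF1 hF2 hi hum
    have hm3 := hodd (m + 3) (by rw [Int.even_iff] at hm ⊢; omega)
    rcases adj_triangle h3 (g (m + 3)) huv hvm hum with h | h | h
    · exact hm3.1 h
    · exact hm3.2 h
    · exact hg.not_adj (by omega) (by omega) (by omega) (by omega) h
  have hpent : ∀ x y, R.Adj x y → (∀ m, ¬ Even (m - i) → ¬ R.Adj (g m) x ∧ ¬ R.Adj (g m) y) →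
      (∀ m, R.Adj x (g m) → ¬ R.Adj y (g m)) → ∀ m, Even (m - i) → R.Adj x (g m) →
      ¬ R.Adj y (g (m + 2)) := by
    intro x y hxy hodd hdisj m hm hxm hym
    have hm1 := hodd (m + 1) (by rw [Int.even_iff] at hm ⊢; omega)
    have hm5 := hodd (m + 5) (by rw [Int.even_iff] at hm ⊢; omega)
    rcases adj_pentagon h5 (a := x) (b := g m) (c := g (m + 1)) (d := g (m + 2)) (e := y)
      (g (m + 5)) hxm (hg.adj (by omega)) (hg.adj (by omega)) hym.symm hxy.symm
      (mt R.adj_symm hm1.1) (fun h => hdisj _ h hym)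
      (hg.not_adj (by omega) (by omega) (by omega) (by omega))
      (fun h => hdisj _ hxm h.symm) hm1.2 with h | h | h | h | h
    · exact hm5.1 h
    · exact hg.not_adj (by omega) (by omega) (by omega) (by omega) h
    · exact hg.not_adj (by omega) (by omega) (by omega) (by omega) h
    · exact hg.not_adj (by omega) (by omega) (by omega) (by omega) h
    · exact hm5.2 h
  obtain ⟨a, b, hua, hvb, hab, hba⟩ := hg.exists_adj_near hℓ h3 hb hF1 hF2 hi huv
  have ha := hg.even_sub hℓ hev h3 h5 hb h6 hF1 hF2 hi hua
  have hb' : Even (b - i) := by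
    by_contra h
    exact (hodd b h).2 hvb.symm
  have hcases : b = a ∨ b = a + 2 ∨ a = b + 2 := by
    rw [Int.even_iff] at ha hb'
    omega
  rcases hcases with rfl | rfl | rfl
  · exact hdisj _ hua hvb
  · exact hpent u v huv hodd hdisj a ha hua hvb
  · exact hpent v u huv.symm (fun m hm => (hodd m hm).symm) (fun m h h' => hdisj m h' h) b hb'
      hvb hua

end IsWinding

theorem IsInducedCycle.isWinding {V : Type*} {R : SimpleGraph V} {ℓ : ℕ} {f : ZMod ℓ → V}
    (hf : IsInducedCycle R ℓ f) : IsWinding R ℓ fun a : ℤ => f a where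
  periodic a b h := by
    congr 1
    rw [← sub_eq_zero]
    exact_mod_cast (ZMod.intCast_zmod_eq_zero_iff_dvd (a - b) ℓ).2 h
  adj_iff a b := by
    rw [hf.2.2, ← ZMod.intCast_zmod_eq_zero_iff_dvd, ← ZMod.intCast_zmod_eq_zero_iff_dvd]
    push_cast
    rw [sub_sub, sub_sub, sub_eq_zero, sub_eq_zero]

/-- If a reduced graph contains an induced cycle of even length
at least 8, then it is bipartite. -/
theorem reduced_with_long_even_hole_bipartite {V : Type*} [Fintype V] (R : SimpleGraph V)
    (hR : IsReducedGraph R)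
    (hcyc : ∃ (ℓ : ℕ) (f : ZMod ℓ → V), 8 ≤ ℓ ∧ Even ℓ ∧ IsInducedCycle R ℓ f) :
    IsBipartite R := by
  classical
  obtain ⟨hconn, -, h3, h5, hb, h6, -, -, hF1, hF2, -, -⟩ := hR
  obtain ⟨ℓ, f, hℓ, hev, hf⟩ := hcyc
  have hg := hf.isWinding
  have hℓ' : (8 : ℤ) ≤ ℓ := by exact_mod_cast hℓ
  have hev' : Even (ℓ : ℤ) := by exact_mod_cast hev
  choose k hk using hg.exists_adj hℓ' hconn h3 hb hF1 hF2
  refine ⟨fun v => decide (Even (k v)), fun u v huv h => ?_⟩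
  refine hg.not_even_sub_of_adj hℓ' hev' h3 h5 hb h6 hF1 hF2 huv (hk u) (hk v) ?_
  rw [Int.even_sub]
  exact (decide_eq_decide.1 h).symm
end

section
/- If a reduced graph R is not bipartite, then the complement of R is a proper circular-arc graph. -/
/-! ### Arcs on the circle -/

lemma circlePt_eq_iff (s t : ℝ) : circlePt s = circlePt t ↔ ∃ k : ℤ, s = t + k := by
  have key : circlePt s = circlePt t ↔
      ((2 * Real.pi * s : ℝ) : Real.Angle) = ((2 * Real.pi * t : ℝ) : Real.Angle) := by
    constructor
    · intro h
      simp only [circlePt, Prod.mk.injEq] at h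
      exact Real.Angle.cos_sin_inj h.1 h.2
    · intro h
      simp only [circlePt, Prod.mk.injEq]
      rw [← Real.Angle.cos_coe, ← Real.Angle.sin_coe, h]
      simp
  rw [key, Real.Angle.angle_eq_iff_two_pi_dvd_sub]
  have hpi : (2 * Real.pi) ≠ 0 := by positivity
  constructor
  · rintro ⟨k, hk⟩
    refine ⟨k, ?_⟩
    have : 2 * Real.pi * (s - t - k) = 0 := by linarith
    have := (mul_eq_zero.1 this).resolve_left hpi
    linarith
  · rintro ⟨k, rfl⟩
    exact ⟨k, by ring⟩

lemma circlePt_mem_arc_iff (t a r : ℝ) :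
    circlePt t ∈ circlePt '' Set.Icc a (a + r) ↔ Int.fract (t - a) ≤ r := by
  constructor
  · rintro ⟨s, ⟨h1, h2⟩, hs⟩
    obtain ⟨k, rfl⟩ := (circlePt_eq_iff s t).1 hs
    have : Int.fract (t - a) = Int.fract (t + k - a) := by
      rw [show t + k - a = t - a + k by ring, Int.fract_add_intCast]
    rw [this]
    have h3 := Int.floor_nonneg.2 (sub_nonneg.2 h1)
    have h4 : (0 : ℝ) ≤ (⌊t + k - a⌋ : ℝ) := by exact_mod_cast h3
    have := Int.fract_add_floor (t + k - a)
    linarith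
  · intro h
    refine ⟨a + Int.fract (t - a), ⟨by linarith [Int.fract_nonneg (t - a)], by linarith⟩, ?_⟩
    refine (circlePt_eq_iff _ _).2 ⟨-⌊t - a⌋, ?_⟩
    have := Int.fract_add_floor (t - a)
    push_cast
    linarith

lemma arc_inter_nonempty_iff {a b r s : ℝ} (hr : 0 ≤ r) (hs : 0 ≤ s) :
    (circlePt '' Set.Icc a (a + r) ∩ circlePt '' Set.Icc b (b + s)).Nonempty ↔
      Int.fract (b - a) ≤ r ∨ Int.fract (a - b) ≤ s := by
  constructor
  · rintro ⟨_, ⟨x, hx, rfl⟩, ⟨y, hy, hxy⟩⟩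
    obtain ⟨k, rfl⟩ := (circlePt_eq_iff y x).1 hxy
    obtain ⟨hx1, hx2⟩ := hx
    obtain ⟨hy1, hy2⟩ := hy
    rcases le_total (b - k) a with h | h
    · right
      refine (circlePt_mem_arc_iff a b s).1 ⟨a + k, ⟨by linarith, by linarith⟩, ?_⟩
      exact (circlePt_eq_iff _ _).2 ⟨k, rfl⟩
    · left
      refine (circlePt_mem_arc_iff b a r).1 ⟨b - k, ⟨by linarith, by linarith⟩, ?_⟩
      exact (circlePt_eq_iff _ _).2 ⟨-k, by push_cast; ring⟩
  · rintro (h | h)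
    · exact ⟨circlePt b, (circlePt_mem_arc_iff b a r).2 h, ⟨b, ⟨le_refl _, by linarith⟩, rfl⟩⟩
    · exact ⟨circlePt a, ⟨a, ⟨le_refl _, by linarith⟩, rfl⟩, (circlePt_mem_arc_iff a b s).2 h⟩

/-- If the arc starting later also ends strictly later, it does not contain the earlier one. -/
lemma not_arc_subset {a b r s : ℝ} (hr : r < 1) (hs : 0 ≤ s) (h0 : 0 < Int.fract (b - a))
    (h : r < Int.fract (b - a) + s) :
    ¬ circlePt '' Set.Icc b (b + s) ⊆ circlePt '' Set.Icc a (a + r) := by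
  intro hsub
  set d := Int.fract (b - a) with hd
  have hd1 : d < 1 := Int.fract_lt_one _
  have hfl : b - a = d + ⌊b - a⌋ := (Int.fract_add_floor (b - a)).symm
  rcases le_or_gt d r with hdr | hdr
  · obtain ⟨t, ht1, ht2⟩ := exists_between (lt_min h hr)
    have ht3 := lt_of_lt_of_le ht2 (min_le_left _ _)
    have ht4 := lt_of_lt_of_le ht2 (min_le_right _ _)
    have hm : circlePt (b + (t - d)) ∈ circlePt '' Set.Icc b (b + s) :=
      ⟨_, ⟨by linarith, by linarith⟩, rfl⟩
    have h2 := (circlePt_mem_arc_iff _ a r).1 (hsub hm)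
    have h3 : Int.fract (b + (t - d) - a) = t := by
      rw [Int.fract_eq_iff]
      exact ⟨by linarith [Int.fract_nonneg (b - a)], ht4, ⌊b - a⌋, by linarith⟩
    linarith
  · have hm : circlePt b ∈ circlePt '' Set.Icc b (b + s) :=
      ⟨_, ⟨le_refl _, by linarith⟩, rfl⟩
    have h2 := (circlePt_mem_arc_iff _ a r).1 (hsub hm)
    linarith

/-! ### Round orientations -/

/-- The number of clockwise steps from position `i` to position `j` among `N` cyclic positions. -/
def cyclicDist (N i j : ℕ) : ℕ := if i ≤ j then j - i else j + N - i

lemma fract_div_sub_div {N i j : ℕ} (hi : i < N) (hj : j < N) :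
    Int.fract ((j : ℝ) / N - (i : ℝ) / N) = (cyclicDist N i j : ℝ) / N := by
  have hN : (0 : ℝ) < N := by exact_mod_cast (by omega : 0 < N)
  have hlt : cyclicDist N i j < N := by unfold cyclicDist; split_ifs <;> omega
  have hlt' : (cyclicDist N i j : ℝ) < N := by exact_mod_cast hlt
  rw [Int.fract_eq_iff]
  refine ⟨by positivity, (div_lt_one hN).2 hlt', ?_⟩
  by_cases h : i ≤ j
  · refine ⟨0, ?_⟩
    have : cyclicDist N i j = j - i := if_pos h
    rw [this]
    push_cast [h]
    ring
  · refine ⟨-1, ?_⟩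
    have : cyclicDist N i j = j + N - i := if_neg h
    rw [this, Nat.cast_sub (by omega)]
    push_cast
    field_simp
    ring

/-- A graph whose edges have a round orientation `D` is a proper circular-arc graph. -/
theorem isProperCircularArcGraph_of_round {V : Type*} [Finite V] (G : SimpleGraph V) (N : ℕ)
    (pos : V → ℕ) (hpos : ∀ v, pos v < N) (hinj : Function.Injective pos) (D : V → V → Prop)
    (hadj : ∀ u v, u ≠ v → (G.Adj u v ↔ D u v ∨ D v u))
    (hround : ∀ u v w, D u w → 0 < cyclicDist N (pos u) (pos v) →
      cyclicDist N (pos u) (pos v) < cyclicDist N (pos u) (pos w) → D u v ∧ D v w) :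
    IsProperCircularArcGraph G := by
  set cy : V → V → ℕ := fun u v => cyclicDist N (pos u) (pos v) with hcy
  have hcylt : ∀ u v, cy u v < N := fun u v => by
    have := hpos u; have := hpos v
    simp only [hcy, cyclicDist]; split_ifs <;> omega
  have hcyz : ∀ u v, cy u v = 0 → u = v := fun u v h => by
    have := hpos u; have := hpos v
    apply hinj
    simp only [hcy, cyclicDist] at h; split_ifs at h <;> omega
  have hcyi : ∀ u v w, cy u v = cy u w → v = w := fun u v w h => by
    have := hpos u; have := hpos v; have := hpos w
    apply hinj
    simp only [hcy, cyclicDist] at h; split_ifs at h <;> omega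
  have hcyadd : ∀ u v w, cy u v ≤ cy u w → cy v w = cy u w - cy u v := fun u v w h => by
    have := hpos u; have := hpos v; have := hpos w
    simp only [hcy, cyclicDist] at h ⊢; split_ifs at h ⊢ <;> omega
  have hL : ∀ u, ∃ l, l < N ∧ (∀ w, D u w → cy u w ≤ l) ∧ (l = 0 ∨ ∃ w, D u w ∧ cy u w = l) := by
    intro u
    by_cases hne : ∃ w, D u w
    · obtain ⟨w, hw, hmax⟩ := Set.exists_max_image {w | D u w} (cy u) (Set.toFinite _) hne
      exact ⟨cy u w, hcylt u w, fun z hz => hmax z hz, Or.inr ⟨w, hw, rfl⟩⟩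
    · exact ⟨0, by have := hpos u; omega, fun w hw => (hne ⟨w, hw⟩).elim, Or.inl rfl⟩
  choose L hLN hLle hLex using hL
  have hD : ∀ u v, u ≠ v → (D u v ↔ cy u v ≤ L u) := by
    intro u v huv
    refine ⟨hLle u v, fun h => ?_⟩
    have h0 : 0 < cy u v := Nat.pos_of_ne_zero fun h => huv (hcyz u v h)
    rcases hLex u with hl | ⟨w, hw, hl⟩
    · omega
    · rcases h.lt_or_eq with h | h
      · exact (hround u v w hw h0 (h.trans_eq hl.symm)).1
      · rw [hcyi u v w (by omega)]; exact hw
  have hmono : ∀ u v, u ≠ v → L u ≤ cy u v + L v := by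
    intro u v huv
    have h0 : 0 < cy u v := Nat.pos_of_ne_zero fun h => huv (hcyz u v h)
    rcases le_or_gt (L u) (cy u v) with h | h
    · omega
    · rcases hLex u with hl | ⟨w, hw, hl⟩
      · omega
      · have := hLle v w (hround u v w hw h0 (h.trans_eq hl.symm)).2
        have := hcyadd u v w (by omega)
        omega
  let x : V → ℝ := fun v => (pos v : ℝ) / N
  let r : V → ℝ := fun v => ((L v : ℝ) + 1) / (N + 1)
  have hN1 : (0 : ℝ) < (N : ℝ) + 1 := by positivity
  have hr0 : ∀ v, 0 ≤ r v := fun v => by positivity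
  have hr1 : ∀ v, r v < 1 := fun v => by
    refine (div_lt_one hN1).2 ?_
    have : (L v : ℝ) < N := by exact_mod_cast hLN v
    linarith
  have hfr : ∀ u v, Int.fract (x v - x u) = (cy u v : ℝ) / N := fun u v =>
    fract_div_sub_div (hpos u) (hpos v)
  have hN0 : ∀ _ : V, (0 : ℝ) < N := fun v => by
    exact_mod_cast (by have := hpos v; omega : 0 < N)
  have hle : ∀ u v, Int.fract (x v - x u) ≤ r u ↔ cy u v ≤ L u := by
    intro u v
    have h1 : cy u v < N := hcylt u v
    have h2 := hLN u
    rw [hfr, div_le_div_iff₀ (hN0 u) hN1]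
    have : ((cy u v : ℝ) * (N + 1) ≤ (L u + 1) * N) ↔ cy u v * (N + 1) ≤ (L u + 1) * N := by
      exact_mod_cast Iff.rfl
    rw [this]
    constructor
    · intro h
      by_contra hc
      have : (L u + 1) * (N + 1) ≤ cy u v * (N + 1) := Nat.mul_le_mul_right _ (by omega)
      nlinarith
    · intro h
      have : cy u v * N ≤ L u * N := Nat.mul_le_mul_right _ h
      nlinarith
  refine ⟨fun v => circlePt '' Set.Icc (x v) (x v + r v), ⟨fun v => ⟨x v, x v + r v, ?_, ?_, rfl⟩,
    fun u v huv => ?_⟩, fun u v h => ?_⟩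
  · simpa using hr0 v
  · simpa using hr1 v
  · rw [hadj u v huv, arc_inter_nonempty_iff (hr0 u) (hr0 v), hle, hle, hD u v huv,
      hD v u huv.symm]
  · have huv : u ≠ v := by rintro rfl; exact h.2 subset_rfl
    have h0 : 0 < cy v u := Nat.pos_of_ne_zero fun h => huv (hcyz v u h).symm
    have h0' : (0 : ℝ) < cy v u := by exact_mod_cast h0
    refine not_arc_subset (hr1 v) (hr0 u) ?_ ?_ h.1
    · rw [hfr]; exact div_pos h0' (hN0 u)
    · rw [hfr]
      have h1 : (L v : ℝ) ≤ cy v u + L u := by exact_mod_cast hmono v u huv.symm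
      have h2 : (cy v u : ℝ) / (N + 1) < cy v u / N :=
        div_lt_div_of_pos_left h0' (hN0 u) (by linarith)
      have h3 : r v ≤ (cy v u : ℝ) / (N + 1) + r u := by
        simp only [r, ← add_div]
        exact div_le_div_of_nonneg_right (by linarith) hN1.le
      linarith

/-! ### Cyclic systems of classes -/

/-- `V` can be enumerated so that the values of `f` are weakly increasing. -/
lemma exists_sorting {V α : Type*} [Fintype V] [LinearOrder α] (f : V → α) :
    ∃ pos : V → ℕ, (∀ v, pos v < Fintype.card V) ∧ Function.Injective pos ∧
      ∀ u v, pos u < pos v → f u ≤ f v := by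
  let e := Fintype.equivFin V
  let σ := Tuple.sort (f ∘ e.symm)
  refine ⟨fun v => (σ.symm (e v)).val, fun v => (σ.symm (e v)).isLt, fun u v h => ?_,
    fun u v h => ?_⟩
  · simpa using Fin.val_injective h
  · have := Tuple.monotone_sort (f ∘ e.symm) (le_of_lt (Fin.lt_def.2 h))
    simpa [σ] using this

/-- A graph `R` together with classes `K · p`, indexed by `p : ℤ` modulo `2 * m`, such that
non-adjacency in `R` is monotone along the cyclic order of the classes. -/
structure CyclicClasses {V : Type*} (R : SimpleGraph V) (m : ℤ) (K : V → ℤ → Prop) : Prop where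
  pos : 0 < m
  periodic : ∀ v p t, K v p → K v (p + 2 * m * t)
  cover : ∀ v, ∃ p, K v p
  same : ∀ u v p, K u p → K v p → ¬ R.Adj u v
  opposite : ∀ u v p, K u p → K v (p + m) → R.Adj u v
  between : ∀ u v w p e d, 0 < e → e < d → d < m → K u p → K v (p + e) → K w (p + d) →
    ¬ R.Adj u w → ¬ R.Adj u v ∧ ¬ R.Adj v w
  forward : ∀ u v w x p d e, 0 < d → d < m → 0 < e → e < m → K u p → K v p → K w (p + d) →
    K x (p + e) → R.Adj v w → R.Adj u x → ¬ R.Adj u w → ¬ R.Adj v x → False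
  backward : ∀ u v w x p d e, 0 < d → d < m → 0 < e → e < m → K u p → K v p → K w (p - d) →
    K x (p - e) → R.Adj v w → R.Adj u x → ¬ R.Adj u w → ¬ R.Adj v x → False
  mixed : ∀ u v w x p d e, 0 < d → d < m → 0 < e → e < m → K u p → K v p → K w (p + d) →
    K x (p - e) → R.Adj v w → R.Adj v x → ¬ R.Adj u w → ¬ R.Adj u x → False

theorem CyclicClasses.isProperCircularArcGraph_compl {V : Type*} [Fintype V] {R : SimpleGraph V}
    {m : ℤ} {K : V → ℤ → Prop} (h : CyclicClasses R m K) : IsProperCircularArcGraph Rᶜ := by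
  classical
  have hm := h.pos
  have hcls : ∀ v, ∃ c, 0 ≤ c ∧ c < 2 * m ∧ K v c := fun v => by
    obtain ⟨p, hp⟩ := h.cover v
    refine ⟨p % (2 * m), Int.emod_nonneg _ (by omega), Int.emod_lt_of_pos _ (by omega), ?_⟩
    have := h.periodic v p (-(p / (2 * m))) hp
    rwa [show p + 2 * m * -(p / (2 * m)) = p % (2 * m) by rw [Int.emod_def]; ring] at this
  choose cls hc0 hc1 hK using hcls
  let off : V → V → ℤ := fun u w => if cls u ≤ cls w then cls w - cls u else cls w + 2 * m - cls u
  have hoffK : ∀ u w, K w (cls u + off u w) := fun u w => by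
    simp only [off]
    split_ifs
    · convert hK w using 1; ring
    · convert h.periodic w _ 1 (hK w) using 1; ring
  have hoffK' : ∀ u w, K w (cls u - off w u) := fun u w => by
    simp only [off]
    split_ifs
    · convert hK w using 1; ring
    · convert h.periodic w _ (-1) (hK w) using 1; ring
  have hoffc : ∀ u v w, cls u = cls v → off u w = off v w := fun u v w e => by
    simp only [off, e]
  have hoffc' : ∀ u v w, cls u = cls v → off w u = off w v := fun u v w e => by
    simp only [off, e]
  let F : V → Finset V := fun u => {w | ¬ R.Adj u w ∧ 0 < off u w ∧ off u w < m}
  let B : V → Finset V := fun u => {w | ¬ R.Adj u w ∧ 0 < off w u ∧ off w u < m}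
  have hFF : ∀ u v, cls u = cls v → F u ⊆ F v ∨ F v ⊆ F u := by
    intro u v e
    by_contra! hcon
    obtain ⟨⟨w, hw, hw'⟩, x, hx, hx'⟩ :=
      And.intro (Finset.not_subset.1 hcon.1) (Finset.not_subset.1 hcon.2)
    simp only [F, Finset.mem_filter, Finset.mem_univ, true_and] at hw hw' hx hx'
    rw [← hoffc u v w e] at hw'
    rw [hoffc u v x e] at hx'
    refine h.forward u v w x (cls u) _ _ hw.2.1 hw.2.2 hx.2.1 hx.2.2 (hK u) (e ▸ hK v) (hoffK u w)
      ?_ (by tauto) (by tauto) hw.1 hx.1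
    rw [e]; exact hoffK v x
  have hBB : ∀ u v, cls u = cls v → B u ⊆ B v ∨ B v ⊆ B u := by
    intro u v e
    by_contra! hcon
    obtain ⟨⟨w, hw, hw'⟩, x, hx, hx'⟩ :=
      And.intro (Finset.not_subset.1 hcon.1) (Finset.not_subset.1 hcon.2)
    simp only [B, Finset.mem_filter, Finset.mem_univ, true_and] at hw hw' hx hx'
    rw [← hoffc' u v w e] at hw'
    rw [hoffc' u v x e] at hx'
    refine h.backward u v w x (cls u) _ _ hw.2.1 hw.2.2 hx.2.1 hx.2.2 (hK u) (e ▸ hK v)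
      (hoffK' u w) ?_ (by tauto) (by tauto) hw.1 hx.1
    rw [e]; exact hoffK' v x
  have hFB : ∀ u v, cls u = cls v → F u ⊆ F v ∨ B u ⊆ B v := by
    intro u v e
    by_contra! hcon
    obtain ⟨⟨w, hw, hw'⟩, x, hx, hx'⟩ :=
      And.intro (Finset.not_subset.1 hcon.1) (Finset.not_subset.1 hcon.2)
    simp only [F, B, Finset.mem_filter, Finset.mem_univ, true_and] at hw hw' hx hx'
    rw [← hoffc u v w e] at hw'
    rw [← hoffc' u v x e] at hx'
    exact h.mixed u v w x (cls u) _ _ hw.2.1 hw.2.2 hx.2.1 hx.2.2 (hK u) (e ▸ hK v)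
      (hoffK u w) (hoffK' u x) (by tauto) (by tauto) hw.1 hx.1
  let key : V → ℤ := fun u => (F u).card - (B u).card
  have hkey : ∀ u v, cls u = cls v → key u ≤ key v → F u ⊆ F v ∧ B v ⊆ B u := by
    intro u v e hk
    simp only [key] at hk
    constructor <;> by_contra hn
    · have h1 := (hFF u v e).resolve_left hn
      have h2 := Finset.card_lt_card (Finset.ssubset_iff_subset_ne.2 ⟨h1, fun h => hn h.superset⟩)
      have h3 := Finset.card_le_card ((hFB u v e).resolve_left hn)
      omega
    · have h1 := (hBB u v e).resolve_right hn
      have h2 := Finset.card_lt_card (Finset.ssubset_iff_subset_ne.2 ⟨h1, fun h => hn h.superset⟩)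
      have h3 := Finset.card_le_card ((hFB v u e.symm).resolve_right hn)
      omega
  obtain ⟨pos, hpos, hinj, hsort⟩ := exists_sorting fun v => toLex (cls v, key v)
  have hsort1 : ∀ u v, pos u < pos v → cls u ≤ cls v ∧ (cls u = cls v → key u ≤ key v) := by
    intro u v huv
    have := hsort u v huv
    rw [Prod.Lex.toLex_le_toLex] at this
    simp only at this
    omega
  refine isProperCircularArcGraph_of_round Rᶜ _ pos hpos hinj
    (fun u w => ¬ R.Adj u w ∧ (0 < off u w ∧ off u w < m ∨ off u w = 0 ∧ pos u < pos w)) ?_ ?_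
  · intro u v huv
    have hp : pos u ≠ pos v := fun e => huv (hinj e)
    rw [SimpleGraph.compl_adj, R.adj_comm v u]
    have hopp : off u v = m → R.Adj u v := fun e =>
      h.opposite u v (cls u) (hK u) (e ▸ hoffK u v)
    have := hc0 u; have := hc1 u; have := hc0 v; have := hc1 v
    constructor
    · rintro ⟨-, hn⟩
      have hne : off u v ≠ m := fun e => hn (hopp e)
      simp only [hn, not_false_eq_true, true_and]
      simp only [off] at hne ⊢
      split_ifs at hne ⊢ <;> omega
    · tauto
  · rintro u v w ⟨hnR, hoff⟩ h1 h2
    have h3 : (pos u < pos v ∧ pos v < pos w) ∨ (pos v < pos w ∧ pos w < pos u) ∨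
        (pos w < pos u ∧ pos u < pos v) := by
      have := hpos u; have := hpos v; have := hpos w
      simp only [cyclicDist] at h1 h2
      split_ifs at h1 h2 <;> omega
    have hcu := hc0 u; have hcu' := hc1 u; have hcv := hc0 v; have hcv' := hc1 v
    have hcw := hc0 w; have hcw' := hc1 w
    have huv := hsort1 u v; have hvw := hsort1 v w; have hwu := hsort1 w u
    have huw : cls u = cls w ∨ cls u ≠ cls w := em _
    rcases hoff with ⟨hd0, hdm⟩ | ⟨hd, hlt⟩
    · have hne : cls u ≠ cls w := fun e => by simp only [off, e] at hd0; simp at hd0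
      by_cases he0 : cls u = cls v
      · have hlt : pos u < pos v := by omega
        have hFw : w ∈ F v := (hkey u v he0 (by omega)).1 (by simp [F, hnR, hd0, hdm])
        simp only [F, Finset.mem_filter, Finset.mem_univ, true_and] at hFw
        refine ⟨⟨h.same u v _ (hK u) (he0 ▸ hK v), Or.inr ⟨?_, hlt⟩⟩, hFw.1, Or.inl hFw.2⟩
        simp [off, he0]
      by_cases hed : cls v = cls w
      · have hlt : pos v < pos w := by omega
        have hBu : u ∈ B v := (hkey v w hed (by omega)).2
          (by simp [B, R.adj_comm w u, hnR, hd0, hdm])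
        simp only [B, Finset.mem_filter, Finset.mem_univ, true_and, R.adj_comm v u] at hBu
        refine ⟨⟨hBu.1, Or.inl hBu.2⟩, h.same v w _ (hK v) (hed ▸ hK w), Or.inr ⟨?_, hlt⟩⟩
        simp [off, hed]
      have hm : 0 < off u v ∧ off u v < off u w ∧ off v w = off u w - off u v := by
        simp only [off] at hd0 hdm ⊢
        split_ifs at hd0 hdm ⊢ <;> omega
      obtain ⟨r1, r2⟩ := h.between u v w _ _ _ hm.1 hm.2.1 hdm (hK u) (hoffK u v) (hoffK u w) hnR
      exact ⟨⟨r1, Or.inl (by omega)⟩, r2, Or.inl (by omega)⟩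
    · have huw : cls u = cls w := by
        simp only [off] at hd; split_ifs at hd <;> omega
      have huv : cls u = cls v := by omega
      have hlt : pos u < pos v ∧ pos v < pos w := by omega
      exact ⟨⟨h.same u v _ (hK u) (huv ▸ hK v), Or.inr ⟨by simp [off, huv], hlt.1⟩⟩,
        h.same v w _ (huv ▸ hK v) (huw ▸ hK w), Or.inr ⟨by simp [off, ← huv, huw], hlt.2⟩⟩

/-! ### Forbidden configurations of a reduced graph -/

lemma embeds_of_twinFree {V : Type*} {R : SimpleGraph V} {n : ℕ}
    {H : SimpleGraph (Fin n)} (f : Fin n → V)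
    (htwin : ∀ i j, i < j → ∃ k, ¬ (H.Adj i k ↔ H.Adj j k))
    (h : ∀ i j, i < j → (H.Adj i j ↔ R.Adj (f i) (f j))) :
    Function.Injective f ∧ ∀ i j, H.Adj i j ↔ R.Adj (f i) (f j) := by
  have hadj : ∀ i j, H.Adj i j ↔ R.Adj (f i) (f j) := fun i j => by
    rcases lt_trichotomy i j with hij | rfl | hij
    · exact h i j hij
    · simp
    · rw [H.adj_comm, R.adj_comm, h j i hij]
  have hne : ∀ i j, i < j → f i ≠ f j := fun i j hij he => by
    obtain ⟨k, hk⟩ := htwin i j hij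
    rw [hadj, hadj, he] at hk
    exact hk Iff.rfl
  refine ⟨fun i j he => ?_, hadj⟩
  rcases lt_trichotomy i j with hij | hij | hij
  · exact (hne i j hij he).elim
  · exact hij
  · exact (hne j i hij he.symm).elim

lemma containsInduced_of_twinFree {V : Type*} {R : SimpleGraph V} {n : ℕ}
    {H : SimpleGraph (Fin n)} (f : Fin n → V)
    (htwin : ∀ i j, i < j → ∃ k, ¬ (H.Adj i k ↔ H.Adj j k))
    (h : ∀ i j, i < j → (H.Adj i j ↔ R.Adj (f i) (f j))) : ContainsInduced R H :=
  ⟨f, embeds_of_twinFree f htwin h⟩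

/-- The cycle on `Fin (n + 1)`. -/
def cycleOnFin (n : ℕ) : SimpleGraph (Fin (n + 1)) := SimpleGraph.fromRel fun i j => j = i + 1

instance (n : ℕ) : DecidableRel (cycleOnFin n).Adj := by unfold cycleOnFin; infer_instance

lemma isInducedCycle_of_cycleOnFin {V : Type*} {R : SimpleGraph V} {n : ℕ} (hn : 3 ≤ n + 1)
    {f : Fin (n + 1) → V}
    (h : Function.Injective f ∧ ∀ i j, (cycleOnFin n).Adj i j ↔ R.Adj (f i) (f j)) :
    IsInducedCycle R (n + 1) f := by
  refine ⟨hn, h.1, fun (i j : Fin (n + 1)) => (h.2 i j).symm.trans ?_⟩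
  have h1 : (1 : Fin (n + 1)) ≠ 0 := by
    rw [Ne, Fin.ext_iff, Fin.val_one', Nat.mod_eq_of_lt (by omega)]; simp
  have hne : ∀ k : Fin (n + 1), k ≠ k + 1 := fun k hk => h1 (by simpa using hk)
  change i ≠ j ∧ (j = i + 1 ∨ i = j + 1) ↔ (i = j + 1 ∨ j = i + 1)
  constructor
  · rintro ⟨-, h | h⟩
    · exact Or.inr h
    · exact Or.inl h
  · rintro (h | h)
    · exact ⟨fun e => hne j (e.symm.trans h), Or.inr h⟩
    · exact ⟨fun e => hne i (e.trans h), Or.inl h⟩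

instance : DecidableRel compC4star.Adj := by unfold compC4star; infer_instance
instance : DecidableRel tentS3.Adj := by unfold tentS3; infer_instance
instance : DecidableRel F1G.Adj := by unfold F1G; infer_instance
instance : DecidableRel F2G.Adj := by unfold F2G; infer_instance
instance : DecidableRel F3G.Adj := by unfold F3G; infer_instance
instance : DecidableRel F4G.Adj := by unfold F4G; infer_instance

namespace IsReducedGraph

variable {V : Type*} {R : SimpleGraph V}

lemma not_triangle_star (h : IsReducedGraph R) {x a b c : V} (hab : R.Adj a b) (hac : R.Adj a c)
    (hbc : R.Adj b c) (xa : ¬ R.Adj x a) (xb : ¬ R.Adj x b) (xc : ¬ R.Adj x c) : False := by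
  have := hab.ne; have := hac.ne; have := hbc.ne
  have := hab.symm; have := hac.symm; have := hbc.symm
  refine h.2.2.1 ⟨(![a, b, c] : Fin 3 → V), x, isInducedCycle_of_cycleOnFin (n := 2) (le_refl _)
    ⟨fun i j hij => ?_, fun i j => ?_⟩, fun (i : Fin 3) => ?_⟩
  · fin_cases i <;> fin_cases j <;> simp_all
  · fin_cases i <;> fin_cases j <;> simp [cycleOnFin, *]
  · fin_cases i <;> simpa

lemma not_pentagon_star (h : IsReducedGraph R) {x c₀ c₁ c₂ c₃ c₄ : V} (h01 : R.Adj c₀ c₁)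
    (h12 : R.Adj c₁ c₂) (h23 : R.Adj c₂ c₃) (h34 : R.Adj c₃ c₄) (h40 : R.Adj c₄ c₀)
    (h02 : ¬ R.Adj c₀ c₂) (h13 : ¬ R.Adj c₁ c₃) (h24 : ¬ R.Adj c₂ c₄) (h30 : ¬ R.Adj c₃ c₀)
    (h41 : ¬ R.Adj c₄ c₁) (x0 : ¬ R.Adj x c₀) (x1 : ¬ R.Adj x c₁) (x2 : ¬ R.Adj x c₂)
    (x3 : ¬ R.Adj x c₃) (x4 : ¬ R.Adj x c₄) : False := by
  refine h.2.2.2.1 ⟨(![c₀, c₁, c₂, c₃, c₄] : Fin 5 → V), x, isInducedCycle_of_cycleOnFin (n := 4)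
    (by norm_num) (embeds_of_twinFree _ (by decide) fun i j hij => ?_), fun (i : Fin 5) => ?_⟩
  · rw [R.adj_comm] at h40 h30 h41
    fin_cases i <;> fin_cases j <;> simp [cycleOnFin] at hij ⊢ <;> assumption
  · fin_cases i <;> simpa

lemma not_hexagon (h : IsReducedGraph R) {c₀ c₁ c₂ c₃ c₄ c₅ : V} (h01 : R.Adj c₀ c₁)
    (h12 : R.Adj c₁ c₂) (h23 : R.Adj c₂ c₃) (h34 : R.Adj c₃ c₄) (h45 : R.Adj c₄ c₅)
    (h50 : R.Adj c₅ c₀) (h02 : ¬ R.Adj c₀ c₂) (h13 : ¬ R.Adj c₁ c₃) (h24 : ¬ R.Adj c₂ c₄)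
    (h35 : ¬ R.Adj c₃ c₅) (h40 : ¬ R.Adj c₄ c₀) (h51 : ¬ R.Adj c₅ c₁) (h03 : ¬ R.Adj c₀ c₃)
    (h14 : ¬ R.Adj c₁ c₄) (h25 : ¬ R.Adj c₂ c₅) : False := by
  refine h.2.2.2.2.2.1 ⟨(![c₀, c₁, c₂, c₃, c₄, c₅] : Fin 6 → V), isInducedCycle_of_cycleOnFin
    (n := 5) (by norm_num) (embeds_of_twinFree _ (by decide) fun i j hij => ?_)⟩
  rw [R.adj_comm] at h50 h40 h51
  fin_cases i <;> fin_cases j <;> simp [cycleOnFin] at hij ⊢ <;> assumption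

/-- No vertex has both edges of an induced `2K₂` in its neighbourhood. -/
lemma not_compl_C4_star (h : IsReducedGraph R) {c p q r s : V} (hpr : R.Adj p r)
    (hqs : R.Adj q s) (hpq : ¬ R.Adj p q) (hqr : ¬ R.Adj q r) (hrs : ¬ R.Adj r s)
    (hsp : ¬ R.Adj s p) (hp : R.Adj c p) (hq : R.Adj c q) (hr : R.Adj c r) (hs : R.Adj c s) :
    False := by
  refine h.2.2.2.2.1 (containsInduced_of_twinFree ![p, q, r, s, c] (by decide) ?_)
  rw [R.adj_comm] at hsp hp hq hr hs
  intro i j hij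
  fin_cases i <;> fin_cases j <;> simp [compC4star] at hij ⊢ <;> assumption

/-- The complement of `R` contains no induced net with triangle `t` and pendant vertices `s`. -/
lemma not_compl_net (h : IsReducedGraph R) {t₀ t₁ t₂ s₀ s₁ s₂ : V} (t01 : ¬ R.Adj t₀ t₁)
    (t12 : ¬ R.Adj t₁ t₂) (t02 : ¬ R.Adj t₀ t₂) (h00 : ¬ R.Adj s₀ t₀) (h11 : ¬ R.Adj s₁ t₁)
    (h22 : ¬ R.Adj s₂ t₂) (s01 : R.Adj s₀ s₁) (s12 : R.Adj s₁ s₂) (s02 : R.Adj s₀ s₂)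
    (h01 : R.Adj s₀ t₁) (h02 : R.Adj s₀ t₂) (h10 : R.Adj s₁ t₀) (h12 : R.Adj s₁ t₂)
    (h20 : R.Adj s₂ t₀) (h21 : R.Adj s₂ t₁) : False := by
  refine h.2.2.2.2.2.2.1 (containsInduced_of_twinFree ![s₀, s₁, s₂, t₂, t₀, t₁] (by decide) ?_)
  rw [R.adj_comm] at t12 t02
  intro i j hij
  fin_cases i <;> fin_cases j <;> simp [tentS3] at hij ⊢ <;> assumption

lemma not_F1 (h : IsReducedGraph R) {x a a' b b' c c' : V} (xa : R.Adj x a) (xb : R.Adj x b)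
    (xc : R.Adj x c) (aa : R.Adj a a') (bb : R.Adj b b') (cc : R.Adj c c')
    (xa' : ¬ R.Adj x a') (xb' : ¬ R.Adj x b') (xc' : ¬ R.Adj x c')
    (ab : ¬ R.Adj a b) (ac : ¬ R.Adj a c) (bc : ¬ R.Adj b c)
    (ab' : ¬ R.Adj a b') (ac' : ¬ R.Adj a c') (ba' : ¬ R.Adj b a') (bc' : ¬ R.Adj b c')
    (ca' : ¬ R.Adj c a') (cb' : ¬ R.Adj c b') (ab'' : ¬ R.Adj a' b') (ac'' : ¬ R.Adj a' c')
    (bc'' : ¬ R.Adj b' c') : False := by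
  refine h.2.2.2.2.2.2.2.2.1 (containsInduced_of_twinFree ![x, a, a', b, b', c, c'] (by decide) ?_)
  rw [R.adj_comm] at ba' ca' cb'
  intro i j hij
  fin_cases i <;> fin_cases j <;> simp [F1G] at hij ⊢ <;> assumption

lemma not_F2 (h : IsReducedGraph R) {p q r s p' r' s' : V} (pq : R.Adj p q) (qr : R.Adj q r)
    (rs : R.Adj r s) (sp : R.Adj s p) (pp' : R.Adj p p') (rr' : R.Adj r r') (ss' : R.Adj s s')
    (pr : ¬ R.Adj p r) (qs : ¬ R.Adj q s) (pr' : ¬ R.Adj p r') (ps' : ¬ R.Adj p s')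
    (qp' : ¬ R.Adj q p') (qr' : ¬ R.Adj q r') (qs' : ¬ R.Adj q s') (rp' : ¬ R.Adj r p')
    (rs' : ¬ R.Adj r s') (sp' : ¬ R.Adj s p') (sr' : ¬ R.Adj s r') (pr'' : ¬ R.Adj p' r')
    (ps'' : ¬ R.Adj p' s') (rs'' : ¬ R.Adj r' s') : False := by
  refine h.2.2.2.2.2.2.2.2.2.1
    (containsInduced_of_twinFree ![p, q, r, s, p', r', s'] (by decide) ?_)
  have := sp.symm
  intro i j hij
  fin_cases i <;> fin_cases j <;> simp [F2G] at hij ⊢ <;> assumption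

lemma not_F3 (h : IsReducedGraph R) {c₀ c₁ c₂ c₃ c₄ c₅ x : V} (h01 : R.Adj c₀ c₁)
    (h12 : R.Adj c₁ c₂) (h23 : R.Adj c₂ c₃) (h34 : R.Adj c₃ c₄) (h45 : R.Adj c₄ c₅)
    (h50 : R.Adj c₅ c₀) (h03 : R.Adj c₀ c₃) (hx : R.Adj c₀ x)
    (h02 : ¬ R.Adj c₀ c₂) (h13 : ¬ R.Adj c₁ c₃) (h24 : ¬ R.Adj c₂ c₄)
    (h35 : ¬ R.Adj c₃ c₅) (h40 : ¬ R.Adj c₄ c₀) (h51 : ¬ R.Adj c₅ c₁)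
    (h14 : ¬ R.Adj c₁ c₄) (h25 : ¬ R.Adj c₂ c₅) (x1 : ¬ R.Adj c₁ x) (x2 : ¬ R.Adj c₂ x)
    (x3 : ¬ R.Adj c₃ x) (x4 : ¬ R.Adj c₄ x) (x5 : ¬ R.Adj c₅ x) : False := by
  refine h.2.2.2.2.2.2.2.2.2.2.1
    (containsInduced_of_twinFree ![c₀, c₁, c₂, c₃, c₄, c₅, x] (by decide) ?_)
  rw [R.adj_comm] at h50 h40 h51
  intro i j hij
  fin_cases i <;> fin_cases j <;> simp [F3G] at hij ⊢ <;> assumption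

lemma not_F4 (h : IsReducedGraph R) {c₀ c₁ c₂ c₃ c₄ c₅ x : V} (h01 : R.Adj c₀ c₁)
    (h12 : R.Adj c₁ c₂) (h23 : R.Adj c₂ c₃) (h34 : R.Adj c₃ c₄) (h45 : R.Adj c₄ c₅)
    (h50 : R.Adj c₅ c₀) (h03 : R.Adj c₀ c₃) (x0 : R.Adj c₀ x) (x3 : R.Adj c₃ x)
    (h02 : ¬ R.Adj c₀ c₂) (h13 : ¬ R.Adj c₁ c₃) (h24 : ¬ R.Adj c₂ c₄)
    (h35 : ¬ R.Adj c₃ c₅) (h40 : ¬ R.Adj c₄ c₀) (h51 : ¬ R.Adj c₅ c₁)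
    (h14 : ¬ R.Adj c₁ c₄) (h25 : ¬ R.Adj c₂ c₅) (x1 : ¬ R.Adj c₁ x) (x2 : ¬ R.Adj c₂ x)
    (x4 : ¬ R.Adj c₄ x) (x5 : ¬ R.Adj c₅ x) : False := by
  refine h.2.2.2.2.2.2.2.2.2.2.2
    (containsInduced_of_twinFree ![c₀, c₁, c₂, c₃, c₄, c₅, x] (by decide) ?_)
  rw [R.adj_comm] at h50 h40 h51
  intro i j hij
  fin_cases i <;> fin_cases j <;> simp [F4G] at hij ⊢ <;> assumption

/-- If some vertex satisfies `P` and some does not, then the complement of `R` has an edge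
between a vertex satisfying `P` and one that does not. -/
lemma exists_compl_boundary (h : IsReducedGraph R) (P : V → Prop) {x y : V} (hx : P x)
    (hy : ¬ P y) : ∃ z w, P z ∧ ¬ P w ∧ ¬ R.Adj z w := by
  obtain ⟨p⟩ := h.2.1.preconnected x y
  obtain ⟨d, -, hd1, hd2⟩ := p.exists_boundary_dart {v | P v} hx hy
  exact ⟨d.fst, d.snd, hd1, hd2, ((R.compl_adj _ _).1 d.adj).2⟩

/-- If some vertex satisfies `P` and some does not, then `R` has an edge between a vertex
satisfying `P` and one that does not. -/
lemma exists_boundary (h : IsReducedGraph R) (P : V → Prop) {x y : V} (hx : P x)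
    (hy : ¬ P y) : ∃ z w, P z ∧ ¬ P w ∧ R.Adj z w := by
  obtain ⟨p⟩ := h.1.preconnected x y
  obtain ⟨d, -, hd1, hd2⟩ := p.exists_boundary_dart {v | P v} hx hy
  exact ⟨d.fst, d.snd, hd1, hd2, d.adj⟩

lemma adj_of_compl_pentagon (h : IsReducedGraph R) {y z g₀ g₁ g₂ g₃ g₄ : V}
    (g01 : ¬ R.Adj g₀ g₁) (g12 : ¬ R.Adj g₁ g₂) (g23 : ¬ R.Adj g₂ g₃) (g40 : ¬ R.Adj g₄ g₀)
    (g02 : R.Adj g₀ g₂) (g13 : R.Adj g₁ g₃) (g24 : R.Adj g₂ g₄)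
    (g30 : R.Adj g₃ g₀) (g41 : R.Adj g₄ g₁) (z0 : R.Adj z g₀) (z1 : R.Adj z g₁)
    (z2 : R.Adj z g₂) (z3 : R.Adj z g₃) (z4 : R.Adj z g₄) (hyz : ¬ R.Adj z y) : R.Adj y g₁ := by
  by_contra h1
  have hs := R.adj_comm
  have hclaw : ∀ p q, R.Adj z p → R.Adj z q → R.Adj p q → ¬ R.Adj y p → R.Adj y q :=
    fun p q hp hq hpq hyp => by_contra fun hyq =>
      h.not_triangle_star hp hq hpq (by rwa [R.adj_comm]) hyp hyq
  by_cases h0 : R.Adj y g₀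
  · by_cases h2 : R.Adj y g₂
    · apply h.not_triangle_star (x := g₁) (a := g₀) (b := g₂) (c := y) <;> grind
    · apply h.not_compl_net (t₀ := y) (t₁ := g₁) (t₂ := g₂) (s₀ := z) (s₁ := g₀) (s₂ := g₃) <;>
        grind
  · apply h.not_compl_net (t₀ := y) (t₁ := g₁) (t₂ := g₀) (s₀ := z) (s₁ := g₂) (s₂ := g₄) <;>
      grind

/-- The complement of `R` contains no induced `C₅*`. -/
lemma not_compl_pentagon_star (h : IsReducedGraph R) {x g₀ g₁ g₂ g₃ g₄ : V}
    (g01 : ¬ R.Adj g₀ g₁) (g12 : ¬ R.Adj g₁ g₂) (g23 : ¬ R.Adj g₂ g₃) (g34 : ¬ R.Adj g₃ g₄)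
    (g40 : ¬ R.Adj g₄ g₀) (g02 : R.Adj g₀ g₂) (g13 : R.Adj g₁ g₃) (g24 : R.Adj g₂ g₄)
    (g30 : R.Adj g₃ g₀) (g41 : R.Adj g₄ g₁) (x0 : R.Adj x g₀) (x1 : R.Adj x g₁)
    (x2 : R.Adj x g₂) (x3 : R.Adj x g₃) (x4 : R.Adj x g₄) : False := by
  obtain ⟨z, y, ⟨z0, z1, z2, z3, z4⟩, hy, hzy⟩ := h.exists_compl_boundary
    (fun v => R.Adj v g₀ ∧ R.Adj v g₁ ∧ R.Adj v g₂ ∧ R.Adj v g₃ ∧ R.Adj v g₄)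
    ⟨x0, x1, x2, x3, x4⟩ (y := g₀) (by simp)
  exact hy ⟨h.adj_of_compl_pentagon g40 g01 g12 g34 g41 g02 g13 g24 g30 z4 z0 z1 z2 z3 hzy,
    h.adj_of_compl_pentagon g01 g12 g23 g40 g02 g13 g24 g30 g41 z0 z1 z2 z3 z4 hzy,
    h.adj_of_compl_pentagon g12 g23 g34 g01 g13 g24 g30 g41 g02 z1 z2 z3 z4 z0 hzy,
    h.adj_of_compl_pentagon g23 g34 g40 g12 g24 g30 g41 g02 g13 z2 z3 z4 z0 z1 hzy,
    h.adj_of_compl_pentagon g34 g40 g01 g23 g30 g41 g02 g13 g24 z3 z4 z0 z1 z2 hzy⟩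

end IsReducedGraph

/-! ### Types with respect to a maximum clique of size at least three -/

/-- `I` is a maximum clique of `R` and has at least three vertices. -/
structure IsLargeMaximumClique {V : Type*} (R : SimpleGraph V) (I : Finset V) : Prop where
  isClique : R.IsClique (I : Set V)
  card_le : ∀ t : Finset V, R.IsClique (t : Set V) → t.card ≤ I.card
  three_le : 3 ≤ I.card

/-- The vertices of `I` not adjacent to `u` are exactly `a` and `b`. -/
def MissesExactly {V : Type*} (R : SimpleGraph V) (I : Finset V) (u a b : V) : Prop :=
  a ∈ I ∧ b ∈ I ∧ ∀ x ∈ I, ¬ R.Adj u x ↔ x = a ∨ x = b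

section

variable {V : Type*} {R : SimpleGraph V} {I : Finset V}

lemma MissesExactly.symm {u a b : V} (h : MissesExactly R I u a b) : MissesExactly R I u b a :=
  ⟨h.2.1, h.1, fun x hx => (h.2.2 x hx).trans or_comm⟩

lemma MissesExactly.congr {u a b c d : V} (h : MissesExactly R I u a b)
    (h' : MissesExactly R I u c d) : (a = c ∧ b = d) ∨ (a = d ∧ b = c) := by
  obtain ⟨ha, hb, hx⟩ := h
  obtain ⟨hc, hd, hy⟩ := h'
  grind

namespace IsLargeMaximumClique

lemma adj (hI : IsLargeMaximumClique R I) {a b : V} (ha : a ∈ I) (hb : b ∈ I) (hab : a ≠ b) :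
    R.Adj a b :=
  hI.isClique ha hb hab

lemma exists_third (hI : IsLargeMaximumClique R I) (a b : V) : ∃ c ∈ I, c ≠ a ∧ c ≠ b := by
  classical
  by_contra! hc
  have h1 : I ⊆ {a, b} := fun c hcI => by
    have := hc c hcI
    simp only [Finset.mem_insert, Finset.mem_singleton]
    tauto
  have h2 := Finset.card_le_card h1
  have h3 : ({a, b} : Finset V).card ≤ 2 := Finset.card_le_two
  have := hI.three_le
  omega

lemma exists_missesExactly (hI : IsLargeMaximumClique R I) (h : IsReducedGraph R) (v : V) :
    ∃ a b, MissesExactly R I v a b := by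
  classical
  have h1 : ∃ a ∈ I, ¬ R.Adj v a := by
    by_contra! hv
    have hvI : v ∉ I := fun hvI => (hv v hvI).ne rfl
    have := hI.card_le (insert v I) (by
      rw [Finset.coe_insert, SimpleGraph.isClique_insert_of_notMem (by simpa using hvI)]
      exact ⟨hI.isClique, fun b hb => hv b hb⟩)
    rw [Finset.card_insert_of_notMem hvI] at this
    omega
  obtain ⟨a, ha, hva⟩ := h1
  by_cases h2 : ∃ b ∈ I, b ≠ a ∧ ¬ R.Adj v b
  · obtain ⟨b, hb, hba, hvb⟩ := h2
    refine ⟨a, b, ha, hb, fun x hx => ⟨fun hvx => ?_, by rintro (rfl | rfl) <;> assumption⟩⟩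
    by_contra! hne
    exact h.not_triangle_star (hI.adj ha hb hba.symm) (hI.adj ha hx hne.1.symm)
      (hI.adj hb hx hne.2.symm) hva hvb hvx
  · push Not at h2
    refine ⟨a, a, ha, ha, fun x hx => ⟨fun hvx => ?_, by rintro (rfl | rfl) <;> assumption⟩⟩
    by_contra! hne
    exact hvx (h2 x hx hne.1)

/-- An induced `2K₂` of `R` cannot miss at most two vertices of the clique. -/
lemma not_two_edges (hI : IsLargeMaximumClique R I) (h : IsReducedGraph R) {a b p q r s : V}
    (hp : ∀ c ∈ I, c ≠ a → c ≠ b → R.Adj p c) (hq : ∀ c ∈ I, c ≠ a → c ≠ b → R.Adj q c)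
    (hr : ∀ c ∈ I, c ≠ a → c ≠ b → R.Adj r c) (hs : ∀ c ∈ I, c ≠ a → c ≠ b → R.Adj s c)
    (hpr : R.Adj p r) (hqs : R.Adj q s) (hpq : ¬ R.Adj p q) (hqr : ¬ R.Adj q r)
    (hrs : ¬ R.Adj r s) (hsp : ¬ R.Adj s p) : False := by
  obtain ⟨c, hc, hca, hcb⟩ := hI.exists_third a b
  exact h.not_compl_C4_star hpr hqs hpq hqr hrs hsp (hp c hc hca hcb).symm (hq c hc hca hcb).symm
    (hr c hc hca hcb).symm (hs c hc hca hcb).symm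

lemma not_adj_of_same (hI : IsLargeMaximumClique R I) (h : IsReducedGraph R) {u v a b : V}
    (hu : MissesExactly R I u a b) (hv : MissesExactly R I v a b) : ¬ R.Adj u v := by
  classical
  intro huv
  obtain ⟨ha, hb, hu⟩ := hu
  obtain ⟨-, -, hv⟩ := hv
  have hs := R.adj_comm
  by_cases hab : a = b
  · subst hab
    have huI : u ∉ I.erase a := fun hm => by
      have := (hu u (Finset.mem_of_mem_erase hm)).1 (R.irrefl)
      simp_all
    have hvI : v ∉ I.erase a := fun hm => by
      have := (hv v (Finset.mem_of_mem_erase hm)).1 (R.irrefl)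
      simp_all
    have h1 : u ∉ insert v (I.erase a) := by
      simp only [Finset.mem_insert, not_or]
      exact ⟨huv.ne, huI⟩
    have := hI.card_le (insert u (insert v (I.erase a))) (by
      rw [Finset.coe_insert, SimpleGraph.isClique_insert_of_notMem (Finset.mem_coe.not.2 h1),
        Finset.coe_insert, SimpleGraph.isClique_insert_of_notMem (Finset.mem_coe.not.2 hvI)]
      refine ⟨⟨hI.isClique.subset (by simp), fun x hx => ?_⟩, fun x hx => ?_⟩
      · simp only [Finset.coe_erase, Set.mem_sdiff, Finset.mem_coe, Set.mem_singleton_iff] at hx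
        by_contra hn
        exact hx.2 (by simpa using (hv x hx.1).1 hn)
      · simp only [Finset.coe_erase, Set.mem_insert_iff, Set.mem_sdiff, Finset.mem_coe,
          Set.mem_singleton_iff] at hx
        rcases hx with rfl | hx
        · exact huv
        · by_contra hn
          exact hx.2 (by simpa using (hu x hx.1).1 hn))
    rw [Finset.card_insert_of_notMem h1, Finset.card_insert_of_notMem hvI,
      Finset.card_erase_of_mem ha] at this
    have := hI.three_le
    omega
  · have hab' := hI.adj ha hb hab
    obtain ⟨c, hc, hca, hcb⟩ := hI.exists_third a b
    have := hI.adj hc ha hca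
    have := hI.adj hc hb hcb
    apply h.not_compl_C4_star (c := c) huv hab' <;> grind

lemma adj_of_disjoint (hI : IsLargeMaximumClique R I) (h : IsReducedGraph R) {u v a b c d : V}
    (hu : MissesExactly R I u a b) (hv : MissesExactly R I v c d) (hab : a ≠ b) (hca : c ≠ a)
    (hcb : c ≠ b) (hda : d ≠ a) (hdb : d ≠ b) : R.Adj u v := by
  obtain ⟨ha, hb, hu⟩ := hu
  obtain ⟨hc, hd, hv⟩ := hv
  have hs := R.adj_comm
  by_contra huv
  exact h.not_triangle_star (x := u) (a := a) (b := b) (c := v) (hI.adj ha hb hab) (by grind)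
    (by grind) (by grind) (by grind) huv

lemma between_single (hI : IsLargeMaximumClique R I) (h : IsReducedGraph R) {u v w a b : V}
    (hu : MissesExactly R I u a a) (hv : MissesExactly R I v a b) (hw : MissesExactly R I w b b)
    (hab : a ≠ b) (huw : ¬ R.Adj u w) : ¬ R.Adj u v := by
  intro huv
  obtain ⟨ha, hb, hv⟩ := hv
  replace hu := hu.2.2
  replace hw := hw.2.2
  have hs := R.adj_comm
  have hcl : ∀ x ∈ I, ∀ y ∈ I, x ≠ y → R.Adj x y := fun x hx y hy => hI.adj hx hy
  have hab' := hI.adj ha hb hab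
  by_cases hvw : R.Adj v w
  · obtain ⟨c, hc, hca, hcb⟩ := hI.exists_third a b
    apply h.not_compl_pentagon_star (x := c) (g₀ := a) (g₁ := u) (g₂ := w) (g₃ := b) (g₄ := v) <;>
      grind
  · apply hI.not_two_edges h (a := a) (b := b) (p := a) (q := u) (r := w) (s := v) <;> grind

lemma between_double (hI : IsLargeMaximumClique R I) (h : IsReducedGraph R) {u v w a b c : V}
    (hu : MissesExactly R I u a b) (hv : MissesExactly R I v b b) (hw : MissesExactly R I w b c)
    (hab : a ≠ b) (hbc : b ≠ c) (hac : a ≠ c) (huw : ¬ R.Adj u w) : ¬ R.Adj u v := by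
  intro huv
  obtain ⟨ha, hb, hu⟩ := hu
  obtain ⟨-, hc, hw⟩ := hw
  replace hv := hv.2.2
  have hs := R.adj_comm
  have hab' := hI.adj ha hb hab
  have hbc' := hI.adj hb hc hbc
  have hac' := hI.adj ha hc hac
  by_cases hvw : R.Adj v w
  · apply h.not_compl_net (t₀ := b) (t₁ := u) (t₂ := w) (s₀ := v) (s₁ := a) (s₂ := c) <;> grind
  · apply h.not_triangle_star (x := w) (a := c) (b := u) (c := v) <;> grind

lemma forward_single (hI : IsLargeMaximumClique R I) (h : IsReducedGraph R) {u v w x a b : V}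
    (hu : MissesExactly R I u a a) (hv : MissesExactly R I v a a)
    (hw : MissesExactly R I w a b ∨ MissesExactly R I w b b)
    (hx : MissesExactly R I x a b ∨ MissesExactly R I x b b) (hab : a ≠ b)
    (hvw : R.Adj v w) (hux : R.Adj u x) (huw : ¬ R.Adj u w) (hvx : ¬ R.Adj v x) : False := by
  have hn : ∀ {y c d}, (MissesExactly R I y c d) → (c = a ∨ c = b) → (d = a ∨ d = b) →
      ∀ e ∈ I, e ≠ a → e ≠ b → R.Adj y e := fun ⟨_, _, hy⟩ _ _ e he _ _ =>
    by_contra fun hn => by have := (hy e he).1 hn; grind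
  have huv := hI.not_adj_of_same h hu hv
  have key : ∀ {c}, (c = a ∨ c = b) → MissesExactly R I w c b → MissesExactly R I x c b → False :=
    fun hc hw hx => hI.not_two_edges h (a := a) (b := b) (p := v) (q := u) (r := w) (s := x)
      (hn hv (by simp) (by simp)) (hn hu (by simp) (by simp)) (hn hw hc (by simp))
      (hn hx hc (by simp)) hvw hux (by rwa [R.adj_comm]) huw (hI.not_adj_of_same h hw hx)
      (by rwa [R.adj_comm])
  rcases hw with hw | hw <;> rcases hx with hx | hx
  · exact key (Or.inl rfl) hw hx
  · exact hI.between_single h hv hw hx hab hvx hvw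
  · exact hI.between_single h hu hx hw hab huw hux
  · exact key (Or.inr rfl) hw hx

lemma forward_double (hI : IsLargeMaximumClique R I) (h : IsReducedGraph R) {u v w x a b c : V}
    (hu : MissesExactly R I u a b) (hv : MissesExactly R I v a b)
    (hw : MissesExactly R I w b b ∨ MissesExactly R I w b c)
    (hx : MissesExactly R I x b b ∨ MissesExactly R I x b c)
    (hab : a ≠ b) (hbc : b ≠ c) (hac : a ≠ c)
    (hvw : R.Adj v w) (hux : R.Adj u x) (huw : ¬ R.Adj u w) (hvx : ¬ R.Adj v x) : False := by
  have huv := hI.not_adj_of_same h hu hv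
  have hs := R.adj_comm
  rcases hw with hw | hw <;> rcases hx with hx | hx
  · have hwx := hI.not_adj_of_same h hw hx
    replace hu := hu.2.2
    replace hv := hv.2.2
    replace hw := hw.2.2
    replace hx := hx.2.2
    apply hI.not_two_edges h (a := a) (b := b) (p := v) (q := u) (r := w) (s := x) <;> grind
  · exact hI.between_double h hv hw hx hab hbc hac hvx hvw
  · exact hI.between_double h hu hx hw hab hbc hac huw hux
  · have hwx := hI.not_adj_of_same h hw hx
    obtain ⟨ha, hb, hu⟩ := hu
    obtain ⟨-, hc, hw⟩ := hw
    replace hv := hv.2.2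
    replace hx := hx.2.2
    have hcl : ∀ x ∈ I, ∀ y ∈ I, x ≠ y → R.Adj x y := fun x hx y hy => hI.adj hx hy
    apply h.not_F4 (c₀ := a) (c₁ := w) (c₂ := v) (c₃ := c) (c₄ := u) (c₅ := x) (x := b) <;> grind

lemma mixed_single (hI : IsLargeMaximumClique R I) (h : IsReducedGraph R) {u v w x a b z : V}
    (hu : MissesExactly R I u a a) (hv : MissesExactly R I v a a)
    (hw : MissesExactly R I w a b ∨ MissesExactly R I w b b)
    (hx : MissesExactly R I x a z ∨ MissesExactly R I x z z) (hab : a ≠ b) (haz : a ≠ z)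
    (hbz : b ≠ z) (hvw : R.Adj v w) (hvx : R.Adj v x) (huw : ¬ R.Adj u w) (hux : ¬ R.Adj u x) :
    False := by
  have huv := hI.not_adj_of_same h hu hv
  by_cases hwx : R.Adj w x
  · exact h.not_triangle_star hvw hvx hwx huv huw hux
  have hs := R.adj_comm
  rcases hw with hw | hw <;> rcases hx with hx | hx
  · exact hI.between_double h hw.symm hv hx hab.symm haz hbz hwx (by rwa [R.adj_comm])
  · exact hwx (hI.adj_of_disjoint h hw hx hab haz.symm hbz.symm haz.symm hbz.symm)
  · rw [R.adj_comm] at hwx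
    exact hwx (hI.adj_of_disjoint h hx hw haz hab.symm hbz hab.symm hbz)
  · obtain ⟨ha, -, hu⟩ := hu
    obtain ⟨hb, -, hw⟩ := hw
    obtain ⟨hz, -, hx⟩ := hx
    have hcl : ∀ x ∈ I, ∀ y ∈ I, x ≠ y → R.Adj x y := fun x hx y hy => hI.adj hx hy
    apply h.not_compl_net (t₀ := u) (t₁ := w) (t₂ := x) (s₀ := a) (s₁ := b) (s₂ := z) <;> grind

lemma mixed_double (hI : IsLargeMaximumClique R I) (h : IsReducedGraph R) {u v w x a b c z : V}
    (hu : MissesExactly R I u a b) (hv : MissesExactly R I v a b)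
    (hw : MissesExactly R I w b b ∨ MissesExactly R I w b c)
    (hx : MissesExactly R I x a a ∨ MissesExactly R I x a z) (hab : a ≠ b) (hac : a ≠ c)
    (hbc : b ≠ c) (haz : a ≠ z) (hbz : b ≠ z) (hvw : R.Adj v w) (hvx : R.Adj v x)
    (huw : ¬ R.Adj u w) (hux : ¬ R.Adj u x) : False := by
  have huv := hI.not_adj_of_same h hu hv
  by_cases hwx : R.Adj w x
  · exact h.not_triangle_star hvw hvx hwx huv huw hux
  have hs := R.adj_comm
  have hxw := fun e => hwx ((hs x w).1 e)
  rcases hw with hw | hw <;> rcases hx with hx | hx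
  · exact hI.between_single h hw hv.symm hx hab.symm hwx (by rwa [R.adj_comm])
  · exact hxw (hI.adj_of_disjoint h hx hw haz hab.symm hbz hab.symm hbz)
  · exact hwx (hI.adj_of_disjoint h hw hx hbc hab hac hab hac)
  · by_cases hzc : z = c
    · subst hzc
      obtain ⟨ha, hb, hu⟩ := hu
      replace hv := hv.2.2
      obtain ⟨-, hc, hw⟩ := hw
      replace hx := hx.2.2
      have hcl : ∀ x ∈ I, ∀ y ∈ I, x ≠ y → R.Adj x y := fun x hx y hy => hI.adj hx hy
      apply h.not_pentagon_star (x := u) (c₀ := a) (c₁ := w) (c₂ := v) (c₃ := x) (c₄ := b) <;>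
        grind
    · exact hwx (hI.adj_of_disjoint h hw hx hbc hab hac (Ne.symm hbz) hzc)

end IsLargeMaximumClique

/-- Two vertices of the clique are linked if their classes should be close on the circle. -/
def Linked (R : SimpleGraph V) (I : Finset V) (a b : V) : Prop :=
  (∃ x, MissesExactly R I x a b) ∨
    ∃ u v, MissesExactly R I u a a ∧ MissesExactly R I v b b ∧ ¬ R.Adj u v

lemma Linked.symm {a b : V} (h : Linked R I a b) : Linked R I b a := by
  rcases h with ⟨x, hx⟩ | ⟨u, v, hu, hv, huv⟩
  · exact Or.inl ⟨x, hx.symm⟩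
  · exact Or.inr ⟨v, u, hv, hu, fun h => huv h.symm⟩

lemma Linked.mem {a b : V} (h : Linked R I a b) : b ∈ I := by
  rcases h with ⟨x, hx⟩ | ⟨u, v, hu, hv, huv⟩
  · exact hx.2.1
  · exact hv.1

/-- The vertices `u`, `y` form a leg at `a` pointing towards `b`. -/
def IsLeg (R : SimpleGraph V) (I : Finset V) (a b u y : V) : Prop :=
  MissesExactly R I y b b ∧ ¬ R.Adj u y ∧
    (MissesExactly R I u a b ∧ y = b ∨ MissesExactly R I u a a)

namespace IsLargeMaximumClique

lemma exists_leg (hI : IsLargeMaximumClique R I) {a b : V} (h : Linked R I a b) :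
    ∃ u y, IsLeg R I a b u y := by
  rcases h with ⟨x, hx⟩ | ⟨u, v, hu, hv, huv⟩
  · refine ⟨x, b, ⟨hx.2.1, hx.2.1, fun c hc => ?_⟩, (hx.2.2 b hx.2.1).2 (Or.inr rfl),
      Or.inl ⟨hx, rfl⟩⟩
    have := hI.adj hx.2.1 hc
    have : ¬ R.Adj b b := R.irrefl
    grind
  · exact ⟨u, v, hv, huv, Or.inr hu⟩

lemma adj_leg_of_ne (hI : IsLargeMaximumClique R I) (h : IsReducedGraph R) {a b c u y y' : V}
    (hl : IsLeg R I a b u y) (hy' : MissesExactly R I y' c c) (hab : a ≠ b) (hac : a ≠ c)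
    (hbc : b ≠ c) : R.Adj u y' := by
  obtain ⟨hy, huy, ⟨hu, -⟩ | hu⟩ := hl
  · exact hI.adj_of_disjoint h hu hy' hab hac.symm hbc.symm hac.symm hbc.symm
  · by_contra huy'
    obtain ⟨ha, -, hu⟩ := hu
    obtain ⟨hb, -, hy⟩ := hy
    obtain ⟨hc, -, hy'⟩ := hy'
    have hs := R.adj_comm
    have hcl : ∀ x ∈ I, ∀ y ∈ I, x ≠ y → R.Adj x y := fun x hx y hy => hI.adj hx hy
    by_cases hyy : R.Adj y y'
    · apply h.not_triangle_star (x := u) (a := a) (b := y) (c := y') <;> grind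
    · apply h.not_compl_net (t₀ := u) (t₁ := y) (t₂ := y') (s₀ := a) (s₁ := b) (s₂ := c) <;> grind

lemma adj_feet (hI : IsLargeMaximumClique R I) (h : IsReducedGraph R) {a b c d u u' y y' : V}
    (hl : IsLeg R I a b u y) (hl' : IsLeg R I a c u' y') (hab : a ≠ b) (hac : a ≠ c)
    (hbc : b ≠ c) (hd : d ∈ I) (hda : d ≠ a) (hdb : d ≠ b) (hdc : d ≠ c)
    (huu : ¬ R.Adj u u') : R.Adj y y' := by
  have h1 := hI.adj_leg_of_ne h hl hl'.1 hab hac hbc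
  have h2 := hI.adj_leg_of_ne h hl' hl.1 hac hab hbc.symm
  by_contra hyy
  obtain ⟨hy, huy, hu⟩ := hl
  obtain ⟨hy', huy', hu'⟩ := hl'
  have hu : R.Adj u d := by
    by_contra hud
    rcases hu with hu | hu
    · have := (hu.1.2.2 d hd).1 hud; grind
    · have := (hu.2.2 d hd).1 hud; grind
  have hu' : R.Adj u' d := by
    by_contra hud
    rcases hu' with hu | hu
    · have := (hu.1.2.2 d hd).1 hud; grind
    · have := (hu.2.2 d hd).1 hud; grind
  replace hy := hy.2.2 d hd
  replace hy' := hy'.2.2 d hd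
  have hs := R.adj_comm
  apply h.not_compl_C4_star (c := d) (p := u) (q := u') (r := y') (s := y) <;> grind

lemma not_three_links (hI : IsLargeMaximumClique R I) (h : IsReducedGraph R) {a b c d : V}
    (hab : a ≠ b) (hac : a ≠ c) (had : a ≠ d) (hbc : b ≠ c) (hbd : b ≠ d) (hcd : c ≠ d)
    (lb : Linked R I a b) (lc : Linked R I a c) (ld : Linked R I a d) : False := by
  have hb := lb.mem
  have hc := lc.mem
  have hd := ld.mem
  obtain ⟨u₁, y₁, l₁⟩ := hI.exists_leg lb
  obtain ⟨u₂, y₂, l₂⟩ := hI.exists_leg lc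
  obtain ⟨u₃, y₃, l₃⟩ := hI.exists_leg ld
  have f12 := hI.adj_feet h l₁ l₂ hab hac hbc hd had.symm hbd.symm hcd.symm
  have f13 := hI.adj_feet h l₁ l₃ hab had hbd hc hac.symm hbc.symm hcd
  have f23 := hI.adj_feet h l₂ l₃ hac had hcd hb hab.symm hbc hbd
  have g12 := hI.adj_leg_of_ne h l₁ l₂.1 hab hac hbc
  have g13 := hI.adj_leg_of_ne h l₁ l₃.1 hab had hbd
  have g21 := hI.adj_leg_of_ne h l₂ l₁.1 hac hab hbc.symm
  have g23 := hI.adj_leg_of_ne h l₂ l₃.1 hac had hcd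
  have g31 := hI.adj_leg_of_ne h l₃ l₁.1 had hab hbd.symm
  have g32 := hI.adj_leg_of_ne h l₃ l₂.1 had hac hcd.symm
  have hfoot : ∀ {b u y}, a ≠ b → IsLeg R I a b u y → ¬ R.Adj u y ∧ ¬ R.Adj u a ∧ R.Adj y a := by
    rintro b u y hab ⟨hy, huy, hu⟩
    have ha : a ∈ I := by rcases hu with ⟨hu, -⟩ | hu <;> exact hu.1
    refine ⟨huy, ?_, by_contra fun hn => by have := (hy.2.2 a ha).1 hn; grind⟩
    rcases hu with ⟨hu, -⟩ | hu
    · exact (hu.2.2 a ha).2 (Or.inl rfl)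
    · exact (hu.2.2 a ha).2 (Or.inl rfl)
  obtain ⟨a1, b1, c1⟩ := hfoot hab l₁
  obtain ⟨a2, b2, c2⟩ := hfoot hac l₂
  obtain ⟨a3, b3, c3⟩ := hfoot had l₃
  clear l₁ l₂ l₃ hfoot lb lc ld hI hab hac had hbc hbd hcd hb hc hd
  have hs := R.adj_comm
  by_cases h12 : R.Adj u₁ u₂ <;> by_cases h13 : R.Adj u₁ u₃ <;> by_cases h23 : R.Adj u₂ u₃
  · apply h.not_triangle_star (x := a) h12 h13 h23 <;> grind
  · apply h.not_compl_net (t₀ := a) (t₁ := u₂) (t₂ := u₃) (s₀ := u₁) (s₁ := y₂) (s₂ := y₃) <;> grind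
  · apply h.not_compl_net (t₀ := a) (t₁ := u₁) (t₂ := u₃) (s₀ := u₂) (s₁ := y₁) (s₂ := y₃) <;> grind
  · apply h.not_triangle_star (x := u₃) (a := u₁) (b := u₂) (c := y₃) <;> grind
  · apply h.not_compl_net (t₀ := a) (t₁ := u₁) (t₂ := u₂) (s₀ := u₃) (s₁ := y₁) (s₂ := y₂) <;> grind
  · apply h.not_triangle_star (x := u₂) (a := u₁) (b := u₃) (c := y₂) <;> grind
  · apply h.not_triangle_star (x := u₁) (a := u₂) (b := u₃) (c := y₁) <;> grind
  · apply h.not_compl_net (t₀ := u₁) (t₁ := u₂) (t₂ := u₃) (s₀ := y₁) (s₁ := y₂) (s₂ := y₃) <;>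
      grind

/-- A set of clique vertices containing no clique vertex outside has a link leaving it. -/
lemma exists_link_leaving (hI : IsLargeMaximumClique R I) (h : IsReducedGraph R) {S : Set V}
    {x y : V} (hSI : S ⊆ I) (hx : x ∈ S) (hyI : y ∈ I) (hy : y ∉ S) :
    ∃ a ∈ S, ∃ b ∈ I, b ∉ S ∧ Linked R I a b := by
  obtain ⟨z, w, ⟨a, haS, hza⟩, hw, hzw⟩ := h.exists_compl_boundary
    (fun v => ∃ a ∈ S, ¬ R.Adj v a) (x := x) (y := y) ⟨x, hx, R.irrefl⟩
    (by rintro ⟨a, ha, hn⟩; exact hn (hI.adj hyI (hSI ha) (by rintro rfl; exact hy ha)))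
  push Not at hw
  have haI := hSI haS
  obtain ⟨c, d, hwt⟩ := hI.exists_missesExactly h w
  have hcS : c ∉ S := fun hc => (hwt.2.2 c hwt.1).2 (Or.inl rfl) (hw c hc)
  have hdS : d ∉ S := fun hd => (hwt.2.2 d hwt.2.1).2 (Or.inr rfl) (hw d hd)
  obtain ⟨b, hzt⟩ : ∃ b, MissesExactly R I z a b := by
    obtain ⟨p, q, hz⟩ := hI.exists_missesExactly h z
    rcases (hz.2.2 a haI).1 hza with rfl | rfl
    · exact ⟨q, hz⟩
    · exact ⟨p, hz.symm⟩
  by_cases hbS : b ∈ S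
  · have hne : ∀ {p q}, p ∈ S → q ∉ S → q ≠ p := fun hp hq e => hq (e ▸ hp)
    have hab : a = b := by_contra fun hab => hzw (hI.adj_of_disjoint h hzt hwt hab
      (hne haS hcS) (hne hbS hcS) (hne haS hdS) (hne hbS hdS))
    have hcd : c = d := by_contra fun hcd => hzw (hI.adj_of_disjoint h hwt hzt hcd
      (hne haS hcS).symm (hne haS hdS).symm (hne hbS hcS).symm (hne hbS hdS).symm).symm
    subst hab hcd
    exact ⟨a, haS, c, hwt.1, hcS, Or.inr ⟨z, w, hzt, hwt, hzw⟩⟩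
  · exact ⟨a, haS, b, hzt.2.1, hbS, Or.inl ⟨z, hzt⟩⟩

end IsLargeMaximumClique

end

/-- A connected relation of maximum degree two on a finite set lives on a cyclic ordering. -/
lemma exists_cyclic_arrangement {V : Type*} {I : Finset V} {L : V → V → Prop}
    (hsymm : ∀ a b, L a b → L b a) (hI : I.Nonempty)
    (hthree : ∀ a b c d, a ≠ b → a ≠ c → a ≠ d → b ≠ c → b ≠ d → c ≠ d →
      L a b → L a c → L a d → False)
    (hconn : ∀ (S : Set V) (x y : V), S ⊆ I → x ∈ S → y ∈ I → y ∉ S →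
      ∃ a ∈ S, ∃ b ∈ I, b ∉ S ∧ L a b) :
    ∃ a : ℤ → V, (∀ i t : ℤ, a (i + I.card * t) = a i) ∧
      (∀ i j : ℤ, i < j → j < i + I.card → a i ≠ a j) ∧ (∀ i, a i ∈ I) ∧ (∀ x ∈ I, ∃ i, a i = x) ∧
      ∀ i j, L (a i) (a j) → a i ≠ a j → a j = a (i + 1) ∨ a j = a (i - 1) := by
  classical
  have path : ∀ k : ℕ, k + 1 ≤ I.card → ∃ s : ℕ → V, (∀ i, i ≤ k → s i ∈ I) ∧
      (∀ i j, i < j → j ≤ k → s i ≠ s j) ∧ ∀ i, i < k → L (s i) (s (i + 1)) := by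
    intro k
    induction k with
    | zero =>
      intro _
      obtain ⟨x, hx⟩ := hI
      exact ⟨fun _ => x, fun _ _ => hx, fun i j h1 h2 => by omega, fun i hi => by omega⟩
    | succ k ih =>
      intro hk
      obtain ⟨s, hsI, hinj, hL⟩ := ih (by omega)
      obtain ⟨y, hyI, hy⟩ : ∃ y ∈ I, y ∉ (Finset.range (k + 1)).image s := by
        by_contra! hc
        have h1 := Finset.card_le_card (s := I) (fun y hy => hc y hy)
        have h2 := Finset.card_image_le (s := Finset.range (k + 1)) (f := s)
        simp only [Finset.card_range] at h2
        omega
      obtain ⟨z, ⟨i, hi, rfl⟩, x, hxI, hx, hlink⟩ := hconn {z | ∃ i, i ≤ k ∧ s i = z} (s 0) y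
        (by rintro _ ⟨i, hi, rfl⟩; exact hsI i hi) ⟨0, by omega, rfl⟩ hyI
        (by
          rintro ⟨i, hi, rfl⟩
          exact hy (Finset.mem_image_of_mem s (Finset.mem_range.2 (by omega))))
      have hx' : ∀ j, j ≤ k → s j ≠ x := fun j hj e => hx ⟨j, hj, e⟩
      by_cases hik : i = k
      · subst hik
        refine ⟨fun j => if j ≤ i then s j else x, ?_, ?_, ?_⟩
        · intro j _
          by_cases h : j ≤ i
          · simpa [h] using hsI j h
          · simpa [h] using hxI
        · intro j j' hj hj'
          by_cases h : j' ≤ i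
          · simpa [h, show j ≤ i by omega] using hinj j j' hj h
          · simpa [h, show j ≤ i by omega] using hx' j (by omega)
        · intro j hj
          by_cases h : j < i
          · simpa [show j ≤ i by omega, show j + 1 ≤ i by omega] using hL j h
          · obtain rfl : j = i := by omega
            simpa using hlink
      by_cases hi0 : i = 0
      · subst hi0
        refine ⟨fun j => if j = 0 then x else s (j - 1), ?_, ?_, ?_⟩
        · intro j hj
          by_cases h : j = 0
          · simpa [h] using hxI
          · simpa [h] using hsI (j - 1) (by omega)
        · intro j j' hj hj'
          by_cases h : j = 0
          · simpa [h, show j' ≠ 0 by omega] using (hx' (j' - 1) (by omega)).symm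
          · simpa [h, show j' ≠ 0 by omega] using hinj (j - 1) (j' - 1) (by omega) (by omega)
        · intro j hj
          by_cases h : j = 0
          · simpa [h] using hsymm _ _ hlink
          · have := hL (j - 1) (by omega)
            rw [show j - 1 + 1 = j by omega] at this
            simpa [h] using this
      · have h1 := hL (i - 1) (by omega)
        rw [show i - 1 + 1 = i by omega] at h1
        exact (hthree (s i) (s (i - 1)) (s (i + 1)) x (hinj (i - 1) i (by omega) hi).symm
          (hinj i (i + 1) (by omega) (by omega)) (hx' i hi)
          (hinj (i - 1) (i + 1) (by omega) (by omega)) (hx' _ (by omega)) (hx' _ (by omega))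
          (hsymm _ _ h1) (hL i (by omega)) hlink).elim
  obtain ⟨k, hk⟩ : ∃ k, I.card = k + 1 := ⟨I.card - 1, by have := hI.card_pos; omega⟩
  obtain ⟨s, hsI, hinj, hL⟩ := path k hk.ge
  have hsurj : ∀ x ∈ I, ∃ i, i ≤ k ∧ s i = x := by
    intro x hx
    have hinj' : Set.InjOn s (Finset.range (k + 1)) := fun i hi j hj e => by
      simp only [Finset.coe_range, Set.mem_Iio] at hi hj
      by_contra hne
      rcases Nat.lt_or_gt_of_ne hne with h | h
      · exact hinj i j h (by omega) e
      · exact hinj j i h (by omega) e.symm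
    have h1 : (Finset.range (k + 1)).image s = I := Finset.eq_of_subset_of_card_le
      (fun y hy => by
        obtain ⟨i, hi, rfl⟩ := Finset.mem_image.1 hy
        exact hsI i (by simpa [Nat.lt_succ_iff] using hi))
      (by rw [Finset.card_image_of_injOn hinj', hk, Finset.card_range])
    rw [← h1] at hx
    obtain ⟨i, hi, e⟩ := Finset.mem_image.1 hx
    exact ⟨i, by simpa [Nat.lt_succ_iff] using hi, e⟩
  have hlink : ∀ i j, i < j → j ≤ k → L (s i) (s j) → j = i + 1 ∨ i = 0 ∧ j = k := by
    intro i j hij hj hl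
    by_contra! hc
    by_cases hi : i = 0
    · have h1 := hL (j - 1) (by omega)
      rw [show j - 1 + 1 = j by omega] at h1
      have := hc.2 hi
      exact hthree (s j) (s (j - 1)) (s (j + 1)) (s i) (hinj _ _ (by omega) (by omega)).symm
        (hinj _ _ (by omega) (by omega)) (hinj _ _ (by omega) (by omega)).symm
        (hinj _ _ (by omega) (by omega)) (hinj _ _ (by omega) (by omega)).symm
        (hinj _ _ (by omega) (by omega)).symm (hsymm _ _ h1) (hL j (by omega)) (hsymm _ _ hl)
    · have h1 := hL (i - 1) (by omega)
      rw [show i - 1 + 1 = i by omega] at h1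
      exact hthree (s i) (s (i - 1)) (s (i + 1)) (s j) (hinj _ _ (by omega) (by omega)).symm
        (hinj _ _ (by omega) (by omega)) (hinj _ _ (by omega) (by omega))
        (hinj _ _ (by omega) (by omega)) (hinj _ _ (by omega) (by omega))
        (hinj _ _ (by omega) (by omega)) (hsymm _ _ h1) (hL i (by omega)) hl
  have hm : (I.card : ℤ) = k + 1 := by rw [hk]; push_cast; ring
  rw [hm]
  let a : ℤ → V := fun i => s (i % (k + 1)).toNat
  have ha : ∀ (r : ℕ) (t : ℤ), r ≤ k → a (r + (k + 1) * t) = s r := fun r t hr => by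
    simp only [a]
    rw [Int.add_mul_emod_self_left, Int.emod_eq_of_lt (by omega) (by omega), Int.toNat_natCast]
  have hrep : ∀ i : ℤ, ∃ (r : ℕ) (t : ℤ), r ≤ k ∧ i = r + (k + 1) * t := fun i => by
    have h1 := Int.emod_nonneg i (b := (k : ℤ) + 1) (by omega)
    have h2 := Int.emod_lt_of_pos i (b := (k : ℤ) + 1) (by omega)
    refine ⟨(i % (k + 1)).toNat, i / (k + 1), by omega, ?_⟩
    rw [Int.toNat_of_nonneg h1, Int.emod_add_mul_ediv]
  refine ⟨a, fun i t => ?_, fun i j hij hj e => ?_, fun i => ?_, fun x hx => ?_,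
    fun i j hl hne => ?_⟩
  · simp only [a, Int.add_mul_emod_self_left]
  · obtain ⟨r, t, hr, rfl⟩ := hrep i
    obtain ⟨r', t', hr', rfl⟩ := hrep j
    rw [ha r t hr, ha r' t' hr'] at e
    have : r = r' := by
      by_contra hne
      rcases Nat.lt_or_gt_of_ne hne with h | h
      · exact hinj _ _ h hr' e
      · exact hinj _ _ h hr e.symm
    subst this
    have h1 : t < t' := by nlinarith
    nlinarith
  · obtain ⟨r, t, hr, rfl⟩ := hrep i
    rw [ha r t hr]
    exact hsI r hr
  · obtain ⟨i, hi, rfl⟩ := hsurj x hx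
    exact ⟨i + (k + 1) * 0, ha i 0 hi⟩
  · obtain ⟨r, t, hr, rfl⟩ := hrep i
    obtain ⟨r', t', hr', rfl⟩ := hrep j
    rw [ha r t hr, ha r' t' hr'] at hl hne
    rw [ha r' t' hr']
    have hrr : r ≠ r' := fun e => hne (by rw [e])
    rcases Nat.lt_or_gt_of_ne hrr with h | h
    · rcases hlink r r' h hr' hl with rfl | ⟨rfl, rfl⟩
      · left
        rw [← ha (r + 1) t hr']
        congr 1
        push_cast
        ring
      · right
        rw [← ha r' (t - 1) hr']
        congr 1
        push_cast
        ring
    · rcases hlink r' r h hr (hsymm _ _ hl) with rfl | ⟨rfl, rfl⟩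
      · right
        rw [← ha r' t hr']
        congr 1
        push_cast
        ring
      · left
        rw [← ha 0 (t + 1) hr']
        congr 1
        push_cast
        ring

section

variable {V : Type*} {R : SimpleGraph V} {I : Finset V}

/-- The class of `v` on the circle determined by a cyclic ordering `a` of the clique. -/
def CliqueClass (R : SimpleGraph V) (I : Finset V) (a : ℤ → V) (v : V) (p : ℤ) : Prop :=
  ∃ i, p = 2 * i ∧ MissesExactly R I v (a i) (a i) ∨
    p = 2 * i + 1 ∧ MissesExactly R I v (a i) (a (i + 1))

namespace CliqueClass

variable {a : ℤ → V} {v : V} {i d : ℤ}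

lemma even (h : CliqueClass R I a v (2 * i)) : MissesExactly R I v (a i) (a i) := by
  obtain ⟨j, ⟨e, h⟩ | ⟨e, h⟩⟩ := h
  · obtain rfl : j = i := by omega
    exact h
  · omega

lemma odd (h : CliqueClass R I a v (2 * i + 1)) : MissesExactly R I v (a i) (a (i + 1)) := by
  obtain ⟨j, ⟨e, h⟩ | ⟨e, h⟩⟩ := h
  · omega
  · obtain rfl : j = i := by omega
    exact h

lemma even_add (h : CliqueClass R I a v (2 * i + d)) (h0 : 0 < d) (h2 : d ≤ 2) :
    MissesExactly R I v (a i) (a (i + 1)) ∨ MissesExactly R I v (a (i + 1)) (a (i + 1)) := by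
  obtain rfl | rfl : d = 1 ∨ d = 2 := by omega
  · exact Or.inl h.odd
  · exact Or.inr (even (by rwa [show 2 * (i + 1) = 2 * i + 2 by ring]))

lemma odd_add (h : CliqueClass R I a v (2 * i + 1 + d)) (h0 : 0 < d) (h2 : d ≤ 2) :
    MissesExactly R I v (a (i + 1)) (a (i + 1)) ∨ MissesExactly R I v (a (i + 1)) (a (i + 2)) := by
  obtain rfl | rfl : d = 1 ∨ d = 2 := by omega
  · exact Or.inl (even (by rwa [show 2 * (i + 1) = 2 * i + 1 + 1 by ring]))
  · have := odd (i := i + 1) (by rwa [show 2 * (i + 1) + 1 = 2 * i + 1 + 2 by ring])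
    rw [show i + 1 + 1 = i + 2 by ring] at this
    exact Or.inr this

lemma even_sub (h : CliqueClass R I a v (2 * i - d)) (h0 : 0 < d) (h2 : d ≤ 2) :
    MissesExactly R I v (a i) (a (i - 1)) ∨ MissesExactly R I v (a (i - 1)) (a (i - 1)) := by
  obtain rfl | rfl : d = 1 ∨ d = 2 := by omega
  · have := odd (i := i - 1) (by rwa [show 2 * (i - 1) + 1 = 2 * i - 1 by ring])
    rw [sub_add_cancel] at this
    exact Or.inl this.symm
  · exact Or.inr (even (by rwa [show 2 * (i - 1) = 2 * i - 2 by ring]))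

lemma odd_sub (h : CliqueClass R I a v (2 * i + 1 - d)) (h0 : 0 < d) (h2 : d ≤ 2) :
    MissesExactly R I v (a i) (a i) ∨ MissesExactly R I v (a i) (a (i - 1)) := by
  obtain rfl | rfl : d = 1 ∨ d = 2 := by omega
  · exact Or.inl (even (by rwa [show 2 * i = 2 * i + 1 - 1 by ring]))
  · have := odd (i := i - 1) (by rwa [show 2 * (i - 1) + 1 = 2 * i + 1 - 2 by ring])
    rw [sub_add_cancel] at this
    exact Or.inr this.symm

end CliqueClass

namespace IsLargeMaximumClique

lemma cliqueClass_near (hI : IsLargeMaximumClique R I) (h : IsReducedGraph R) {a : ℤ → V}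
    (hper : ∀ i t : ℤ, a (i + I.card * t) = a i)
    (hne : ∀ i j : ℤ, i < j → j < i + I.card → a i ≠ a j)
    (hlink : ∀ i j, Linked R I (a i) (a j) → a i ≠ a j → a j = a (i + 1) ∨ a j = a (i - 1))
    {u w : V} {p d : ℤ} (hd : d ≤ I.card) (hu : CliqueClass R I a u p)
    (hw : CliqueClass R I a w (p + d)) (huw : ¬ R.Adj u w) : d ≤ 2 := by
  have hm := hI.three_le
  by_contra! hd2
  have hwu : ¬ R.Adj w u := by rwa [R.adj_comm]
  obtain ⟨i, ⟨rfl, hu⟩ | ⟨rfl, hu⟩⟩ := hu <;> obtain ⟨j, ⟨e, hw⟩ | ⟨e, hw⟩⟩ := hw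
  · rcases hlink i j (Or.inr ⟨u, w, hu, hw, huw⟩) (hne i j (by omega) (by omega)) with e' | e'
    · exact hne (i + 1) j (by omega) (by omega) e'.symm
    · rw [← hper (i - 1) 1] at e'
      exact hne j (i - 1 + I.card * 1) (by omega) (by omega) e'
  · exact hwu (hI.adj_of_disjoint h hw hu (hne _ _ (by omega) (by omega))
      (hne _ _ (by omega) (by omega)) (hne _ _ (by omega) (by omega))
      (hne _ _ (by omega) (by omega)) (hne _ _ (by omega) (by omega)))
  · exact huw (hI.adj_of_disjoint h hu hw (hne _ _ (by omega) (by omega))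
      (hne _ _ (by omega) (by omega)).symm (hne _ _ (by omega) (by omega)).symm
      (hne _ _ (by omega) (by omega)).symm (hne _ _ (by omega) (by omega)).symm)
  · exact huw (hI.adj_of_disjoint h hu hw (hne _ _ (by omega) (by omega))
      (hne _ _ (by omega) (by omega)).symm (hne _ _ (by omega) (by omega)).symm
      (hne _ _ (by omega) (by omega)).symm (hne _ _ (by omega) (by omega)).symm)

theorem isProperCircularArcGraph_compl [Fintype V] (hI : IsLargeMaximumClique R I)
    (h : IsReducedGraph R) : IsProperCircularArcGraph Rᶜ := by
  have hm := hI.three_le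
  obtain ⟨a, hper, hne, haI, hsurj, hlink⟩ := exists_cyclic_arrangement (I := I)
    (L := Linked R I) (fun _ _ => Linked.symm) (Finset.card_pos.1 (by omega))
    (fun _ _ _ _ => hI.not_three_links h)
    (fun S x y hS hx hyI hy => hI.exists_link_leaving h hS hx hyI hy)
  have near : ∀ {u w p d}, 0 < d → d ≤ (I.card : ℤ) → CliqueClass R I a u p →
      CliqueClass R I a w (p + d) → ¬ R.Adj u w → d ≤ 2 :=
    fun _ hd => hI.cliqueClass_near h hper hne hlink hd
  have near' : ∀ {u w p d}, 0 < d → d ≤ (I.card : ℤ) → CliqueClass R I a u p →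
      CliqueClass R I a w (p - d) → ¬ R.Adj u w → d ≤ 2 := fun {u w p d} h0 hd hu hw huw =>
    near h0 hd hw (by rwa [sub_add_cancel]) (by rwa [R.adj_comm])
  refine CyclicClasses.isProperCircularArcGraph_compl (m := I.card) (K := CliqueClass R I a)
    ⟨by omega, ?_, ?_, ?_, ?_, ?_, ?_, ?_, ?_⟩
  · rintro v p t ⟨i, ⟨rfl, hv⟩ | ⟨rfl, hv⟩⟩
    · exact ⟨i + I.card * t, Or.inl ⟨by ring, by rwa [hper]⟩⟩
    · refine ⟨i + I.card * t, Or.inr ⟨by ring, ?_⟩⟩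
      rwa [add_right_comm, hper, hper]
  · intro v
    obtain ⟨x, y, hv⟩ := hI.exists_missesExactly h v
    obtain ⟨i, rfl⟩ := hsurj x hv.1
    obtain ⟨j, rfl⟩ := hsurj y hv.2.1
    by_cases hij : a i = a j
    · rw [← hij] at hv
      exact ⟨2 * i, i, Or.inl ⟨rfl, hv⟩⟩
    · rcases hlink i j (Or.inl ⟨v, hv⟩) hij with e | e <;> rw [e] at hv
      · exact ⟨2 * i + 1, i, Or.inr ⟨rfl, hv⟩⟩
      · exact ⟨2 * (i - 1) + 1, i - 1, Or.inr ⟨rfl, by rw [sub_add_cancel]; exact hv.symm⟩⟩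
  · intro u v p hu hv
    rcases Int.even_or_odd' p with ⟨i, rfl | rfl⟩
    · exact hI.not_adj_of_same h hu.even hv.even
    · exact hI.not_adj_of_same h hu.odd hv.odd
  · intro u v p hu hv
    by_contra huv
    have := near (by omega) le_rfl hu hv huv
    omega
  · intro u v w p e d he hed hd hu hv hw huw
    have := near (by omega) hd.le hu hw huw
    obtain ⟨rfl, rfl⟩ : e = 1 ∧ d = 2 := by omega
    have hwu : ¬ R.Adj w u := by rwa [R.adj_comm]
    rw [R.adj_comm v w]
    rcases Int.even_or_odd' p with ⟨i, rfl | rfl⟩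
    · rw [show 2 * i + 2 = 2 * (i + 1) by ring] at hw
      have hab := hne i (i + 1) (by omega) (by omega)
      exact ⟨hI.between_single h hu.even hv.odd hw.even hab huw,
        hI.between_single h hw.even hv.odd.symm hu.even hab.symm hwu⟩
    · rw [show 2 * i + 1 + 1 = 2 * (i + 1) by ring] at hv
      rw [show 2 * i + 1 + 2 = 2 * (i + 1) + 1 by ring] at hw
      have hab := hne i (i + 1) (by omega) (by omega)
      have hbc := hne (i + 1) (i + 1 + 1) (by omega) (by omega)
      have hac := hne i (i + 1 + 1) (by omega) (by omega)
      exact ⟨hI.between_double h hu.odd hv.even hw.odd hab hbc hac huw,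
        hI.between_double h hw.odd.symm hv.even hu.odd.symm hbc.symm hab.symm hac.symm hwu⟩
  · intro u v w x p d e hd0 hd he0 he hu hv hw hx hvw hux huw hvx
    have hd2 := near hd0 hd.le hu hw huw
    have he2 := near he0 he.le hv hx hvx
    rcases Int.even_or_odd' p with ⟨i, rfl | rfl⟩
    · exact hI.forward_single h hu.even hv.even (hw.even_add hd0 hd2) (hx.even_add he0 he2)
        (hne _ _ (by omega) (by omega)) hvw hux huw hvx
    · exact hI.forward_double h hu.odd hv.odd (hw.odd_add hd0 hd2) (hx.odd_add he0 he2)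
        (hne _ _ (by omega) (by omega)) (hne _ _ (by omega) (by omega))
        (hne _ _ (by omega) (by omega)) hvw hux huw hvx
  · intro u v w x p d e hd0 hd he0 he hu hv hw hx hvw hux huw hvx
    have hd2 := near' hd0 hd.le hu hw huw
    have he2 := near' he0 he.le hv hx hvx
    rcases Int.even_or_odd' p with ⟨i, rfl | rfl⟩
    · exact hI.forward_single h hu.even hv.even (hw.even_sub hd0 hd2) (hx.even_sub he0 he2)
        (hne _ _ (by omega) (by omega)).symm hvw hux huw hvx
    · exact hI.forward_double h hu.odd.symm hv.odd.symm (hw.odd_sub hd0 hd2)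
        (hx.odd_sub he0 he2) (hne _ _ (by omega) (by omega)).symm
        (hne _ _ (by omega) (by omega)).symm (hne _ _ (by omega) (by omega)).symm hvw hux huw hvx
  · intro u v w x p d e hd0 hd he0 he hu hv hw hx hvw hvx huw hux
    have hd2 := near hd0 hd.le hu hw huw
    have he2 := near' he0 he.le hu hx hux
    rcases Int.even_or_odd' p with ⟨i, rfl | rfl⟩
    · exact hI.mixed_single h hu.even hv.even (hw.even_add hd0 hd2) (hx.even_sub he0 he2)
        (hne _ _ (by omega) (by omega)) (hne _ _ (by omega) (by omega)).symm
        (hne _ _ (by omega) (by omega)).symm hvw hvx huw hux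
    · exact hI.mixed_double h hu.odd hv.odd (hw.odd_add hd0 hd2) (hx.odd_sub he0 he2)
        (hne _ _ (by omega) (by omega)) (hne _ _ (by omega) (by omega))
        (hne _ _ (by omega) (by omega)) (hne _ _ (by omega) (by omega)).symm
        (hne _ _ (by omega) (by omega)).symm hvw hvx huw hux

end IsLargeMaximumClique

end

/-! ### Shortest odd cycles -/

/-- The `n`-periodic sequence `c` runs around a shortest odd cycle of `R`, of length `n ≥ 5`. -/
structure IsShortestOddCycle {V : Type*} (R : SimpleGraph V) (n : ℤ) (c : ℤ → V) : Prop where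
  odd : Odd n
  five_le : 5 ≤ n
  periodic : ∀ j, c (j + n) = c j
  adj_succ : ∀ j, R.Adj (c j) (c (j + 1))
  le_length : ∀ u (w : R.Walk u u), Odd w.length → n ≤ w.length

/-- The vertex `u` is adjacent to both cycle neighbours of `c i`. -/
def SeesBoth {V : Type*} (R : SimpleGraph V) (c : ℤ → V) (i : ℤ) (u : V) : Prop :=
  R.Adj u (c (i - 1)) ∧ R.Adj u (c (i + 1))

/-- The vertex `u` is adjacent to `c i` but to no cycle vertex at distance two from it. -/
def SeesOnly {V : Type*} (R : SimpleGraph V) (c : ℤ → V) (i : ℤ) (u : V) : Prop :=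
  R.Adj u (c i) ∧ ¬ R.Adj u (c (i - 2)) ∧ ¬ R.Adj u (c (i + 2))

lemma Int.eq_or_eq_or_eq_of_dvd {n x : ℤ} (h : n ∣ x) (h1 : -(2 * n) < x) (h2 : x < 2 * n) :
    x = 0 ∨ x = n ∨ x = -n := by
  obtain ⟨q, rfl⟩ := h
  have hn : 0 < n := by omega
  have h3 : q < 2 := by nlinarith
  have h4 : -2 < q := by nlinarith
  obtain rfl | rfl | rfl : q = -1 ∨ q = 0 ∨ q = 1 := by omega
  all_goals simp

lemma SeesBoth.adj {V : Type*} {R : SimpleGraph V} {c : ℤ → V} {u : V} {i j : ℤ}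
    (hu : SeesBoth R c i u) (h : j = i - 1 ∨ j = i + 1) : R.Adj u (c j) := by
  rcases h with rfl | rfl
  · exact hu.1
  · exact hu.2

namespace IsShortestOddCycle

variable {V : Type*} {R : SimpleGraph V} {n : ℤ} {c : ℤ → V} {u v w : V} {i j : ℤ}

lemma eq_of_dvd (hc : IsShortestOddCycle R n c) (h : n ∣ i - j) : c i = c j := by
  have h1 : ∀ (k : ℕ) j, c (j + n * k) = c j := fun k => by
    induction k with
    | zero => simp
    | succ k ih => intro j; rw [← ih j, ← hc.periodic (j + n * k)]; push_cast; ring_nf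
  obtain ⟨q, hq⟩ := h
  obtain ⟨k, rfl | rfl⟩ := q.eq_nat_or_neg
  · rw [← h1 k j, ← hq]; ring_nf
  · rw [← h1 k i]; congr 1; linarith

lemma not_adj_of_adj (hc : IsShortestOddCycle R n c) (huv : R.Adj u v) (hvw : R.Adj v w) :
    ¬ R.Adj u w := by
  intro huw
  have h5 := hc.five_le
  have := hc.le_length u (.cons huv (.cons hvw (.cons huw.symm .nil))) ⟨1, rfl⟩
  simp at this
  omega

lemma reflect (hc : IsShortestOddCycle R n c) : IsShortestOddCycle R n (fun j => c (-j)) where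
  odd := hc.odd
  five_le := hc.five_le
  periodic j := by rw [← hc.periodic (-(j + n))]; ring_nf
  adj_succ j := by
    have := (hc.adj_succ (-(j + 1))).symm
    rwa [show -(j + 1) + 1 = -j by ring] at this
  le_length := hc.le_length

lemma exists_walk (hc : IsShortestOddCycle R n c) (i : ℤ) (k : ℕ) :
    ∃ w : R.Walk (c i) (c (i + k)), w.length = k := by
  induction k with
  | zero => exact ⟨SimpleGraph.Walk.nil.copy rfl (by simp), by simp⟩
  | succ k ih =>
    obtain ⟨w, hw⟩ := ih
    refine ⟨(w.concat (hc.adj_succ (i + k))).copy rfl (by push_cast; ring_nf), by simp [hw]⟩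

/-- Walks of length at most three join cycle vertices no further apart than expected. -/
lemma exists_offset (hc : IsShortestOddCycle R n c) (w : R.Walk (c i) (c j)) (ℓ : ℤ)
    (hw : w.length = ℓ) (hl : ℓ ≤ 3) (h1 : -(n + 1) ≤ j - i) (h2 : j - i ≤ n + 1) :
    ∃ t, -ℓ ≤ t ∧ t ≤ ℓ ∧ 2 ∣ t - ℓ ∧ (j - i = t ∨ j - i = t + n ∨ j - i = t - n) := by
  have h5 := hc.five_le
  obtain ⟨m, hm⟩ := hc.odd
  suffices ∃ t, -ℓ ≤ t ∧ t ≤ ℓ ∧ 2 ∣ t - ℓ ∧ n ∣ j - i - t by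
    obtain ⟨t, ht1, ht2, ht3, ht4⟩ := this
    refine ⟨t, ht1, ht2, ht3, ?_⟩
    have := Int.eq_or_eq_or_eq_of_dvd ht4 (by omega) (by omega)
    omega
  have hr0 := Int.emod_nonneg (j - i) (b := n) (by omega)
  have hr1 := Int.emod_lt_of_pos (j - i) (b := n) (by omega)
  have hr2 : n ∣ j - i - (j - i) % n := Int.dvd_self_sub_emod
  set r := (j - i) % n
  by_cases hp : 2 ∣ r - ℓ
  · refine ⟨r, by omega, ?_, hp, hr2⟩
    obtain ⟨w', hw'⟩ := hc.exists_walk j (n - r).toNat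
    have e : c (j + (n - r).toNat) = c i := hc.eq_of_dvd (by
      rw [Int.toNat_of_nonneg (by omega), show j + (n - r) - i = j - i - r + n by ring]
      exact dvd_add hr2 dvd_rfl)
    have := hc.le_length (c i) (w.append (w'.copy rfl e)) (by
      simp only [SimpleGraph.Walk.length_append, SimpleGraph.Walk.length_copy, hw']
      rw [Nat.odd_iff]
      omega)
    simp only [SimpleGraph.Walk.length_append, SimpleGraph.Walk.length_copy, hw'] at this
    omega
  · refine ⟨r - n, ?_, by omega, by omega, ?_⟩
    · obtain ⟨w', hw'⟩ := hc.exists_walk i r.toNat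
      have e : c (i + r.toNat) = c j := hc.eq_of_dvd (by
        rw [Int.toNat_of_nonneg (by omega), show i + r - j = -(j - i - r) by ring]
        exact hr2.neg_right)
      have := hc.le_length (c i) (w.append (w'.copy rfl e).reverse) (by
        simp only [SimpleGraph.Walk.length_append, SimpleGraph.Walk.length_reverse,
          SimpleGraph.Walk.length_copy, hw']
        rw [Nat.odd_iff]
        omega)
      simp only [SimpleGraph.Walk.length_append, SimpleGraph.Walk.length_reverse,
          SimpleGraph.Walk.length_copy, hw'] at this
      omega
    · rw [show j - i - (r - n) = j - i - r + n by ring]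
      exact dvd_add hr2 dvd_rfl

lemma adj (hc : IsShortestOddCycle R n c) (h : j = i + 1 ∨ i = j + 1) : R.Adj (c i) (c j) := by
  rcases h with rfl | rfl
  · exact hc.adj_succ i
  · exact (hc.adj_succ j).symm

lemma not_adj (hc : IsShortestOddCycle R n c) (h1 : j ≠ i + 1) (h2 : i ≠ j + 1)
    (h3 : i - j < n - 1) (h4 : j - i < n - 1) : ¬ R.Adj (c i) (c j) := by
  intro h
  have h5 := hc.five_le
  obtain ⟨t, ht⟩ := hc.exists_offset (.cons h .nil) 1 rfl (by omega) (by omega) (by omega)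
  omega

lemma offset_of_common (hc : IsShortestOddCycle R n c) (hi : R.Adj u (c i)) (hj : R.Adj u (c j))
    (h1 : -(n + 1) ≤ j - i) (h2 : j - i ≤ n + 1) :
    ∃ t, (t = -2 ∨ t = 0 ∨ t = 2) ∧ (j - i = t ∨ j - i = t + n ∨ j - i = t - n) := by
  obtain ⟨t, ht⟩ := hc.exists_offset (.cons hi.symm (.cons hj .nil)) 2 rfl (by omega) h1 h2
  exact ⟨t, by omega, by omega⟩

lemma offset_of_adj (hc : IsShortestOddCycle R n c) (huv : R.Adj u v) (hi : R.Adj u (c i))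
    (hj : R.Adj v (c j)) (h1 : -(n + 1) ≤ j - i) (h2 : j - i ≤ n + 1) :
    ∃ t, (t = -3 ∨ t = -1 ∨ t = 1 ∨ t = 3) ∧
      (j - i = t ∨ j - i = t + n ∨ j - i = t - n) := by
  obtain ⟨t, ht⟩ := hc.exists_offset (.cons hi.symm (.cons huv (.cons hj .nil))) 3 rfl
    (by omega) h1 h2
  exact ⟨t, by omega, by omega⟩

lemma eq_of_add (hc : IsShortestOddCycle R n c) (h : i = j ∨ i = j + n ∨ i = j - n) :
    c i = c j := by
  rcases h with rfl | rfl | rfl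
  · rfl
  · exact hc.periodic j
  · rw [← hc.periodic (j - n), sub_add_cancel]

lemma adj_iff (hc : IsShortestOddCycle R n c) (h1 : i - j < n - 1) (h2 : j - i < n - 1) :
    R.Adj (c i) (c j) ↔ j = i + 1 ∨ i = j + 1 :=
  ⟨fun h => by_contra fun hn => hc.not_adj (by omega) (by omega) h1 h2 h, hc.adj⟩

lemma seesBoth_adj_iff (hc : IsShortestOddCycle R n c) (hu : SeesBoth R c i u)
    (h1 : i - j < n - 1) (h2 : j - i < n - 1) : R.Adj u (c j) ↔ j = i - 1 ∨ j = i + 1 := by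
  refine ⟨fun h => ?_, hu.adj⟩
  have h5 := hc.five_le
  obtain ⟨m, hm⟩ := hc.odd
  obtain ⟨t, ht, ht'⟩ := hc.offset_of_common hu.1 h (by omega) (by omega)
  obtain ⟨s, hs, hs'⟩ := hc.offset_of_common hu.2 h (by omega) (by omega)
  omega

lemma seesOnly_adj_iff (hc : IsShortestOddCycle R n c) (hu : SeesOnly R c i u)
    (h1 : i - j < n) (h2 : j - i < n) : R.Adj u (c j) ↔ j = i := by
  refine ⟨fun h => ?_, by rintro rfl; exact hu.1⟩
  have h5 := hc.five_le
  obtain ⟨t, rfl | rfl | rfl, ht⟩ := hc.offset_of_common hu.1 h (by omega) (by omega)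
  · rw [hc.eq_of_add (j := i - 2) (by omega)] at h
    exact (hu.2.1 h).elim
  · omega
  · rw [hc.eq_of_add (j := i + 2) (by omega)] at h
    exact (hu.2.2 h).elim

/-- A vertex seeing both cycle neighbours of `c i` can replace `c i` on the cycle. -/
lemma replace (hc : IsShortestOddCycle R n c) (hu : SeesBoth R c i u) :
    IsShortestOddCycle R n (fun j => if n ∣ j - i then u else c j) where
  odd := hc.odd
  five_le := hc.five_le
  periodic j := by
    simp only [show j + n - i = j - i + n by ring, dvd_add_self_right, hc.periodic]
  adj_succ j := by
    have h5 := hc.five_le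
    have key : ∀ {x y : ℤ}, n ∣ x → n ∣ y → x - y ≠ 1 := fun hx hy e => by
      have := Int.le_of_dvd (by omega) (dvd_sub hx hy)
      omega
    by_cases h1 : n ∣ j - i <;> by_cases h2 : n ∣ j + 1 - i
    · exact (key h2 h1 (by ring)).elim
    · simp only [h1, h2, if_true, if_false]
      rw [hc.eq_of_dvd (j := i + 1) (by simpa using h1)]
      exact hu.2
    · simp only [h1, h2, if_true, if_false]
      rw [hc.eq_of_dvd (i := j) (j := i - 1) (by convert h2 using 1; ring)]
      exact hu.1.symm
    · simp only [h1, h2, if_false]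
      exact hc.adj_succ j
  le_length := hc.le_length

lemma exists_replace (hc : IsShortestOddCycle R n c) (hu : SeesBoth R c i u) :
    ∃ c', IsShortestOddCycle R n c' ∧ c' i = u ∧
      ∀ j, j ≠ i → i - j < n → j - i < n → c' j = c j := by
  refine ⟨_, hc.replace hu, by simp, fun j hj h1 h2 => if_neg fun hn => ?_⟩
  have h5 := hc.five_le
  have := Int.eq_or_eq_or_eq_of_dvd hn (by omega) (by omega)
  omega

lemma exists_sees (hi : R.Adj u (c i)) :
    (∃ j, SeesBoth R c j u) ∨ ∃ j, SeesOnly R c j u := by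
  by_cases h1 : R.Adj u (c (i - 2))
  · exact Or.inl ⟨i - 1, by rwa [show i - 1 - 1 = i - 2 by ring], by rwa [sub_add_cancel]⟩
  by_cases h2 : R.Adj u (c (i + 2))
  · exact Or.inl ⟨i + 1, by rwa [add_sub_cancel_right], by rwa [show i + 1 + 1 = i + 2 by ring]⟩
  exact Or.inr ⟨i, hi, h1, h2⟩

/-- Every vertex has a neighbour on a shortest odd cycle of a reduced graph. -/
lemma exists_adj (hc : IsShortestOddCycle R n c) (h : IsReducedGraph R) (z : V) :
    ∃ i, R.Adj z (c i) := by
  have h5 := hc.five_le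
  obtain ⟨m, hm⟩ := hc.odd
  by_contra hz
  by_cases hn : n = 5
  · push Not at hz
    have h04 : R.Adj (c 4) (c 0) := by
      rw [hc.eq_of_add (i := 0) (j := 5) (by omega)]
      exact hc.adj (by omega)
    have hcc := fun i j => hc.adj_iff (i := i) (j := j)
    apply h.not_pentagon_star (x := z) (c₀ := c 0) (c₁ := c 1) (c₂ := c 2) (c₃ := c 3)
      (c₄ := c 4) <;> grind
  obtain ⟨y, w, ⟨i, hyi⟩, hw, hyw⟩ := h.exists_boundary (fun v => ∃ i, R.Adj v (c i))
    (x := c 0) (y := z) ⟨1, hc.adj (by omega)⟩ hz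
  push Not at hw
  have hs := R.adj_comm
  have hcc := fun i j => hc.adj_iff (i := i) (j := j)
  rcases exists_sees hyi with ⟨i, hy⟩ | ⟨i, hy⟩
  · have hyc := fun j => hc.seesBoth_adj_iff (j := j) hy
    apply h.not_F2 (p := c (i + 1)) (q := c i) (r := c (i - 1)) (s := y) (p' := c (i + 2))
      (r' := c (i - 2)) (s' := w) <;> grind
  · have hyc := fun j => hc.seesOnly_adj_iff (j := j) hy
    apply h.not_F1 (x := c i) (a := c (i + 1)) (a' := c (i + 2)) (b := c (i - 1))
      (b' := c (i - 2)) (c := y) (c' := w) <;> grind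

lemma exists_adj_window (hc : IsShortestOddCycle R n c) (h : IsReducedGraph R) (z : V) (i : ℤ) :
    ∃ j, i ≤ j ∧ j < i + n ∧ R.Adj z (c j) := by
  have h5 := hc.five_le
  obtain ⟨j, hj⟩ := hc.exists_adj h z
  have h1 := Int.emod_nonneg (j - i) (b := n) (by omega)
  have h2 := Int.emod_lt_of_pos (j - i) (b := n) (by omega)
  refine ⟨i + (j - i) % n, by omega, by omega, ?_⟩
  rwa [hc.eq_of_dvd (i := i + (j - i) % n) (j := j)]
  rw [show i + (j - i) % n - j = -(j - i - (j - i) % n) by ring]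
  exact Int.dvd_self_sub_emod.neg_right

variable {x : V}

lemma not_adj_of_common (hc : IsShortestOddCycle R n c) (hu : R.Adj u w) (hv : R.Adj v w) :
    ¬ R.Adj u v :=
  hc.not_adj_of_adj hu hv.symm

lemma adj_opposite (hc : IsShortestOddCycle R n c) (h : IsReducedGraph R) (hu : SeesBoth R c i u)
    (hv : SeesOnly R c i v) : R.Adj u v := by
  have h5 := hc.five_le
  obtain ⟨c', hc', hi, hne⟩ := hc.exists_replace hu
  obtain ⟨j, h1, h2, hj⟩ := hc'.exists_adj_window h v i
  by_cases hij : j = i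
  · rw [hij, hi] at hj
    exact hj.symm
  · rw [hne j hij (by omega) (by omega)] at hj
    have := (hc.seesOnly_adj_iff hv (by omega) (by omega)).1 hj
    omega

lemma not_adj_seesOnly_sub_three (hc : IsShortestOddCycle R n c) (h : IsReducedGraph R)
    (hu : SeesOnly R c i u) (hw : SeesOnly R c (i - 3) w) : ¬ R.Adj u w := by
  intro huw
  have h5 := hc.five_le
  have hs := R.adj_comm
  have hcc := fun i j => hc.adj_iff (i := i) (j := j)
  have huc := fun j => hc.seesOnly_adj_iff (j := j) hu
  have hwc := fun j => hc.seesOnly_adj_iff (j := j) hw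
  apply h.not_hexagon (c₀ := u) (c₁ := c i) (c₂ := c (i - 1)) (c₃ := c (i - 2)) (c₄ := c (i - 3))
    (c₅ := w) <;> grind

lemma between_even (hc : IsShortestOddCycle R n c) (h : IsReducedGraph R)
    (hu : SeesBoth R c i u) (hv : SeesOnly R c (i - 2) v) (hw : SeesBoth R c (i - 1) w)
    (huv : R.Adj u v) : R.Adj u w := by
  by_contra huw
  have h5 := hc.five_le
  have hs := R.adj_comm
  have hcc := fun i j => hc.adj_iff (i := i) (j := j)
  have huc := fun j => hc.seesBoth_adj_iff (j := j) hu
  have hvc := fun j => hc.seesOnly_adj_iff (j := j) hv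
  have hwc := fun j => hc.seesBoth_adj_iff (j := j) hw
  have hvw : ¬ R.Adj v w := hc.not_adj_of_common hv.1 (hw.adj (by omega))
  apply h.not_hexagon (c₀ := c (i - 2)) (c₁ := v) (c₂ := u) (c₃ := c (i + 1)) (c₄ := c i)
    (c₅ := w) <;> grind

lemma between_odd (hc : IsShortestOddCycle R n c) (h : IsReducedGraph R)
    (hu : SeesOnly R c i u) (hv : SeesBoth R c (i - 2) v) (hw : SeesOnly R c (i - 1) w)
    (huv : R.Adj u v) : R.Adj u w := by
  have h5 := hc.five_le
  have hvw : ¬ R.Adj w v := hc.not_adj_of_common hw.1 (hv.adj (by omega))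
  obtain ⟨c', hc', hi, hne⟩ := hc.exists_replace hv
  by_contra huw
  refine huw (hc'.adj_opposite h (i := i - 1) ⟨?_, ?_⟩ ⟨?_, ?_, ?_⟩)
  · rwa [show i - 1 - 1 = i - 2 by ring, hi]
  · rw [hne _ (by omega) (by omega) (by omega), sub_add_cancel]
    exact hu.1
  · rw [hne _ (by omega) (by omega) (by omega)]
    exact hw.1
  · rw [hne _ (by omega) (by omega) (by omega)]
    exact hw.2.1
  · rw [hne _ (by omega) (by omega) (by omega)]
    exact hw.2.2

lemma adj_of_even_sub (hc : IsShortestOddCycle R n c)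
    (hw : SeesBoth R c (i - 1) w ∨ SeesOnly R c (i - 2) w) :
    R.Adj w (c (i - 2)) ∧ ¬ R.Adj w (c (i + 1)) := by
  have h5 := hc.five_le
  rcases hw with hw | hw
  · have hwc := fun j => hc.seesBoth_adj_iff (j := j) hw
    grind
  · have hwc := fun j => hc.seesOnly_adj_iff (j := j) hw
    grind

lemma adj_of_odd_sub (hc : IsShortestOddCycle R n c)
    (hw : SeesOnly R c (i - 1) w ∨ SeesBoth R c (i - 2) w) :
    R.Adj w (c (i - 1)) ∧ ¬ R.Adj w (c (i + 1)) := by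
  have h5 := hc.five_le
  rcases hw with hw | hw
  · have hwc := fun j => hc.seesOnly_adj_iff (j := j) hw
    grind
  · have hwc := fun j => hc.seesBoth_adj_iff (j := j) hw
    grind

lemma forward_even (hc : IsShortestOddCycle R n c) (h : IsReducedGraph R)
    (hu : SeesBoth R c i u) (hv : SeesBoth R c i v)
    (hw : SeesBoth R c (i - 1) w ∨ SeesOnly R c (i - 2) w)
    (hx : SeesBoth R c (i - 1) x ∨ SeesOnly R c (i - 2) x)
    (hvw : R.Adj v w) (hux : R.Adj u x) (huw : ¬ R.Adj u w) (hvx : ¬ R.Adj v x) : False := by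
  have h5 := hc.five_le
  have hw := hc.adj_of_even_sub hw
  have hx := hc.adj_of_even_sub hx
  have hs := R.adj_comm
  have hcc := fun i j => hc.adj_iff (i := i) (j := j)
  have huc := fun j => hc.seesBoth_adj_iff (j := j) hu
  have hvc := fun j => hc.seesBoth_adj_iff (j := j) hv
  have huv := hc.not_adj_of_common hu.1 hv.1
  have hwx := hc.not_adj_of_common hw.1 hx.1
  apply h.not_hexagon (c₀ := c (i + 1)) (c₁ := u) (c₂ := x) (c₃ := c (i - 2)) (c₄ := w)
    (c₅ := v) <;> grind

lemma forward_odd (hc : IsShortestOddCycle R n c) (h : IsReducedGraph R)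
    (hu : SeesOnly R c i u) (hv : SeesOnly R c i v)
    (hw : SeesOnly R c (i - 1) w ∨ SeesBoth R c (i - 2) w)
    (hx : SeesOnly R c (i - 1) x ∨ SeesBoth R c (i - 2) x)
    (hvw : R.Adj v w) (hux : R.Adj u x) (huw : ¬ R.Adj u w) (hvx : ¬ R.Adj v x) : False := by
  have h5 := hc.five_le
  have hw := hc.adj_of_odd_sub hw
  have hx := hc.adj_of_odd_sub hx
  have hs := R.adj_comm
  have hcc := fun i j => hc.adj_iff (i := i) (j := j)
  have huc := fun j => hc.seesOnly_adj_iff (j := j) hu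
  have hvc := fun j => hc.seesOnly_adj_iff (j := j) hv
  have huv := hc.not_adj_of_common hu.1 hv.1
  have hwx := hc.not_adj_of_common hw.1 hx.1
  have hw' := hc.not_adj_of_common hw.1 (hc.adj (i := i) (by omega))
  have hx' := hc.not_adj_of_common hx.1 (hc.adj (i := i) (by omega))
  apply h.not_F3 (c₀ := c i) (c₁ := u) (c₂ := x) (c₃ := c (i - 1)) (c₄ := w)
    (c₅ := v) (x := c (i + 1)) <;> grind

/-- The reflection of the cycle exchanges the two sides. -/
lemma seesBoth_reflect (hu : SeesBoth R c i u) : SeesBoth R (fun j => c (-j)) (-i) u :=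
  ⟨by simpa [show -(-i - 1) = i + 1 by ring] using hu.2,
    by simpa [show -(-i + 1) = i - 1 by ring] using hu.1⟩

lemma seesOnly_reflect (hu : SeesOnly R c i u) : SeesOnly R (fun j => c (-j)) (-i) u :=
  ⟨by simpa using hu.1, by simpa [show -(-i - 2) = i + 2 by ring] using hu.2.2,
    by simpa [show -(-i + 2) = i - 2 by ring] using hu.2.1⟩

lemma adj_of_even_add (hc : IsShortestOddCycle R n c)
    (hw : SeesBoth R c (i + 1) w ∨ SeesOnly R c (i + 2) w) :
    R.Adj w (c (i + 2)) ∧ ¬ R.Adj w (c (i - 1)) := by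
  have h5 := hc.five_le
  rcases hw with hw | hw
  · have hwc := fun j => hc.seesBoth_adj_iff (j := j) hw
    grind
  · have hwc := fun j => hc.seesOnly_adj_iff (j := j) hw
    grind

lemma adj_of_odd_add (hc : IsShortestOddCycle R n c)
    (hw : SeesOnly R c (i + 1) w ∨ SeesBoth R c (i + 2) w) :
    R.Adj w (c (i + 1)) ∧ ¬ R.Adj w (c (i - 1)) := by
  have h5 := hc.five_le
  rcases hw with hw | hw
  · have hwc := fun j => hc.seesOnly_adj_iff (j := j) hw
    grind
  · have hwc := fun j => hc.seesBoth_adj_iff (j := j) hw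
    grind

lemma mixed_odd (hc : IsShortestOddCycle R n c) (h : IsReducedGraph R)
    (hu : SeesOnly R c i u) (hv : SeesOnly R c i v)
    (hw : SeesOnly R c (i - 1) w ∨ SeesBoth R c (i - 2) w)
    (hx : SeesOnly R c (i + 1) x ∨ SeesBoth R c (i + 2) x)
    (hvw : R.Adj v w) (hvx : R.Adj v x) (huw : ¬ R.Adj u w) (hux : ¬ R.Adj u x) : False := by
  have h5 := hc.five_le
  have hw := hc.adj_of_odd_sub hw
  have hx := hc.adj_of_odd_add hx
  have hs := R.adj_comm
  have hcc := fun i j => hc.adj_iff (i := i) (j := j)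
  have huc := fun j => hc.seesOnly_adj_iff (j := j) hu
  have hvc := fun j => hc.seesOnly_adj_iff (j := j) hv
  have huv := hc.not_adj_of_common hu.1 hv.1
  have hwx := hc.not_adj_of_adj hvw.symm hvx
  have hw' := hc.not_adj_of_common hw.1 (hc.adj (i := i) (by omega))
  have hx' := hc.not_adj_of_common hx.1 (hc.adj (i := i) (by omega))
  apply h.not_F3 (c₀ := c i) (c₁ := c (i - 1)) (c₂ := w) (c₃ := v) (c₄ := x)
    (c₅ := c (i + 1)) (x := u) <;> grind

lemma mixed_even (hc : IsShortestOddCycle R n c) (h : IsReducedGraph R)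
    (hu : SeesBoth R c i u) (hv : SeesBoth R c i v)
    (hw : SeesBoth R c (i - 1) w ∨ SeesOnly R c (i - 2) w)
    (hx : SeesBoth R c (i + 1) x ∨ SeesOnly R c (i + 2) x)
    (hvw : R.Adj v w) (hvx : R.Adj v x) (huw : ¬ R.Adj u w) (hux : ¬ R.Adj u x) : False := by
  have h5 := hc.five_le
  have hw := hc.adj_of_even_sub hw
  have hx := hc.adj_of_even_add hx
  have huv := hc.not_adj_of_common hu.1 hv.1
  obtain ⟨c₁, hc₁, hi₁, hne₁⟩ := hc.exists_replace hv
  have hw₁ : SeesBoth R c₁ (i - 1) w := by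
    refine ⟨?_, by rw [sub_add_cancel, hi₁]; exact hvw.symm⟩
    rw [hne₁ _ (by omega) (by omega) (by omega), show i - 1 - 1 = i - 2 by ring]
    exact hw.1
  obtain ⟨c₂, hc₂, hi₂, hne₂⟩ := hc₁.exists_replace hw₁
  have hx₂ : SeesBoth R c₂ (i + 1) x := by
    constructor
    · rw [hne₂ _ (by omega) (by omega) (by omega), add_sub_cancel_right, hi₁]
      exact hvx.symm
    · rw [hne₂ _ (by omega) (by omega) (by omega), hne₁ _ (by omega) (by omega) (by omega),
        show i + 1 + 1 = i + 2 by ring]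
      exact hx.1
  obtain ⟨c₃, hc₃, hi₃, hne₃⟩ := hc₂.exists_replace hx₂
  obtain ⟨j, h1, h2, hj⟩ := hc₃.exists_adj_window h u (i - 1)
  by_cases j₃ : j = i + 1
  · rw [j₃, hi₃] at hj
    exact hux hj
  rw [hne₃ j j₃ (by omega) (by omega)] at hj
  by_cases j₂ : j = i - 1
  · rw [j₂, hi₂] at hj
    exact huw hj
  rw [hne₂ j j₂ (by omega) (by omega)] at hj
  by_cases j₁ : j = i
  · rw [j₁, hi₁] at hj
    exact huv hj
  rw [hne₁ j j₁ (by omega) (by omega)] at hj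
  have := (hc.seesBoth_adj_iff hu (by omega) (by omega)).1 hj
  omega

end IsShortestOddCycle

/-- The class of `v` on a circle of `2 * n` positions determined by a shortest odd cycle. -/
def CycleClass {V : Type*} (R : SimpleGraph V) (c : ℤ → V) (v : V) (p : ℤ) : Prop :=
  Even p ∧ SeesBoth R c p v ∨ Odd p ∧ SeesOnly R c p v

namespace IsShortestOddCycle

variable {V : Type*} {R : SimpleGraph V} {n : ℤ} {c : ℤ → V} {u v w x : V} {i j p d e : ℤ}

lemma seesBoth_congr (hc : IsShortestOddCycle R n c) (h : n ∣ i - j) (hu : SeesBoth R c i u) :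
    SeesBoth R c j u := by
  refine ⟨?_, ?_⟩
  · rw [hc.eq_of_dvd (j := i - 1) (by
      rw [show j - 1 - (i - 1) = -(i - j) by ring]; exact h.neg_right)]
    exact hu.1
  · rw [hc.eq_of_dvd (j := i + 1) (by
      rw [show j + 1 - (i + 1) = -(i - j) by ring]; exact h.neg_right)]
    exact hu.2

lemma seesOnly_congr (hc : IsShortestOddCycle R n c) (h : n ∣ i - j) (hu : SeesOnly R c i u) :
    SeesOnly R c j u := by
  refine ⟨?_, ?_, ?_⟩
  · rw [hc.eq_of_dvd (j := i) (by
      rw [show j - i = -(i - j) by ring]; exact h.neg_right)]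
    exact hu.1
  · rw [hc.eq_of_dvd (j := i - 2) (by
      rw [show j - 2 - (i - 2) = -(i - j) by ring]; exact h.neg_right)]
    exact hu.2.1
  · rw [hc.eq_of_dvd (j := i + 2) (by
      rw [show j + 2 - (i + 2) = -(i - j) by ring]; exact h.neg_right)]
    exact hu.2.2

lemma cycleClass_even (h : CycleClass R c v p) (hp : Even p) : SeesBoth R c p v := by
  rcases h with ⟨-, h⟩ | ⟨hp', -⟩
  · exact h
  · exact (Int.not_odd_iff_even.2 hp hp').elim

lemma cycleClass_odd (h : CycleClass R c v p) (hp : Odd p) : SeesOnly R c p v := by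
  rcases h with ⟨hp', -⟩ | ⟨-, h⟩
  · exact (Int.not_odd_iff_even.2 hp' hp).elim
  · exact h

lemma cycleClass_reflect (h : CycleClass R c v p) : CycleClass R (fun j => c (-j)) v (-p) := by
  rcases h with ⟨hp, h⟩ | ⟨hp, h⟩
  · exact Or.inl ⟨hp.neg, seesBoth_reflect h⟩
  · exact Or.inr ⟨hp.neg, seesOnly_reflect h⟩

lemma cycleClass_near (hc : IsShortestOddCycle R n c) (h : IsReducedGraph R) (h0 : 0 < d)
    (hd : d < n) (hu : CycleClass R c u p) (hw : CycleClass R c w (p + d)) (huw : R.Adj u w) :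
    d = n - 1 ∨ d = n - 2 := by
  have h5 := hc.five_le
  obtain ⟨m, hm⟩ := hc.odd
  rcases hu with ⟨⟨q, hq⟩, hu⟩ | ⟨⟨q, hq⟩, hu⟩ <;> rcases hw with ⟨⟨r, hr⟩, hw⟩ | ⟨⟨r, hr⟩, hw⟩
  · obtain ⟨t, ht, ht'⟩ := hc.offset_of_adj huw hu.2 hw.2 (by omega) (by omega)
    obtain ⟨s, hs, hs'⟩ := hc.offset_of_adj huw hu.2 hw.1 (by omega) (by omega)
    omega
  · obtain ⟨t, ht, ht'⟩ := hc.offset_of_adj huw hu.2 hw.1 (by omega) (by omega)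
    omega
  · obtain ⟨t, ht, ht'⟩ := hc.offset_of_adj huw hu.1 hw.1 (by omega) (by omega)
    omega
  · obtain ⟨t, ht, ht'⟩ := hc.offset_of_adj huw hu.1 hw.1 (by omega) (by omega)
    by_cases hd3 : d = n - 3
    · refine (hc.not_adj_seesOnly_sub_three h hu (hc.seesOnly_congr ?_ hw) huw).elim
      rw [hd3, show p + (n - 3) - (p - 3) = n by ring]
    · omega

lemma even_add (hc : IsShortestOddCycle R n c) (hd : d = n - 1 ∨ d = n - 2) (hp : Even p)
    (hw : CycleClass R c w (p + d)) : SeesBoth R c (p - 1) w ∨ SeesOnly R c (p - 2) w := by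
  obtain ⟨m, hm⟩ := hc.odd
  obtain ⟨q, hq⟩ := hp
  rcases hd with rfl | rfl
  · exact Or.inl (hc.seesBoth_congr (by ring_nf; rfl) (cycleClass_even hw ⟨q + m, by omega⟩))
  · exact Or.inr (hc.seesOnly_congr (by ring_nf; rfl) (cycleClass_odd hw ⟨q + m - 1, by omega⟩))

lemma odd_add (hc : IsShortestOddCycle R n c) (hd : d = n - 1 ∨ d = n - 2) (hp : Odd p)
    (hw : CycleClass R c w (p + d)) : SeesOnly R c (p - 1) w ∨ SeesBoth R c (p - 2) w := by
  obtain ⟨m, hm⟩ := hc.odd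
  obtain ⟨q, hq⟩ := hp
  rcases hd with rfl | rfl
  · exact Or.inl (hc.seesOnly_congr (by ring_nf; rfl) (cycleClass_odd hw ⟨q + m, by omega⟩))
  · exact Or.inr (hc.seesBoth_congr (by ring_nf; rfl) (cycleClass_even hw ⟨q + m, by omega⟩))

lemma even_sub (hc : IsShortestOddCycle R n c) (hd : d = n - 1 ∨ d = n - 2) (hp : Even p)
    (hw : CycleClass R c w (p - d)) : SeesBoth R c (p + 1) w ∨ SeesOnly R c (p + 2) w := by
  have hw' := cycleClass_reflect hw
  rw [neg_sub, sub_eq_neg_add] at hw'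
  refine (hc.reflect.even_add hd hp.neg hw').imp (fun h => ?_) (fun h => ?_)
  · simpa [add_comm] using seesBoth_reflect h
  · simpa [add_comm] using seesOnly_reflect h

lemma odd_sub (hc : IsShortestOddCycle R n c) (hd : d = n - 1 ∨ d = n - 2) (hp : Odd p)
    (hw : CycleClass R c w (p - d)) : SeesOnly R c (p + 1) w ∨ SeesBoth R c (p + 2) w := by
  have hw' := cycleClass_reflect hw
  rw [neg_sub, sub_eq_neg_add] at hw'
  refine (hc.reflect.odd_add hd hp.neg hw').imp (fun h => ?_) (fun h => ?_)
  · simpa [add_comm] using seesOnly_reflect h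
  · simpa [add_comm] using seesBoth_reflect h

lemma cycleClass_forward (hc : IsShortestOddCycle R n c) (h : IsReducedGraph R) (hd0 : 0 < d)
    (hd : d < n) (he0 : 0 < e) (he : e < n) (hu : CycleClass R c u p) (hv : CycleClass R c v p)
    (hw : CycleClass R c w (p + d)) (hx : CycleClass R c x (p + e)) (hvw : R.Adj v w)
    (hux : R.Adj u x) (huw : ¬ R.Adj u w) (hvx : ¬ R.Adj v x) : False := by
  have hd' := hc.cycleClass_near h hd0 hd hv hw hvw
  have he' := hc.cycleClass_near h he0 he hu hx hux
  rcases Int.even_or_odd p with hp | hp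
  · exact hc.forward_even h (cycleClass_even hu hp) (cycleClass_even hv hp)
      (hc.even_add hd' hp hw) (hc.even_add he' hp hx) hvw hux huw hvx
  · exact hc.forward_odd h (cycleClass_odd hu hp) (cycleClass_odd hv hp)
      (hc.odd_add hd' hp hw) (hc.odd_add he' hp hx) hvw hux huw hvx

lemma cycleClass_between (hc : IsShortestOddCycle R n c) (h : IsReducedGraph R) (he : 0 < e)
    (hed : e < d) (hd : d < n) (hu : CycleClass R c u p) (hv : CycleClass R c v (p + e))
    (hw : CycleClass R c w (p + d)) (huw : ¬ R.Adj u w) : ¬ R.Adj u v := by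
  intro huv
  have := hc.cycleClass_near h he (by omega) hu hv huv
  obtain ⟨rfl, rfl⟩ : e = n - 2 ∧ d = n - 1 := by omega
  obtain ⟨m, hm⟩ := hc.odd
  rcases Int.even_or_odd p with hp | hp
  · obtain ⟨q, hq⟩ := id hp
    exact huw (hc.between_even h (cycleClass_even hu hp)
      (hc.seesOnly_congr (by ring_nf; rfl) (cycleClass_odd hv ⟨q + m - 1, by omega⟩))
      (hc.seesBoth_congr (by ring_nf; rfl) (cycleClass_even hw ⟨q + m, by omega⟩)) huv)
  · obtain ⟨q, hq⟩ := id hp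
    exact huw (hc.between_odd h (cycleClass_odd hu hp)
      (hc.seesBoth_congr (by ring_nf; rfl) (cycleClass_even hv ⟨q + m, by omega⟩))
      (hc.seesOnly_congr (by ring_nf; rfl) (cycleClass_odd hw ⟨q + m, by omega⟩)) huv)

theorem isProperCircularArcGraph_compl [Fintype V] (hc : IsShortestOddCycle R n c)
    (h : IsReducedGraph R) : IsProperCircularArcGraph Rᶜ := by
  have h5 := hc.five_le
  refine CyclicClasses.isProperCircularArcGraph_compl (m := n) (K := CycleClass R c)
    ⟨by omega, ?_, ?_, ?_, ?_, ?_, ?_, ?_, ?_⟩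
  · rintro v p t (⟨hp, hv⟩ | ⟨hp, hv⟩)
    · exact Or.inl ⟨hp.add ((even_two.mul_right n).mul_right t),
        hc.seesBoth_congr ⟨-2 * t, by ring⟩ hv⟩
    · exact Or.inr ⟨hp.add_even ((even_two.mul_right n).mul_right t),
        hc.seesOnly_congr ⟨-2 * t, by ring⟩ hv⟩
  · intro v
    obtain ⟨i, hi⟩ := hc.exists_adj h v
    rcases exists_sees hi with ⟨j, hj⟩ | ⟨j, hj⟩
    · rcases Int.even_or_odd j with hp | hp
      · exact ⟨j, Or.inl ⟨hp, hj⟩⟩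
      · exact ⟨j + n, Or.inl ⟨hp.add_odd hc.odd, hc.seesBoth_congr (by simp) hj⟩⟩
    · rcases Int.even_or_odd j with hp | hp
      · exact ⟨j + n, Or.inr ⟨hp.add_odd hc.odd, hc.seesOnly_congr (by simp) hj⟩⟩
      · exact ⟨j, Or.inr ⟨hp, hj⟩⟩
  · intro u v p hu hv
    rcases Int.even_or_odd p with hp | hp
    · exact hc.not_adj_of_common (cycleClass_even hu hp).1 (cycleClass_even hv hp).1
    · exact hc.not_adj_of_common (cycleClass_odd hu hp).1 (cycleClass_odd hv hp).1
  · intro u v p hu hv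
    rcases Int.even_or_odd p with hp | hp
    · exact hc.adj_opposite h (cycleClass_even hu hp)
        (hc.seesOnly_congr (by simp) (cycleClass_odd hv (hp.add_odd hc.odd)))
    · exact (hc.adj_opposite h
        (hc.seesBoth_congr (by simp) (cycleClass_even hv (hp.add_odd hc.odd)))
        (cycleClass_odd hu hp)).symm
  · intro u v w p e d he hed hd hu hv hw huw
    refine ⟨hc.cycleClass_between h he hed hd hu hv hw huw, fun hvw => ?_⟩
    refine hc.reflect.cycleClass_between h (p := -(p + d)) (e := d - e) (d := d) (by omega)
      (by omega) hd (cycleClass_reflect hw) ?_ ?_ (fun e => huw e.symm) hvw.symm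
    · rw [show -(p + d) + (d - e) = -(p + e) by ring]
      exact cycleClass_reflect hv
    · rw [show -(p + d) + d = -p by ring]
      exact cycleClass_reflect hu
  · intro u v w x p d e hd0 hd he0 he hu hv hw hx hvw hux huw hvx
    exact hc.cycleClass_forward h hd0 hd he0 he hu hv hw hx hvw hux huw hvx
  · intro u v w x p d e hd0 hd he0 he hu hv hw hx hvw hux huw hvx
    refine hc.reflect.cycleClass_forward h hd0 hd he0 he (cycleClass_reflect hu)
      (cycleClass_reflect hv) ?_ ?_ hvw hux huw hvx
    · rw [show -p + d = -(p - d) by ring]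
      exact cycleClass_reflect hw
    · rw [show -p + e = -(p - e) by ring]
      exact cycleClass_reflect hx
  · intro u v w x p d e hd0 hd he0 he hu hv hw hx hvw hvx huw hux
    have hd' := hc.cycleClass_near h hd0 hd hv hw hvw
    have he' := hc.cycleClass_near h he0 he hx (by rwa [sub_add_cancel]) hvx.symm
    rcases Int.even_or_odd p with hp | hp
    · exact hc.mixed_even h (cycleClass_even hu hp) (cycleClass_even hv hp)
        (hc.even_add hd' hp hw) (hc.even_sub he' hp hx) hvw hvx huw hux
    · exact hc.mixed_odd h (cycleClass_odd hu hp) (cycleClass_odd hv hp)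
        (hc.odd_add hd' hp hw) (hc.odd_sub he' hp hx) hvw hvx huw hux

end IsShortestOddCycle

/-- A triangle-free graph that is not bipartite has a shortest odd cycle. -/
lemma exists_isShortestOddCycle {V : Type*} {R : SimpleGraph V} (hnb : ¬ IsBipartite R)
    (htri : ∀ a b c, R.Adj a b → R.Adj b c → ¬ R.Adj a c) :
    ∃ n c, IsShortestOddCycle R n c := by
  classical
  have hodd : ∃ (N : ℕ) (u : V) (w : R.Walk u u), Odd w.length ∧ w.length = N := by
    by_contra! hev
    refine hnb ?_
    obtain ⟨C⟩ := SimpleGraph.two_colorable_iff_forall_loop_even.2 fun u w =>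
      Nat.not_odd_iff_even.1 fun ho => hev _ u w ho rfl
    refine ⟨fun v => decide (C v = 0), fun u v huv e => C.valid huv ?_⟩
    have : C u = 0 ↔ C v = 0 := by simpa using e
    generalize C u = x at *
    generalize C v = y at *
    omega
  obtain ⟨u, w, ho, hN⟩ := Nat.find_spec hodd
  have hmin : ∀ (u' : V) (w' : R.Walk u' u'), Odd w'.length → w.length ≤ w'.length :=
    fun u' w' ho' => hN ▸ Nat.find_min' hodd ⟨u', w', ho', rfl⟩
  clear hN
  have hadj : ∀ i, i < w.length → R.Adj (w.getVert i) (w.getVert (i + 1)) :=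
    fun i hi => w.adj_getVert_succ hi
  have h5 : 5 ≤ w.length := by
    obtain ⟨k, hk⟩ := ho
    by_contra! hlt
    have h0 := w.getVert_zero
    have hl := w.getVert_length
    have h1 := hadj 0 (by omega)
    obtain rfl | rfl : k = 0 ∨ k = 1 := by omega
    · rw [hk] at hl
      rw [h0] at h1
      simp only [mul_zero, zero_add] at hl h1
      rw [hl] at h1
      exact R.irrefl h1
    · have h2 := hadj 1 (by omega)
      have h3 := hadj 2 (by omega)
      rw [hk] at hl
      norm_num at hl h1 h2 h3
      rw [hl] at h3
      exact htri _ _ _ h1 h2 h3.symm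
  have hm0 := fun j => Int.emod_nonneg j (b := (w.length : ℤ)) (by omega)
  have hm1 := fun j => Int.emod_lt_of_pos j (b := (w.length : ℤ)) (by omega)
  refine ⟨w.length, fun j => w.getVert (j % w.length).toNat, by exact_mod_cast ho,
    by exact_mod_cast h5, fun j => by simp, fun j => ?_, fun u' w' ho' => by
      exact_mod_cast hmin u' w' ho'⟩
  have h0 := hm0 j
  have h1 := hm1 j
  have h := hadj (j % w.length).toNat (by omega)
  by_cases hlast : j % w.length + 1 = w.length
  · have e : (j + 1) % (w.length : ℤ) = 0 := by
      rw [← Int.emod_add_emod, hlast, Int.emod_self]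
    rw [show (j % (w.length : ℤ)).toNat + 1 = w.length by omega, w.getVert_length] at h
    simpa [e] using h
  · have e : (j + 1) % (w.length : ℤ) = j % w.length + 1 := by
      rw [← Int.emod_add_emod, Int.emod_eq_of_lt (by omega) (by omega)]
    rw [show (j % (w.length : ℤ)).toNat + 1 = (j % w.length + 1).toNat by omega, ← e] at h
    exact h

/-- If a reduced graph `R` is not bipartite, then the complement
of `R` is a proper circular-arc graph. -/
theorem reduced_nonbipartite_compl_pcag {V : Type*} [Fintype V] (R : SimpleGraph V)
    (hR : IsReducedGraph R) (hnb : ¬ IsBipartite R) :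
    IsProperCircularArcGraph Rᶜ := by
  classical
  by_cases htri : ∀ a b c, R.Adj a b → R.Adj b c → ¬ R.Adj a c
  · obtain ⟨n, c, hc⟩ := exists_isShortestOddCycle hnb htri
    exact hc.isProperCircularArcGraph_compl hR
  · push Not at htri
    obtain ⟨a, b, c, hab, hbc, hac⟩ := htri
    have hcl : R.IsClique (({a, b, c} : Finset V) : Set V) := by
      simp only [Finset.coe_insert, Finset.coe_singleton]
      intro x hx y hy hxy
      have hs := R.adj_comm
      simp only [Set.mem_insert_iff, Set.mem_singleton_iff] at hx hy
      grind
    obtain ⟨I, hI, hmax⟩ := Finset.exists_max_image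
      (Finset.univ.filter fun t : Finset V => R.IsClique (t : Set V)) Finset.card
      ⟨{a, b, c}, by simpa using hcl⟩
    simp only [Finset.mem_filter, Finset.mem_univ, true_and] at hI hmax
    refine IsLargeMaximumClique.isProperCircularArcGraph_compl ⟨hI, hmax, ?_⟩ hR
    rw [← Finset.card_eq_three.2 ⟨a, b, c, hab.ne, hac.ne, hbc.ne, rfl⟩]
    exact hmax _ hcl
end

section
/- Let R be a reduced graph and let B be an induced cycle of R of even length at least 8. Then no vertex of B is contained in a triangle of R. -/
namespace IsInducedCycle

variable {V : Type*} {G : SimpleGraph V} {ℓ : ℕ} {f : ZMod ℓ → V}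

theorem adj_add_natCast (h : IsInducedCycle G ℓ f) (i : ZMod ℓ) {j k : ℕ}
    (hj : j + 1 < ℓ) (hk : k + 1 < ℓ) :
    G.Adj (f (i + j)) (f (i + k)) ↔ j = k + 1 ∨ k = j + 1 := by
  have cast_eq {a b : ℕ} (ha : a < ℓ) (hb : b < ℓ) : (a : ZMod ℓ) = b ↔ a = b := by
    rw [ZMod.natCast_eq_natCast_iff, Nat.ModEq, Nat.mod_eq_of_lt ha, Nat.mod_eq_of_lt hb]
  rw [h.2.2, add_assoc, add_assoc, add_right_inj, add_right_inj, ← Nat.cast_succ,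
    ← Nat.cast_succ, cast_eq (by omega) hk, cast_eq (by omega) hj]

end IsInducedCycle

section ForbiddenSubgraphs

variable {V : Type*} {G : SimpleGraph V}

/-- In a graph without `C_3*`, every triangle is dominating. -/
theorem adj_triangle_of_not_hasCycleStar (h : ¬ HasCycleStar G 3) {a b c : V}
    (hab : G.Adj a b) (hac : G.Adj a c) (hbc : G.Adj b c) (v : V) :
    G.Adj v a ∨ G.Adj v b ∨ G.Adj v c := by
  by_contra! hv
  have hinj : Function.Injective (![a, b, c] : Fin 3 → V) := by
    intro i j
    have := hab.ne
    have := hac.ne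
    have := hbc.ne
    fin_cases i <;> fin_cases j <;> simp_all [eq_comm]
  have hadj (i j : Fin 3) :
      G.Adj ((![a, b, c] : Fin 3 → V) i) ((![a, b, c] : Fin 3 → V) j) ↔ i = j + 1 ∨ j = i + 1 := by
    fin_cases i <;> fin_cases j <;> simp [hab, hac, hbc, hab.symm, hac.symm, hbc.symm]
  refine h ⟨(![a, b, c] : Fin 3 → V), v, ⟨le_rfl, hinj, hadj⟩, fun i => ?_⟩
  fin_cases i <;> simp [hv]

/-- In a graph without the complement of `C_4*`, two edges inducing a `2K_2` have no
common neighbour. -/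
theorem false_of_butterfly (h : ¬ ContainsInduced G compC4star) {a b c d x : V}
    (hab : G.Adj a b) (hcd : G.Adj c d) (hac : ¬ G.Adj a c) (had : ¬ G.Adj a d)
    (hbc : ¬ G.Adj b c) (hbd : ¬ G.Adj b d) (hxa : G.Adj x a) (hxb : G.Adj x b)
    (hxc : G.Adj x c) (hxd : G.Adj x d) : False := by
  have hac' : a ≠ c := by rintro rfl; exact hbc hab.symm
  have had' : a ≠ d := by rintro rfl; exact hbd hab.symm
  have hbc' : b ≠ c := by rintro rfl; exact hac hab
  have hbd' : b ≠ d := by rintro rfl; exact had hab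
  refine h ⟨![a, c, b, d, x], ?_, ?_⟩
  · intro i j
    have := hab.ne
    have := hcd.ne
    have := hxa.ne
    have := hxb.ne
    have := hxc.ne
    have := hxd.ne
    fin_cases i <;> fin_cases j <;> simp_all [eq_comm]
  · intro i j
    fin_cases i <;> fin_cases j <;>
      simp_all [compC4star, SimpleGraph.adj_comm]

theorem hasCycleStar_five {a b c d e v : V}
    (hab : G.Adj a b) (hbc : G.Adj b c) (hcd : G.Adj c d) (hde : G.Adj d e) (hea : G.Adj e a)
    (hac : ¬ G.Adj a c) (hbd : ¬ G.Adj b d) (hce : ¬ G.Adj c e) (hda : ¬ G.Adj d a)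
    (heb : ¬ G.Adj e b) (hva : ¬ G.Adj v a) (hvb : ¬ G.Adj v b) (hvc : ¬ G.Adj v c)
    (hvd : ¬ G.Adj v d) (hve : ¬ G.Adj v e) : HasCycleStar G 5 := by
  have hac' : a ≠ c := by rintro rfl; exact hda hcd.symm
  have hbd' : b ≠ d := by rintro rfl; exact hda hab.symm
  have hce' : c ≠ e := by rintro rfl; exact hac hea.symm
  have hda' : d ≠ a := by rintro rfl; exact hac hcd.symm
  have heb' : e ≠ b := by rintro rfl; exact hbd hde.symm
  have hinj : Function.Injective (![a, b, c, d, e] : Fin 5 → V) := by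
    have := hab.ne
    have := hbc.ne
    have := hcd.ne
    have := hde.ne
    have := hea.ne
    intro i j
    fin_cases i <;> fin_cases j <;> simp_all [eq_comm]
  have hadj (i j : Fin 5) : G.Adj ((![a, b, c, d, e] : Fin 5 → V) i)
      ((![a, b, c, d, e] : Fin 5 → V) j) ↔ i = j + 1 ∨ j = i + 1 := by
    fin_cases i <;> fin_cases j <;>
      simp [hab, hbc, hcd, hde, hea, hab.symm, hbc.symm, hcd.symm, hde.symm, hea.symm,
        hac, hbd, hce, hda, heb, G.adj_comm c a, G.adj_comm d b, G.adj_comm e c,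
        G.adj_comm a d, G.adj_comm b e]
  refine ⟨(![a, b, c, d, e] : Fin 5 → V), v, ⟨by norm_num, hinj, hadj⟩, fun i => ?_⟩
  fin_cases i <;> simp [hva, hvb, hvc, hvd, hve]

end ForbiddenSubgraphs

/-- No vertex is adjacent to two consecutive vertices of a long hole. -/
theorem IsInducedCycle.not_adj_succ {V : Type*} {G : SimpleGraph V} {ℓ : ℕ} {f : ZMod ℓ → V}
    (h : IsInducedCycle G ℓ f) (hℓ : 6 ≤ ℓ) (h3 : ¬ HasCycleStar G 3)
    (hbf : ¬ ContainsInduced G compC4star) (i : ZMod ℓ) (k : ℕ) {x : V}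
    (hx : G.Adj x (f (i + k))) : ¬ G.Adj x (f (i + (k + 1 : ℕ))) := by
  intro hx'
  rw [Nat.cast_succ, ← add_assoc] at hx'
  generalize i + (k : ZMod ℓ) = s at hx hx'
  have A {j k : ℕ} (hj : j + 1 < ℓ) (hk : k + 1 < ℓ) := h.adj_add_natCast s hj hk
  have e0 : f s = f (s + (0 : ℕ)) := by simp
  have e1 : f (s + 1) = f (s + (1 : ℕ)) := by simp
  rw [e0] at hx
  rw [e1] at hx'
  have h01 := (A (j := 0) (k := 1) (by omega) (by omega)).2 (by omega)
  have dom {j : ℕ} (hj : 3 ≤ j) (hj' : j + 1 < ℓ) : G.Adj x (f (s + j)) := by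
    rcases adj_triangle_of_not_hasCycleStar h3 hx hx' h01 (f (s + j)) with h | h | h
    · exact h.symm
    · rw [A hj' (by omega)] at h
      omega
    · rw [A hj' (by omega)] at h
      omega
  refine false_of_butterfly hbf h01 ((A (j := 3) (k := 4) (by omega) (by omega)).2 (by omega))
    ?_ ?_ ?_ ?_ hx hx' (dom (by omega) (by omega)) (dom (by omega) (by omega)) <;>
  · rw [A (by omega) (by omega)]
    omega

/-- If `B` is an induced cycle of even length at least 8 in a
reduced graph `R`, then no vertex of `B` is contained in a triangle of `R`. -/
theorem reduced_even_hole_no_triangle {V : Type*} [Fintype V] (R : SimpleGraph V)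
    (hR : IsReducedGraph R) (ℓ : ℕ) (fB : ZMod ℓ → V)
    (h8 : 8 ≤ ℓ) (heven : Even ℓ) (hB : IsInducedCycle R ℓ fB) :
    ∀ (i : ZMod ℓ) (x y : V), ¬ (R.Adj (fB i) x ∧ R.Adj (fB i) y ∧ R.Adj x y) := by
  obtain ⟨-, -, h3, h5, hbf, -⟩ := hR
  rintro i x y ⟨hix, hiy, hxy⟩
  have A {j k : ℕ} (hj : j + 1 < ℓ) (hk : k + 1 < ℓ) := hB.adj_add_natCast i hj hk
  have e0 : fB i = fB (i + (0 : ℕ)) := by simp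
  rw [e0] at hix hiy
  have S {x : V} (k : ℕ) (hx : R.Adj x (fB (i + k))) :=
    hB.not_adj_succ (by omega) h3 hbf i k hx
  have dom {j : ℕ} (hj : 2 ≤ j) (hj' : j + 1 < ℓ) :
      R.Adj x (fB (i + j)) ∨ R.Adj y (fB (i + j)) := by
    rcases adj_triangle_of_not_hasCycleStar h3 hix hiy hxy (fB (i + j)) with h | h | h
    · rw [A hj' (by omega)] at h
      omega
    · exact .inl h.symm
    · exact .inr h.symm
  wlog hx2 : R.Adj x (fB (i + (2 : ℕ))) generalizing x y
  · exact this y x hiy hix hxy.symm (fun hj hj' => (dom hj hj').symm)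
      ((dom le_rfl (by omega)).resolve_left hx2)
  have hy3 := (dom (j := 3) (by omega) (by omega)).resolve_left (S 2 hx2)
  have hx4 := (dom (j := 4) (by omega) (by omega)).resolve_right (S 3 hy3)
  have hy5 := (dom (j := 5) (by omega) (by omega)).resolve_left (S 4 hx4)
  have hy2 : ¬ R.Adj y (fB (i + (2 : ℕ))) := fun h => S 2 h hy3
  refine h5 (hasCycleStar_five (v := fB (i + (6 : ℕ))) hiy.symm
    ((A (j := 0) (k := 1) (by omega) (by omega)).2 (by omega))
    ((A (j := 1) (k := 2) (by omega) (by omega)).2 (by omega))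
    ((A (j := 2) (k := 3) (by omega) (by omega)).2 (by omega))
    hy3.symm (S 0 hiy.symm) ?_ ?_ (fun h => hy2 h.symm) ?_ (fun h => S 5 hy5 h.symm)
    ?_ ?_ ?_ ?_) <;>
  · rw [A (by omega) (by omega)]
    omega
end
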